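/- For a positive integer $N$ write $[N]=\{1,\dots,N\}$, and write $\mathbb{E}_{s\in S}$ for the average over a finite non-empty set $S$. For positive integers $q\le N$ set $M:=\lfloor\sqrt{N/q}\rfloor$ and, for $f_0,f_1,f_2:\mathbb{Z}\to\mathbb{C}$, $$\Lambda_{q,N}(f_0,f_1,f_2):=\mathbb{E}_{x\in[N]}\,\mathbb{E}_{y\in[M]}\,f_0(x)f_1(x+y)f_2(x+qy^2).$$ The cut norm of $f:\mathbb{Z}\to\mathbb{C}$ is $$\|f\|_{q,N}:=\sup\{|\Lambda_{q,N}(f,g_1,g_2)|,\ |\Lambda_{q,N}(g_1,f,g_2)|,\ |\Lambda_{q,N}(g_1,g_2,f)|\},$$ the supremum being over all $g_1,g_2:\mathbb{Z}\to\mathbb{C}$ supported in $[N]$ with $|g_i|\le 1$. Functions on $[N]$ are extended by $0$ to $\mathbb{Z}$. A factor of $[N]$ is a partition of $[N]$; the join of factors is their common refinement (the non-empty intersections of their elements; the join of no factors is $\{[N]\}$). For real $R>0$ and an integer $m\ge 1$, a simple local factor of resolution $R$ and modulus $m$ is the join of the partition of $[N]$ induced by a partition of $\mathbb{R}$ into half-open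 intervals $[r+kR,r+(k+1)R)$, $k\in\mathbb{Z}$, for some $r\in\mathbb{R}$, and the partition of $[N]$ into congruence classes mod $m$. A local factor of dimension $d$, resolution $R$ and modulus $m$ is the join of $d$ simple local factors of resolutions $R_i\ge R$ and moduli $m_i$ with $m=\mathrm{lcm}[m_1,\dots,m_d]$ (the empty lcm being $1$). For a factor $\mathcal{B}$ and $f:[N]\to\mathbb{C}$, put $\Pi_{\mathcal{B}}f(x):=\mathbb{E}_{y\in B_x}f(y)$, where $B_x$ is the element of $\mathcal{B}$ containing $x$. There exist absolute constants $C,c>0$ such that the following holds. Let $q\le N$ be positive integers and $0<\delta\le 1$. Either $N\le C(q/\delta)^C$, or for any function $f:[N]\to[0,1]$ there exists a local factor $\mathcal{B}$ of $[N]$ of dimension $d\le C\delta^{-C}$, resolution at least $c(\delta/q)^CN^{1/2}$, and modulus $qq'$ for some positive integer $q'\le (C/\delta)^{Cd}$, such that $$\|f-\Pi_{\mathcal{B}}f\|_{q,N}\le\delta.$$ -/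

import Mathlib

/-- The length `M = ⌊√(N/q)⌋` of the range of `y`. -/
noncomputable def yRange (q N : ℕ) : ℕ := ⌊Real.sqrt ((N : ℝ) / (q : ℝ))⌋₊

/-- The counting operator `Λ_{q,N}(f₀,f₁,f₂) = 𝔼_{x∈[N]} 𝔼_{y∈[M]} f₀(x) f₁(x+y) f₂(x+qy²)`,
where `M = ⌊√(N/q)⌋`. -/
noncomputable def cntOp (q N : ℕ) (f₀ f₁ f₂ : ℤ → ℂ) : ℂ :=
  (∑ x ∈ Finset.Icc (1 : ℤ) (N : ℤ), ∑ y ∈ Finset.Icc (1 : ℤ) (yRange q N : ℤ),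
      f₀ x * f₁ (x + y) * f₂ (x + (q : ℤ) * y ^ 2)) /
    ((N : ℂ) * (yRange q N : ℂ))

/-- The cut norm `‖f‖_{q,N}`: the supremum over all 1-bounded `g₁, g₂` supported in `[N]`
(the set is nonempty and bounded above, since all sums are finite). -/
noncomputable def cutNorm (q N : ℕ) (f : ℤ → ℂ) : ℝ :=
  sSup {r : ℝ | ∃ g₁ g₂ : ℤ → ℂ,
    (∀ x, ‖g₁ x‖ ≤ 1) ∧ (∀ x, ‖g₂ x‖ ≤ 1) ∧
    (∀ x, g₁ x ≠ 0 → x ∈ Finset.Icc (1 : ℤ) (N : ℤ)) ∧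
    (∀ x, g₂ x ≠ 0 → x ∈ Finset.Icc (1 : ℤ) (N : ℤ)) ∧
    (r = ‖cntOp q N f g₁ g₂‖ ∨ r = ‖cntOp q N g₁ f g₂‖ ∨ r = ‖cntOp q N g₁ g₂ f‖)}

/-- Two integers lie in the same part of the factor (partition) `𝓑` of `[N]`. -/
def SamePart {N : ℕ} (𝓑 : Finpartition (Finset.Icc (1 : ℤ) (N : ℤ))) (x y : ℤ) : Prop :=
  ∃ B ∈ 𝓑.parts, x ∈ B ∧ y ∈ B

/-- `𝓑` is a *simple local factor* of resolution `M` and modulus `q`: the join of the partition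
of `[N]` induced by the intervals `[r + kM, r + (k+1)M)`, `k ∈ ℤ`, for some real `r`, and the
partition into congruence classes mod `q`. -/
def IsSimpleLocalFactor {N : ℕ} (𝓑 : Finpartition (Finset.Icc (1 : ℤ) (N : ℤ)))
    (M : ℝ) (q : ℕ) : Prop :=
  0 < M ∧ 0 < q ∧
    ∃ r : ℝ, ∀ x y : ℤ, x ∈ Finset.Icc (1 : ℤ) (N : ℤ) → y ∈ Finset.Icc (1 : ℤ) (N : ℤ) →
      (SamePart 𝓑 x y ↔
        (⌊((x : ℝ) - r) / M⌋ = ⌊((y : ℝ) - r) / M⌋ ∧ x % (q : ℤ) = y % (q : ℤ)))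

/-- `𝓑` is a *local factor* of dimension `d`, resolution (at least) `M` and modulus `q`:
the join of `d` simple local factors of resolutions `Ms i ≥ M` and moduli `qs i`, with
`q = lcm (qs 1, …, qs d)`. -/
def IsLocalFactor {N : ℕ} (𝓑 : Finpartition (Finset.Icc (1 : ℤ) (N : ℤ)))
    (d : ℕ) (M : ℝ) (q : ℕ) : Prop :=
  ∃ (Ms : Fin d → ℝ) (qs : Fin d → ℕ)
      (Bs : Fin d → Finpartition (Finset.Icc (1 : ℤ) (N : ℤ))),
    (∀ i, IsSimpleLocalFactor (Bs i) (Ms i) (qs i)) ∧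
    (∀ i, M ≤ Ms i) ∧
    q = Finset.univ.lcm qs ∧
    ∀ x y : ℤ, x ∈ Finset.Icc (1 : ℤ) (N : ℤ) → y ∈ Finset.Icc (1 : ℤ) (N : ℤ) →
      (SamePart 𝓑 x y ↔ ∀ i, SamePart (Bs i) x y)

/-- The projection `Π_𝓑 f` of `f` onto the factor `𝓑`: on each part, the average of `f`
over that part (and `0` outside `[N]`). -/
noncomputable def factorProj {N : ℕ} (𝓑 : Finpartition (Finset.Icc (1 : ℤ) (N : ℤ)))
    (f : ℤ → ℂ) (x : ℤ) : ℂ :=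
  ∑ B ∈ 𝓑.parts, if x ∈ B then (∑ y ∈ B, f y) / (B.card : ℂ) else 0

namespace PolyRoth

open Finset
open scoped BigOperators ComplexConjugate

set_option linter.unusedSectionVars false

section Averages
variable {ι κ μ : Type*}

lemma norm_expect_le (s : Finset ι) (f : ι → ℂ) : ‖𝔼 i ∈ s, f i‖ ≤ 𝔼 i ∈ s, ‖f i‖ := by
  rw [Finset.expect_eq_sum_div_card, Finset.expect_eq_sum_div_card, norm_div]
  simp only [Complex.norm_natCast]
  gcongr
  exact norm_sum_le _ _

lemma norm_expect_le_of_le {s : Finset ι} {f : ι → ℂ} {a : ℝ} (ha : 0 ≤ a)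
    (h : ∀ i ∈ s, ‖f i‖ ≤ a) : ‖𝔼 i ∈ s, f i‖ ≤ a := by
  rcases s.eq_empty_or_nonempty with rfl | hs
  · simpa using ha
  · exact (norm_expect_le s f).trans (Finset.expect_le hs h)

lemma expect_le_of_le {s : Finset ι} {f : ι → ℝ} {a : ℝ} (ha : 0 ≤ a)
    (h : ∀ i ∈ s, f i ≤ a) : 𝔼 i ∈ s, f i ≤ a := by
  rcases s.eq_empty_or_nonempty with rfl | hs
  · simpa using ha
  · exact Finset.expect_le hs h

lemma conj_expect (s : Finset ι) (f : ι → ℂ) : conj (𝔼 i ∈ s, f i) = 𝔼 i ∈ s, conj (f i) := by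
  rw [Finset.expect_eq_sum_div_card, Finset.expect_eq_sum_div_card, map_div₀, map_sum, map_natCast]

lemma ofReal_expect (s : Finset ι) (f : ι → ℝ) :
    ((𝔼 i ∈ s, f i : ℝ) : ℂ) = 𝔼 i ∈ s, (f i : ℂ) := by
  rw [Finset.expect_eq_sum_div_card, Finset.expect_eq_sum_div_card]; push_cast; rfl

lemma re_expect (s : Finset ι) (f : ι → ℂ) : (𝔼 i ∈ s, f i).re = 𝔼 i ∈ s, (f i).re := by
  rw [Finset.expect_eq_sum_div_card, Finset.expect_eq_sum_div_card, ← Complex.re_sum]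
  exact Complex.div_natCast_re _ _

lemma sq_expect_le (s : Finset ι) (v : ι → ℝ) : (𝔼 i ∈ s, v i) ^ 2 ≤ 𝔼 i ∈ s, v i ^ 2 := by
  rcases s.eq_empty_or_nonempty with rfl | hs
  · simp
  · have := Finset.expect_mul_sq_le_sq_mul_sq s v (fun _ => (1 : ℝ))
    simpa [Finset.expect_const hs] using this

lemma pow_four_expect_le (s : Finset ι) (v : ι → ℝ) :
    (𝔼 i ∈ s, v i) ^ 4 ≤ 𝔼 i ∈ s, v i ^ 4 := by
  have h1 := sq_expect_le s v
  have h2 := sq_expect_le s (fun i => v i ^ 2)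
  have h3 : ((𝔼 i ∈ s, v i) ^ 2) ^ 2 ≤ (𝔼 i ∈ s, v i ^ 2) ^ 2 := by gcongr
  calc (𝔼 i ∈ s, v i) ^ 4 = ((𝔼 i ∈ s, v i) ^ 2) ^ 2 := by ring
    _ ≤ _ := h3.trans h2
    _ = _ := by simp only [← pow_mul]

lemma pow_eight_expect_le (s : Finset ι) (v : ι → ℝ) :
    (𝔼 i ∈ s, v i) ^ 8 ≤ 𝔼 i ∈ s, v i ^ 8 := by
  have h1 := pow_four_expect_le s v
  have h2 := sq_expect_le s (fun i => v i ^ 4)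
  have h3 : ((𝔼 i ∈ s, v i) ^ 4) ^ 2 ≤ (𝔼 i ∈ s, v i ^ 4) ^ 2 := by
    gcongr
  calc (𝔼 i ∈ s, v i) ^ 8 = ((𝔼 i ∈ s, v i) ^ 4) ^ 2 := by ring
    _ ≤ _ := h3.trans h2
    _ = _ := by simp only [← pow_mul]

lemma normSq_expect (s : Finset ι) (a : ι → ℂ) :
    ((‖𝔼 i ∈ s, a i‖ ^ 2 : ℝ) : ℂ) = 𝔼 i ∈ s, 𝔼 j ∈ s, a i * conj (a j) := by
  rw [← Finset.expect_mul_expect, ← conj_expect, Complex.mul_conj, Complex.normSq_eq_norm_sq]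

/-- Cauchy–Schwarz: a bounded weight that does not matter is removed. -/
lemma normSq_expect_mul_le (s : Finset ι) (b a : ι → ℂ) (hb : ∀ i ∈ s, ‖b i‖ ≤ 1) :
    ‖𝔼 i ∈ s, b i * a i‖ ^ 2 ≤ 𝔼 i ∈ s, ‖a i‖ ^ 2 := by
  have h1 : ‖𝔼 i ∈ s, b i * a i‖ ≤ 𝔼 i ∈ s, ‖a i‖ := by
    refine (norm_expect_le _ _).trans (Finset.expect_le_expect fun i hi => ?_)
    rw [norm_mul]
    exact mul_le_of_le_one_left (norm_nonneg _) (hb i hi)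
  calc ‖𝔼 i ∈ s, b i * a i‖ ^ 2 ≤ (𝔼 i ∈ s, ‖a i‖) ^ 2 := by gcongr
    _ ≤ _ := sq_expect_le _ _

/-- Expanding the square of an average of averages. -/
lemma expect_normSq_expect_le (s : Finset ι) (t : Finset κ) (a : ι → κ → ℂ) :
    𝔼 i ∈ s, ‖𝔼 k ∈ t, a i k‖ ^ 2 ≤
      𝔼 k ∈ t, 𝔼 l ∈ t, ‖𝔼 i ∈ s, a i k * conj (a i l)‖ := by
  have h : ((𝔼 i ∈ s, ‖𝔼 k ∈ t, a i k‖ ^ 2 : ℝ) : ℂ) =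
      𝔼 k ∈ t, 𝔼 l ∈ t, 𝔼 i ∈ s, a i k * conj (a i l) := by
    rw [ofReal_expect]
    simp_rw [normSq_expect]
    rw [Finset.expect_comm]
    refine Finset.expect_congr rfl fun k _ => ?_
    rw [Finset.expect_comm]
  have h0 : 0 ≤ 𝔼 i ∈ s, ‖𝔼 k ∈ t, a i k‖ ^ 2 := Finset.expect_nonneg fun _ _ => by positivity
  calc 𝔼 i ∈ s, ‖𝔼 k ∈ t, a i k‖ ^ 2
      = ‖((𝔼 i ∈ s, ‖𝔼 k ∈ t, a i k‖ ^ 2 : ℝ) : ℂ)‖ := by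
        rw [Complex.norm_real, Real.norm_of_nonneg h0]
    _ ≤ _ := by
        rw [h]
        refine (norm_expect_le _ _).trans (Finset.expect_le_expect fun k _ => ?_)
        exact norm_expect_le _ _

lemma norm_mul_conj_le_one {z w : ℂ} (hz : ‖z‖ ≤ 1) (hw : ‖w‖ ≤ 1) : ‖z * conj w‖ ≤ 1 := by
  rw [norm_mul, RCLike.norm_conj]
  exact mul_le_one₀ hz (norm_nonneg _) hw

lemma norm_mul_le_one {z w : ℂ} (hz : ‖z‖ ≤ 1) (hw : ‖w‖ ≤ 1) : ‖z * w‖ ≤ 1 := by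
  rw [norm_mul]
  exact mul_le_one₀ hz (norm_nonneg _) hw

/-- The two-dimensional box inequality. -/
lemma box_two (A : Finset ι) (B : Finset κ) (b₁ : κ → ℂ) (b₂ : ι → ℂ) (T : ι → κ → ℂ)
    (h₁ : ∀ k ∈ B, ‖b₁ k‖ ≤ 1) (h₂ : ∀ h ∈ A, ‖b₂ h‖ ≤ 1) :
    ‖𝔼 h ∈ A, 𝔼 k ∈ B, b₁ k * b₂ h * T h k‖ ^ 4 ≤
      𝔼 h ∈ A, 𝔼 h' ∈ A, ‖𝔼 k ∈ B, T h k * conj (T h' k)‖ ^ 2 := by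
  have e1 : 𝔼 h ∈ A, 𝔼 k ∈ B, b₁ k * b₂ h * T h k =
      𝔼 k ∈ B, b₁ k * 𝔼 h ∈ A, b₂ h * T h k := by
    rw [Finset.expect_comm]
    simp_rw [Finset.mul_expect, mul_assoc]
  have e2 : ‖𝔼 h ∈ A, 𝔼 k ∈ B, b₁ k * b₂ h * T h k‖ ^ 2 ≤
      𝔼 h ∈ A, 𝔼 h' ∈ A, ‖𝔼 k ∈ B, T h k * conj (T h' k)‖ := by
    rw [e1]
    refine (normSq_expect_mul_le _ _ _ h₁).trans ((expect_normSq_expect_le _ _ _).trans ?_)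
    refine Finset.expect_le_expect fun h hh => Finset.expect_le_expect fun h' hh' => ?_
    have : 𝔼 k ∈ B, b₂ h * T h k * conj (b₂ h' * T h' k) =
        (b₂ h * conj (b₂ h')) * 𝔼 k ∈ B, T h k * conj (T h' k) := by
      rw [Finset.mul_expect]
      refine Finset.expect_congr rfl fun k _ => ?_
      rw [map_mul]; ring
    rw [this, norm_mul]
    exact mul_le_of_le_one_left (norm_nonneg _) (norm_mul_conj_le_one (h₂ h hh) (h₂ h' hh'))
  calc ‖𝔼 h ∈ A, 𝔼 k ∈ B, b₁ k * b₂ h * T h k‖ ^ 4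
      = (‖𝔼 h ∈ A, 𝔼 k ∈ B, b₁ k * b₂ h * T h k‖ ^ 2) ^ 2 := by ring
    _ ≤ (𝔼 h ∈ A, 𝔼 h' ∈ A, ‖𝔼 k ∈ B, T h k * conj (T h' k)‖) ^ 2 := by gcongr
    _ ≤ _ := (sq_expect_le _ _).trans (Finset.expect_le_expect fun h _ => sq_expect_le _ _)

/-- The three-dimensional box inequality. -/
lemma box_three (A : Finset ι) (B : Finset κ) (E : Finset μ) (b₁ : κ → μ → ℂ) (b₂ : ι → μ → ℂ)
    (b₃ : ι → κ → ℂ) (T : ι → κ → μ → ℂ)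
    (h₁ : ∀ k ∈ B, ∀ n ∈ E, ‖b₁ k n‖ ≤ 1) (h₂ : ∀ h ∈ A, ∀ n ∈ E, ‖b₂ h n‖ ≤ 1)
    (h₃ : ∀ h ∈ A, ∀ k ∈ B, ‖b₃ h k‖ ≤ 1) :
    ‖𝔼 l ∈ A, 𝔼 m ∈ B, 𝔼 n ∈ E, b₁ m n * b₂ l n * b₃ l m * T l m n‖ ^ 8 ≤
      𝔼 l ∈ A, 𝔼 l' ∈ A, 𝔼 m ∈ B, 𝔼 m' ∈ B,
        ‖𝔼 n ∈ E, (T l m n * conj (T l' m n)) * conj (T l m' n * conj (T l' m' n))‖ ^ 2 := by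
  have e1 : 𝔼 l ∈ A, 𝔼 m ∈ B, 𝔼 n ∈ E, b₁ m n * b₂ l n * b₃ l m * T l m n =
      𝔼 p ∈ B ×ˢ E, b₁ p.1 p.2 * 𝔼 l ∈ A, b₂ l p.2 * b₃ l p.1 * T l p.1 p.2 := by
    rw [Finset.expect_product, Finset.expect_comm]
    refine Finset.expect_congr rfl fun m _ => ?_
    rw [Finset.expect_comm]
    simp_rw [Finset.mul_expect, mul_assoc]
  have e2 : ‖𝔼 l ∈ A, 𝔼 m ∈ B, 𝔼 n ∈ E, b₁ m n * b₂ l n * b₃ l m * T l m n‖ ^ 2 ≤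
      𝔼 l ∈ A, 𝔼 l' ∈ A, ‖𝔼 m ∈ B, 𝔼 n ∈ E, (b₂ l n * conj (b₂ l' n)) *
        (b₃ l m * conj (b₃ l' m)) * (T l m n * conj (T l' m n))‖ := by
    rw [e1]
    refine (normSq_expect_mul_le _ _ _ ?_).trans ((expect_normSq_expect_le _ _ _).trans ?_)
    · intro p hp
      rw [Finset.mem_product] at hp
      exact h₁ _ hp.1 _ hp.2
    refine Finset.expect_le_expect fun l _ => Finset.expect_le_expect fun l' _ => le_of_eq ?_
    rw [Finset.expect_product]
    congr 1
    refine Finset.expect_congr rfl fun m _ => Finset.expect_congr rfl fun n _ => ?_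
    simp only [map_mul]; ring
  have e3 : ∀ l ∈ A, ∀ l' ∈ A, ‖𝔼 m ∈ B, 𝔼 n ∈ E, (b₂ l n * conj (b₂ l' n)) *
        (b₃ l m * conj (b₃ l' m)) * (T l m n * conj (T l' m n))‖ ^ 4 ≤
      𝔼 m ∈ B, 𝔼 m' ∈ B,
        ‖𝔼 n ∈ E, (T l m n * conj (T l' m n)) * conj (T l m' n * conj (T l' m' n))‖ ^ 2 :=
    fun l hl l' hl' => box_two B E (fun n => b₂ l n * conj (b₂ l' n))
      (fun m => b₃ l m * conj (b₃ l' m)) (fun m n => T l m n * conj (T l' m n))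
      (fun n hn => norm_mul_conj_le_one (h₂ l hl n hn) (h₂ l' hl' n hn))
      (fun m hm => norm_mul_conj_le_one (h₃ l hl m hm) (h₃ l' hl' m hm))
  calc ‖𝔼 l ∈ A, 𝔼 m ∈ B, 𝔼 n ∈ E, b₁ m n * b₂ l n * b₃ l m * T l m n‖ ^ 8
      = (‖𝔼 l ∈ A, 𝔼 m ∈ B, 𝔼 n ∈ E, b₁ m n * b₂ l n * b₃ l m * T l m n‖ ^ 2) ^ 4 := by ring
    _ ≤ (𝔼 l ∈ A, 𝔼 l' ∈ A, ‖𝔼 m ∈ B, 𝔼 n ∈ E, (b₂ l n * conj (b₂ l' n)) *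
        (b₃ l m * conj (b₃ l' m)) * (T l m n * conj (T l' m n))‖) ^ 4 := by gcongr
    _ ≤ _ := (pow_four_expect_le _ _).trans (Finset.expect_le_expect fun l hl =>
        (pow_four_expect_le _ _).trans (Finset.expect_le_expect fun l' hl' => e3 l hl l' hl'))

/-- If an average of quantities in `[0,1]` is at least `ε` and each term that is at least `ε / 2`
forces `A` to be at least `η`, then `A` is at least `ε η / 2` on average. -/
lemma le_expect_of_imp {s : Finset ι} {S A : ι → ℝ} {ε η : ℝ} (hε : 0 ≤ ε) (hη : 0 ≤ η)
    (hS : ∀ i ∈ s, S i ≤ 1) (hA : ∀ i ∈ s, 0 ≤ A i) (h : ε ≤ 𝔼 i ∈ s, S i)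
    (himp : ∀ i ∈ s, ε / 2 ≤ S i → η ≤ A i) : ε / 2 * η ≤ 𝔼 i ∈ s, A i := by
  rcases s.eq_empty_or_nonempty with rfl | hs
  · simp at h ⊢
    have : ε = 0 := le_antisymm h hε
    simp [this]
  have h1 : ∀ i ∈ s, (S i - ε / 2) * η ≤ A i := by
    intro i hi
    by_cases hc : ε / 2 ≤ S i
    · have := himp i hi hc
      have h2 : S i - ε / 2 ≤ 1 := by linarith [hS i hi]
      nlinarith
    · push Not at hc
      have := hA i hi
      nlinarith
  have h2 := Finset.expect_le_expect h1
  rw [← Finset.expect_mul, Finset.expect_sub_distrib, Finset.expect_const hs] at h2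
  nlinarith

/-- The proportion of indices satisfying a predicate. -/
noncomputable def dens (s : Finset ι) (p : ι → Prop) : ℝ :=
  open Classical in 𝔼 i ∈ s, if p i then (1 : ℝ) else 0

lemma dens_nonneg (s : Finset ι) (p : ι → Prop) : 0 ≤ dens s p :=
  Finset.expect_nonneg fun _ _ => by split_ifs <;> norm_num

lemma dens_mono {s : Finset ι} {p r : ι → Prop} (h : ∀ i ∈ s, p i → r i) :
    dens s p ≤ dens s r := by
  classical
  refine Finset.expect_le_expect fun i hi => ?_
  by_cases hp : p i
  · simp [hp, h i hi hp]
  · simp only [hp, if_false]; split_ifs <;> norm_num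

lemma dens_eq_card_div (s : Finset ι) (p : ι → Prop) [DecidablePred p] :
    dens s p = (#{i ∈ s | p i} : ℝ) / #s := by
  rw [dens, Finset.expect_eq_sum_div_card]
  congr 1
  rw [Finset.card_filter]
  push_cast
  refine Finset.sum_congr rfl fun i _ => ?_
  by_cases h : p i <;> simp [h]

/-- A large average of quantities in `[0,1]` forces many large terms. -/
lemma le_dens_of_le_expect {s : Finset ι} {S : ι → ℝ} {ε : ℝ} (hε : 0 ≤ ε)
    (hS : ∀ i ∈ s, S i ≤ 1) (h : ε ≤ 𝔼 i ∈ s, S i) : ε / 2 ≤ dens s (fun i => ε / 2 ≤ S i) := by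
  classical
  have := le_expect_of_imp (s := s) (S := S)
    (A := fun i => if ε / 2 ≤ S i then (1 : ℝ) else 0) hε zero_le_one hS
    (fun i _ => by split_ifs <;> norm_num) h (fun i _ hi => by simp [hi])
  rw [mul_one] at this
  refine this.trans (le_of_eq (Finset.expect_congr rfl fun i _ => ?_))
  by_cases h : ε / 2 ≤ S i <;> simp [h]

end Averages

section Shifts

lemma expect_Icc_shift_le (M : ℕ) (a : ℤ → ℂ) (ha : ∀ y, ‖a y‖ ≤ 1) (t : ℤ) (ht : 0 ≤ t) :
    ‖(𝔼 y ∈ Icc (1 : ℤ) M, a (y + t)) - 𝔼 y ∈ Icc (1 : ℤ) M, a y‖ ≤ 2 * t / M := by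
  rcases Nat.eq_zero_or_pos M with rfl | hM
  · simp
  rw [Finset.expect_eq_sum_div_card, Finset.expect_eq_sum_div_card, ← sub_div, norm_div]
  simp only [Int.card_Icc, Complex.norm_natCast]
  have hc : ((M : ℤ) + 1 - 1).toNat = M := by omega
  rw [hc]
  have hM' : (0 : ℝ) < M := by exact_mod_cast hM
  gcongr
  have h1 : ∑ y ∈ Icc (1 : ℤ) M, a (y + t) = ∑ y ∈ Icc (1 + t) (M + t), a y := by
    rw [← Finset.image_add_right_Icc, Finset.sum_image (by intro x _ y _ h; simpa using h)]
  rw [h1, ← Finset.sum_sdiff_sub_sum_sdiff]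
  have h2 : ∀ s : Finset ℤ, ‖∑ y ∈ s, a y‖ ≤ #s := fun s =>
    (norm_sum_le _ _).trans (by simpa using Finset.sum_le_card_nsmul s _ 1 (fun y _ => ha y))
  have h3 : Icc (1 + t) (M + t) \ Icc (1 : ℤ) M ⊆ Ioc (M : ℤ) (M + t) := by
    intro y; simp only [mem_sdiff, mem_Icc, mem_Ioc]; omega
  have h4 : Icc (1 : ℤ) M \ Icc (1 + t) (M + t) ⊆ Ioc (0 : ℤ) t := by
    intro y; simp only [mem_sdiff, mem_Icc, mem_Ioc]; omega
  have h5 := Finset.card_le_card h3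
  have h6 := Finset.card_le_card h4
  rw [Int.card_Ioc] at h5 h6
  have h7 : ((#(Icc (1 + t) (M + t) \ Icc (1 : ℤ) M) : ℕ) : ℝ) ≤ t := by
    have : ((#(Icc (1 + t) (M + t) \ Icc (1 : ℤ) M) : ℕ) : ℤ) ≤ t := by omega
    exact_mod_cast this
  have h8 : ((#(Icc (1 : ℤ) M \ Icc (1 + t) (M + t)) : ℕ) : ℝ) ≤ t := by
    have : ((#(Icc (1 : ℤ) M \ Icc (1 + t) (M + t)) : ℕ) : ℤ) ≤ t := by omega
    exact_mod_cast this
  calc _ ≤ _ := norm_sub_le _ _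
    _ ≤ (t : ℝ) + t := add_le_add ((h2 _).trans h7) ((h2 _).trans h8)
    _ = _ := by ring

/-- An average over an interval is stable under averaging over bounded shifts. -/
lemma norm_expect_sub_expect_shift_le {ι : Type*} (M : ℕ) (a : ℤ → ℂ) (ha : ∀ y, ‖a y‖ ≤ 1)
    (s : Finset ι) (hs : s.Nonempty) (φ : ι → ℤ) (B : ℝ) (hφ : ∀ i ∈ s, 0 ≤ φ i ∧ (φ i : ℝ) ≤ B) :
    ‖(𝔼 y ∈ Icc (1 : ℤ) M, a y) - 𝔼 i ∈ s, 𝔼 y ∈ Icc (1 : ℤ) M, a (y + φ i)‖ ≤ 2 * B / M := by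
  have hB : 0 ≤ B := by
    obtain ⟨i, hi⟩ := hs
    exact le_trans (by exact_mod_cast (hφ i hi).1) (hφ i hi).2
  rw [norm_sub_rev, ← Finset.expect_const hs (𝔼 y ∈ Icc (1 : ℤ) M, a y),
    ← Finset.expect_sub_distrib]
  refine norm_expect_le_of_le (by positivity) fun i hi => ?_
  refine (expect_Icc_shift_le M a ha _ (hφ i hi).1).trans ?_
  gcongr
  exact (hφ i hi).2

end Shifts

section Group
variable {G : Type*} [AddCommGroup G] [Fintype G]

lemma expect_add_right {M : Type*} [AddCommMonoid M] [Module ℚ≥0 M] (f : G → M) (t : G) :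
    𝔼 x, f (x + t) = 𝔼 x, f x :=
  Fintype.expect_equiv (Equiv.addRight t) _ _ fun _ => rfl

lemma norm_expect_comp_le {ι : Type*} {f : G → ℂ} (hf : ∀ x, ‖f x‖ ≤ 1) (S : Finset ι)
    (v : ι → G) : ‖𝔼 n ∈ S, f (v n)‖ ≤ 1 :=
  norm_expect_le_of_le zero_le_one fun _ _ => hf _

/-- The multiplicative derivative `x ↦ f x * conj (f (x + t))`. -/
def mulDeriv (t : G) (f : G → ℂ) (x : G) : ℂ := f x * conj (f (x + t))

lemma norm_mulDeriv_le {f : G → ℂ} (hf : ∀ x, ‖f x‖ ≤ 1) (t x : G) : ‖mulDeriv t f x‖ ≤ 1 :=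
  norm_mul_conj_le_one (hf _) (hf _)

lemma mulDeriv_comm (s t : G) (f : G → ℂ) :
    mulDeriv s (mulDeriv t f) = mulDeriv t (mulDeriv s f) := by
  funext x
  simp only [mulDeriv, map_mul, RingHomCompTriple.comp_apply, RingHom.id_apply]
  rw [add_right_comm]; ring

lemma mulDeriv_translate (s t : G) (f : G → ℂ) :
    mulDeriv t (fun x => f (x + s)) = fun x => mulDeriv t f (x + s) := by
  funext x
  simp only [mulDeriv]
  rw [add_right_comm]

/-- The mean square of the averages of `f` over the translates of `{v n : n ∈ S}`. -/
noncomputable def sqAvg {ι : Type*} (S : Finset ι) (v : ι → G) (f : G → ℂ) : ℝ :=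
  𝔼 x, ‖𝔼 n ∈ S, f (x + v n)‖ ^ 2

variable {ι : Type*}

lemma sqAvg_nonneg (S : Finset ι) (v : ι → G) (f : G → ℂ) : 0 ≤ sqAvg S v f :=
  Finset.expect_nonneg fun _ _ => by positivity

lemma sqAvg_le_one (S : Finset ι) (v : ι → G) {f : G → ℂ} (hf : ∀ x, ‖f x‖ ≤ 1) :
    sqAvg S v f ≤ 1 :=
  expect_le_of_le zero_le_one fun x _ => pow_le_one₀ (norm_nonneg _)
    (norm_expect_comp_le hf S fun n => x + v n)

lemma sqAvg_eq (S : Finset ι) (v : ι → G) (f : G → ℂ) :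
    (sqAvg S v f : ℂ) = 𝔼 n ∈ S, 𝔼 m ∈ S, 𝔼 x, mulDeriv (v m - v n) f x := by
  rw [sqAvg, ofReal_expect]
  simp_rw [normSq_expect]
  rw [Finset.expect_comm]
  refine Finset.expect_congr rfl fun n _ => ?_
  rw [Finset.expect_comm]
  refine Finset.expect_congr rfl fun m _ => ?_
  rw [← expect_add_right (fun x => mulDeriv (v m - v n) f x) (v n)]
  refine Finset.expect_congr rfl fun x _ => ?_
  simp only [mulDeriv]
  congr 3
  abel

lemma sqAvg_translate (S : Finset ι) (v : ι → G) (f : G → ℂ) (s : G) :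
    sqAvg S v (fun x => f (x + s)) = sqAvg S v f := by
  rw [sqAvg, sqAvg, ← expect_add_right (fun x => ‖𝔼 n ∈ S, f (x + v n)‖ ^ 2) s]
  refine Finset.expect_congr rfl fun x _ => ?_
  simp only [add_right_comm x s]

variable (Γ : AddSubgroup G) [Fintype Γ]

/-- The mean square of the averages of `f` over the cosets of `Γ`. -/
noncomputable def gowersOne (f : G → ℂ) : ℝ := sqAvg (univ : Finset Γ) (fun s => (s : G)) f

/-- The `U²` functional along `Γ`. -/
noncomputable def gowersTwo (f : G → ℂ) : ℝ := 𝔼 t : Γ, gowersOne Γ (mulDeriv (t : G) f)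

/-- The `U³` functional along `Γ`. -/
noncomputable def gowersThree (f : G → ℂ) : ℝ := 𝔼 t : Γ, gowersTwo Γ (mulDeriv (t : G) f)

/-- The `U⁴` functional along `Γ`. -/
noncomputable def gowersFour (f : G → ℂ) : ℝ := 𝔼 t : Γ, gowersThree Γ (mulDeriv (t : G) f)

lemma gowersOne_nonneg (f : G → ℂ) : 0 ≤ gowersOne Γ f := sqAvg_nonneg _ _ _
lemma gowersOne_le_one {f : G → ℂ} (hf : ∀ x, ‖f x‖ ≤ 1) : gowersOne Γ f ≤ 1 :=
  sqAvg_le_one _ _ hf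
lemma gowersOne_eq (f : G → ℂ) :
    (gowersOne Γ f : ℂ) = 𝔼 s : Γ, 𝔼 x, mulDeriv (s : G) f x := by
  rw [gowersOne, sqAvg_eq]
  have : ∀ n : Γ, 𝔼 m : Γ, 𝔼 x, mulDeriv ((m : G) - (n : G)) f x =
      𝔼 s : Γ, 𝔼 x, mulDeriv (s : G) f x := by
    intro n
    refine Fintype.expect_equiv (Equiv.subRight n) _ _ fun m => ?_
    simp
  simp_rw [this]
  exact Fintype.expect_const _

lemma gowersOne_eq_re (f : G → ℂ) :
    gowersOne Γ f = 𝔼 s : Γ, (𝔼 x, mulDeriv (s : G) f x).re := by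
  have := congrArg Complex.re (gowersOne_eq Γ f)
  rw [re_expect] at this
  simpa using this

lemma sqAvg_eq_re (S : Finset ι) (v : ι → G) (f : G → ℂ) :
    sqAvg S v f = 𝔼 n ∈ S, 𝔼 m ∈ S, (𝔼 x, mulDeriv (v m - v n) f x).re := by
  have := congrArg Complex.re (sqAvg_eq S v f)
  simpa [re_expect] using this

/-- Interchanging the direction of an average over `Γ` with a thin direction. -/
lemma expect_sqAvg_mulDeriv (S : Finset ι) (v : ι → G) (f : G → ℂ) :
    𝔼 t : Γ, sqAvg S v (mulDeriv (t : G) f) =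
      𝔼 n ∈ S, 𝔼 m ∈ S, gowersOne Γ (mulDeriv (v m - v n) f) := by
  simp_rw [sqAvg_eq_re, gowersOne_eq_re]
  rw [Finset.expect_comm]
  refine Finset.expect_congr rfl fun n _ => ?_
  rw [Finset.expect_comm]
  refine Finset.expect_congr rfl fun m _ => ?_
  refine Finset.expect_congr rfl fun t _ => ?_
  rw [mulDeriv_comm]

end Group

section Counting
variable {G : Type*} [AddCommGroup G] [Fintype G]

/-- The counting operator `𝔼 x, 𝔼 y ∈ [M], f₀ x * f₁ (x + y e) * f₂ (x + y² γ)`. -/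
noncomputable def Lam (e γ : G) (M : ℕ) (f₀ f₁ f₂ : G → ℂ) : ℂ :=
  𝔼 x, 𝔼 y ∈ Icc (1 : ℤ) M, f₀ x * f₁ (x + y • e) * f₂ (x + (y ^ 2) • γ)

lemma mem_Icc_cast {H : ℕ} {h : ℤ} (hh : h ∈ Icc (1 : ℤ) H) : 0 ≤ h ∧ (h : ℝ) ≤ H := by
  rw [mem_Icc] at hh
  exact ⟨by omega, by exact_mod_cast hh.2⟩

lemma Icc_one_nonempty {H : ℕ} (hH : 0 < H) : (Icc (1 : ℤ) H).Nonempty :=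
  ⟨1, by rw [mem_Icc]; omega⟩

lemma Lam_shift (e γ : G) (M : ℕ) {f₀ f₁ f₂ : G → ℂ} (h₀ : ∀ x, ‖f₀ x‖ ≤ 1)
    (h₁ : ∀ x, ‖f₁ x‖ ≤ 1) (h₂ : ∀ x, ‖f₂ x‖ ≤ 1) {κ : Type*} (s : Finset κ) (hs : s.Nonempty)
    (φ : κ → ℤ) (B : ℝ) (hφ : ∀ i ∈ s, 0 ≤ φ i ∧ (φ i : ℝ) ≤ B) :
    ‖Lam e γ M f₀ f₁ f₂ - 𝔼 x, 𝔼 i ∈ s, 𝔼 y ∈ Icc (1 : ℤ) M,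
      f₀ x * f₁ (x + (y + φ i) • e) * f₂ (x + ((y + φ i) ^ 2) • γ)‖ ≤ 2 * B / M := by
  have hB : 0 ≤ B := by
    obtain ⟨i, hi⟩ := hs
    exact le_trans (by exact_mod_cast (hφ i hi).1) (hφ i hi).2
  rw [Lam, ← Finset.expect_sub_distrib]
  refine norm_expect_le_of_le (by positivity) fun x _ => ?_
  exact norm_expect_sub_expect_shift_le M
    (fun y => f₀ x * f₁ (x + y • e) * f₂ (x + (y ^ 2) • γ))
    (fun y => norm_mul_le_one (norm_mul_le_one (h₀ _) (h₁ _)) (h₂ _)) s hs φ B hφ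

/-- Four linear forms along `γ`. -/
noncomputable def linFour (γ : G) (M : ℕ) (α : Fin 4 → ℤ) (g : Fin 4 → G → ℂ) : ℂ :=
  𝔼 y ∈ Icc (1 : ℤ) M, 𝔼 x, g 1 (x + (α 1 * y) • γ) * g 2 (x + (α 2 * y) • γ) *
    g 3 (x + (α 3 * y) • γ) * g 0 (x + (α 0 * y) • γ)

lemma Lam_pow_four_le (e γ : G) (M H : ℕ) (hH : 0 < H) {f₀ f₁ f₂ : G → ℂ}
    (h₀ : ∀ x, ‖f₀ x‖ ≤ 1) (h₁ : ∀ x, ‖f₁ x‖ ≤ 1) (h₂ : ∀ x, ‖f₂ x‖ ≤ 1)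
    (hM : 4 * (H : ℝ) / M ≤ ‖Lam e γ M f₀ f₁ f₂‖) :
    (‖Lam e γ M f₀ f₁ f₂‖ - 4 * H / M) ^ 4 ≤
      𝔼 h ∈ Icc (1 : ℤ) H, 𝔼 h' ∈ Icc (1 : ℤ) H, 𝔼 k ∈ Icc (1 : ℤ) H, 𝔼 k' ∈ Icc (1 : ℤ) H,
        ‖linFour γ M ![2 * (h + k), 2 * (h' + k'), 2 * (h + k'), 2 * (h' + k)]
          ![fun x => f₂ (x + (((h + k) ^ 2) • γ - k • e)),
            fun x => f₂ (x + (((h' + k') ^ 2) • γ - k' • e)),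
            fun x => conj (f₂ (x + (((h + k') ^ 2) • γ - k' • e))),
            fun x => conj (f₂ (x + (((h' + k) ^ 2) • γ - k • e)))]‖ := by
  set S := Icc (1 : ℤ) H with hS
  have hSne : S.Nonempty := Icc_one_nonempty hH
  set T : G × ℤ → ℤ → ℤ → ℂ := fun p h k => f₂ (p.1 - k • e + ((p.2 + h + k) ^ 2) • γ) with hT
  set L' := 𝔼 x : G, 𝔼 p ∈ S ×ˢ S, 𝔼 y ∈ Icc (1 : ℤ) M, f₀ x * f₁ (x + (y + (p.1 + p.2)) • e) *
    f₂ (x + ((y + (p.1 + p.2)) ^ 2) • γ) with hL'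
  have e1 : ‖Lam e γ M f₀ f₁ f₂ - L'‖ ≤ 4 * H / M := by
    refine (Lam_shift e γ M h₀ h₁ h₂ (S ×ˢ S) (hSne.product hSne) (fun p => p.1 + p.2) (2 * H)
      ?_).trans (le_of_eq (by ring))
    intro p hp
    rw [Finset.mem_product] at hp
    have h1 := mem_Icc_cast hp.1
    have h2 := mem_Icc_cast hp.2
    refine ⟨by omega, ?_⟩
    push_cast; linarith [h1.2, h2.2]
  have e2 : L' = 𝔼 p ∈ (univ : Finset G) ×ˢ Icc (1 : ℤ) M, 𝔼 h ∈ S, 𝔼 k ∈ S,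
      f₀ (p.1 - k • e) * f₁ (p.1 + (p.2 + h) • e) * T p h k := by
    rw [Finset.expect_product, hL', Finset.expect_comm]
    simp_rw [Finset.expect_comm (s := (univ : Finset G)) (t := Icc (1 : ℤ) M)]
    rw [Finset.expect_comm]
    refine Finset.expect_congr rfl fun y _ => ?_
    rw [Finset.expect_product, Finset.expect_comm (s := (univ : Finset G))]
    refine Finset.expect_congr rfl fun h _ => ?_
    rw [Finset.expect_comm (s := (univ : Finset G))]
    refine Finset.expect_congr rfl fun k _ => ?_
    rw [← expect_add_right _ (-(k • e))]
    refine Finset.expect_congr rfl fun x _ => ?_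
    simp only [hT]
    have a1 : x + -(k • e) = x - k • e := by abel
    have a2 : x - k • e + (y + (h + k)) • e = x + (y + h) • e := by module
    rw [a1, a2, add_assoc y h k]
  have e3 : ‖L'‖ ^ 4 ≤ 𝔼 h ∈ S, 𝔼 h' ∈ S, 𝔼 k ∈ S, 𝔼 k' ∈ S,
      ‖𝔼 p ∈ (univ : Finset G) ×ˢ Icc (1 : ℤ) M,
        (T p h k * conj (T p h' k)) * conj (T p h k' * conj (T p h' k'))‖ := by
    have b1 : ‖L'‖ ^ 4 ≤ 𝔼 p ∈ (univ : Finset G) ×ˢ Icc (1 : ℤ) M, 𝔼 h ∈ S, 𝔼 h' ∈ S,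
        ‖𝔼 k ∈ S, T p h k * conj (T p h' k)‖ ^ 2 := by
      rw [e2]
      refine le_trans (pow_le_pow_left₀ (norm_nonneg _) (norm_expect_le _ _) 4)
        ((pow_four_expect_le _ _).trans (Finset.expect_le_expect fun p _ => ?_))
      exact box_two S S (fun k => f₀ (p.1 - k • e)) (fun h => f₁ (p.1 + (p.2 + h) • e))
        (fun h k => T p h k) (fun _ _ => h₀ _) (fun _ _ => h₁ _)
    refine b1.trans ?_
    rw [Finset.expect_comm]
    refine Finset.expect_le_expect fun h _ => ?_
    rw [Finset.expect_comm]
    refine Finset.expect_le_expect fun h' _ => ?_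
    exact expect_normSq_expect_le _ _ _
  have e4 : (‖Lam e γ M f₀ f₁ f₂‖ - 4 * H / M) ^ 4 ≤ ‖L'‖ ^ 4 := by
    refine pow_le_pow_left₀ (by linarith) ?_ 4
    have := norm_sub_norm_le (Lam e γ M f₀ f₁ f₂) L'
    linarith
  refine e4.trans (e3.trans (le_of_eq ?_))
  refine Finset.expect_congr rfl fun h _ => Finset.expect_congr rfl fun h' _ =>
    Finset.expect_congr rfl fun k _ => Finset.expect_congr rfl fun k' _ => ?_
  congr 1
  rw [Finset.expect_product, linFour, Finset.expect_comm]
  refine Finset.expect_congr rfl fun y _ => ?_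
  rw [← expect_add_right _ (-((y ^ 2) • γ))]
  refine Finset.expect_congr rfl fun x _ => ?_
  have key : ∀ h k : ℤ, T (x + -(y ^ 2 • γ), y) h k =
      f₂ (x + (2 * (h + k) * y) • γ + ((h + k) ^ 2 • γ - k • e)) := by
    intro h k
    simp only [hT]
    congr 1
    have : (y + h + k) ^ 2 = y ^ 2 + 2 * (h + k) * y + (h + k) ^ 2 := by ring
    rw [this, add_smul, add_smul]
    abel
  simp only [key]
  simp [Matrix.cons_val_zero, Matrix.cons_val_one]
  ring

end Counting

section Control
variable {G : Type*} [AddCommGroup G] [Fintype G]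

lemma expect_product_four {ι κ μ ν : Type*} (s : Finset ι) (t : Finset κ) (u : Finset μ)
    (w : Finset ν) (F : ι → κ → μ → ν → ℝ) :
    𝔼 p ∈ s ×ˢ t ×ˢ u ×ˢ w, F p.1 p.2.1 p.2.2.1 p.2.2.2 =
      𝔼 a ∈ s, 𝔼 b ∈ t, 𝔼 c ∈ u, 𝔼 d ∈ w, F a b c d := by
  simp_rw [Finset.expect_product]

lemma linFour_pow_eight_le (γ : G) (M H : ℕ) (hH : 0 < H) (α : Fin 4 → ℤ) (g : Fin 4 → G → ℂ)
    (hg : ∀ i x, ‖g i x‖ ≤ 1) (hM : 6 * (H : ℝ) / M ≤ ‖linFour γ M α g‖) :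
    (‖linFour γ M α g‖ - 6 * H / M) ^ 8 ≤
      𝔼 l ∈ Icc (1 : ℤ) H, 𝔼 l' ∈ Icc (1 : ℤ) H, 𝔼 m ∈ Icc (1 : ℤ) H, 𝔼 m' ∈ Icc (1 : ℤ) H,
        sqAvg (Icc (1 : ℤ) H) (fun n : ℤ => ((α 0 - α 3) * n) • γ)
          (mulDeriv (((α 0 - α 2) * (m' - m)) • γ)
            (mulDeriv (((α 0 - α 1) * (l' - l)) • γ) (g 0))) := by
  set S := Icc (1 : ℤ) H with hS
  have hSne : S.Nonempty := Icc_one_nonempty hH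
  set a : G → ℤ → ℂ := fun x y => g 1 (x + (α 1 * y) • γ) * g 2 (x + (α 2 * y) • γ) *
    g 3 (x + (α 3 * y) • γ) * g 0 (x + (α 0 * y) • γ) with ha
  set W : G × ℤ → ℤ → ℤ → ℤ → G := fun p l m n => p.1 + (α 0 * p.2 + (α 0 - α 1) * l +
    (α 0 - α 2) * m + (α 0 - α 3) * n) • γ with hW
  set L' := 𝔼 x : G, 𝔼 p ∈ S ×ˢ S ×ˢ S, 𝔼 y ∈ Icc (1 : ℤ) M, a x (y + (p.1 + p.2.1 + p.2.2))
    with hL'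
  have e1 : ‖linFour γ M α g - L'‖ ≤ 6 * H / M := by
    rw [linFour, Finset.expect_comm, hL', ← Finset.expect_sub_distrib]
    refine norm_expect_le_of_le (by positivity) fun x _ => ?_
    refine (norm_expect_sub_expect_shift_le M (a x) (fun y => ?_) (S ×ˢ S ×ˢ S)
      (hSne.product (hSne.product hSne)) (fun p => p.1 + p.2.1 + p.2.2) (3 * H) ?_).trans
      (le_of_eq (by ring))
    · exact norm_mul_le_one (norm_mul_le_one (norm_mul_le_one (hg _ _) (hg _ _)) (hg _ _)) (hg _ _)
    intro p hp
    simp only [Finset.mem_product] at hp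
    have h1 := mem_Icc_cast hp.1
    have h2 := mem_Icc_cast hp.2.1
    have h3 := mem_Icc_cast hp.2.2
    refine ⟨by omega, ?_⟩
    push_cast; linarith [h1.2, h2.2, h3.2]
  have e2 : L' = 𝔼 p ∈ (univ : Finset G) ×ˢ Icc (1 : ℤ) M, 𝔼 l ∈ S, 𝔼 m ∈ S, 𝔼 n ∈ S,
      g 1 (p.1 + (α 1 * p.2 + (α 1 - α 2) * m + (α 1 - α 3) * n) • γ) *
      g 2 (p.1 + (α 2 * p.2 + (α 2 - α 1) * l + (α 2 - α 3) * n) • γ) *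
      g 3 (p.1 + (α 3 * p.2 + (α 3 - α 1) * l + (α 3 - α 2) * m) • γ) * g 0 (W p l m n) := by
    rw [Finset.expect_product, hL', Finset.expect_comm]
    simp_rw [Finset.expect_comm (s := (univ : Finset G)) (t := Icc (1 : ℤ) M)]
    rw [Finset.expect_comm]
    refine Finset.expect_congr rfl fun y _ => ?_
    simp_rw [Finset.expect_product]
    rw [Finset.expect_comm (s := (univ : Finset G))]
    refine Finset.expect_congr rfl fun l _ => ?_
    rw [Finset.expect_comm (s := (univ : Finset G))]
    refine Finset.expect_congr rfl fun m _ => ?_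
    rw [Finset.expect_comm (s := (univ : Finset G))]
    refine Finset.expect_congr rfl fun n _ => ?_
    rw [← expect_add_right _ (-((α 1 * l + α 2 * m + α 3 * n) • γ))]
    refine Finset.expect_congr rfl fun x _ => ?_
    simp only [ha, hW]
    congr 1
    · congr 1
      · congr 1
        · congr 1; module
        · congr 1; module
      · congr 1; module
    · congr 1; module
  have e3 : ‖L'‖ ^ 8 ≤ 𝔼 p ∈ (univ : Finset G) ×ˢ Icc (1 : ℤ) M,
      𝔼 l ∈ S, 𝔼 l' ∈ S, 𝔼 m ∈ S, 𝔼 m' ∈ S, ‖𝔼 n ∈ S,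
        (g 0 (W p l m n) * conj (g 0 (W p l' m n))) *
          conj (g 0 (W p l m' n) * conj (g 0 (W p l' m' n)))‖ ^ 2 := by
    rw [e2]
    refine le_trans (pow_le_pow_left₀ (norm_nonneg _) (norm_expect_le _ _) 8)
      ((pow_eight_expect_le _ _).trans (Finset.expect_le_expect fun p _ => ?_))
    exact box_three S S S _ _ _ (fun l m n => g 0 (W p l m n)) (fun _ _ _ _ => hg _ _)
      (fun _ _ _ _ => hg _ _) (fun _ _ _ _ => hg _ _)
  have e4 : (‖linFour γ M α g‖ - 6 * H / M) ^ 8 ≤ ‖L'‖ ^ 8 := by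
    refine pow_le_pow_left₀ (by linarith) ?_ 8
    have := norm_sub_norm_le (linFour γ M α g) L'
    linarith
  refine e4.trans (e3.trans ?_)
  rw [Finset.expect_comm]
  refine Finset.expect_le_expect fun l _ => ?_
  rw [Finset.expect_comm]
  refine Finset.expect_le_expect fun l' _ => ?_
  rw [Finset.expect_comm]
  refine Finset.expect_le_expect fun m _ => ?_
  rw [Finset.expect_comm]
  refine Finset.expect_le_expect fun m' _ => ?_
  rw [Finset.expect_product, Finset.expect_comm]
  refine expect_le_of_le (sqAvg_nonneg _ _ _) fun y _ => le_of_eq ?_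
  symm
  rw [sqAvg, ← expect_add_right _ ((α 0 * y + (α 0 - α 1) * l + (α 0 - α 2) * m) • γ)]
  refine Finset.expect_congr rfl fun x _ => ?_
  congr 2
  refine Finset.expect_congr rfl fun n _ => ?_
  simp only [mulDeriv, hW]
  congr 1
  · congr 1
    · congr 1; module
    · congr 2; module
  · congr 2
    · congr 1; module
    · congr 2; module

lemma two_pow_le_pow {X : ℝ} (hX : 2 ≤ X) (n : ℕ) : (2 : ℝ) ^ n ≤ X ^ n :=
  pow_le_pow_left₀ (by norm_num) hX n

lemma one_div_le_of_mul_le {X M H : ℝ} (hX : 0 < X) (hM : 0 < M) (h : H * X ≤ M) :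
    H / M ≤ 1 / X := by
  rw [div_le_div_iff₀ hM hX]; linarith

/-- The counting operator is controlled by an average of box norms of `f₂`. -/
lemma Lam_control (e γ : G) (M H : ℕ) (hH : 0 < H) {X : ℝ} (hX : 2 ≤ X) (hHM : H * X ^ 16 ≤ M)
    {f₀ f₁ f₂ : G → ℂ} (h₀ : ∀ x, ‖f₀ x‖ ≤ 1) (h₁ : ∀ x, ‖f₁ x‖ ≤ 1) (h₂ : ∀ x, ‖f₂ x‖ ≤ 1)
    (hL : 1 / X ≤ ‖Lam e γ M f₀ f₁ f₂‖) :
    1 / X ^ 89 ≤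
      𝔼 h ∈ Icc (1 : ℤ) H, 𝔼 h' ∈ Icc (1 : ℤ) H, 𝔼 k ∈ Icc (1 : ℤ) H, 𝔼 k' ∈ Icc (1 : ℤ) H,
      𝔼 l ∈ Icc (1 : ℤ) H, 𝔼 l' ∈ Icc (1 : ℤ) H, 𝔼 m ∈ Icc (1 : ℤ) H, 𝔼 m' ∈ Icc (1 : ℤ) H,
        sqAvg (Icc (1 : ℤ) H) (fun n : ℤ => (2 * (h - h') * n) • γ)
          (mulDeriv ((2 * (k - k') * (m' - m)) • γ)
            (mulDeriv ((2 * (h - h' + (k - k')) * (l' - l)) • γ) f₂)) := by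
  set S := Icc (1 : ℤ) H with hS
  have hX0 : 0 < X := by linarith
  have hH0 : (0 : ℝ) < H := by exact_mod_cast hH
  have hM0 : (0 : ℝ) < M := lt_of_lt_of_le (by positivity) hHM
  have hM' : (H : ℝ) / M ≤ 1 / X ^ 16 := one_div_le_of_mul_le (by positivity) hM0 hHM
  have hx : 1 / X ^ 16 = (1 / X) ^ 4 * (1 / X) ^ 12 := by field_simp
  have hx12 : (1 / X) ^ 12 ≤ (1 / 2) ^ 12 := by gcongr
  have hx1 : 1 / X ^ 16 ≤ (1 / X) ^ 4 * (1 / 2) ^ 12 := by rw [hx]; gcongr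
  have hx3 : (1 / X) ^ 4 ≤ (1 / X) := by
    have : (1 / X) ^ 4 ≤ (1 / X) ^ 1 :=
      pow_le_pow_of_le_one (by positivity) (by rw [div_le_one hX0]; linarith) (by norm_num)
    simpa using this
  set ζ : ℝ := (1 / (2 * X)) ^ 4 with hζdef
  have hζ : ζ = (1 / X) ^ 4 / 16 := by rw [hζdef]; field_simp; norm_num
  have hζ0 : 0 < ζ := by positivity
  have c1 : 6 * (H : ℝ) / M ≤ ζ / 4 := by
    rw [hζ, mul_div_assoc]; linarith [show (0 : ℝ) < (1 / X) ^ 4 by positivity]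
  have c2 : 4 * (H : ℝ) / M ≤ 1 / (2 * X) := by
    rw [mul_div_assoc]
    have : 1 / (2 * X) = (1 / X) / 2 := by field_simp
    rw [this]; linarith [show (0 : ℝ) < (1 / X) ^ 4 by positivity]
  have c3 : 1 / (2 * X) ≤ ‖Lam e γ M f₀ f₁ f₂‖ - 4 * H / M := by
    have : 1 / X = 1 / (2 * X) + 1 / (2 * X) := by field_simp; norm_num
    linarith
  have h1 := Lam_pow_four_le e γ M H hH h₀ h₁ h₂ (by linarith [show 0 < 1 / (2 * X) by positivity])
  have h2 : ζ ≤ _ := (pow_le_pow_left₀ (by positivity) c3 4).trans h1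
  rw [← expect_product_four] at h2 ⊢
  have h3 := le_expect_of_imp (η := (ζ / 4) ^ 8) (A := fun p : ℤ × ℤ × ℤ × ℤ =>
      𝔼 l ∈ Icc (1 : ℤ) H, 𝔼 l' ∈ Icc (1 : ℤ) H, 𝔼 m ∈ Icc (1 : ℤ) H, 𝔼 m' ∈ Icc (1 : ℤ) H,
        sqAvg (Icc (1 : ℤ) H) (fun n : ℤ => (2 * (p.1 - p.2.1) * n) • γ)
          (mulDeriv ((2 * (p.2.2.1 - p.2.2.2) * (m' - m)) • γ)
            (mulDeriv ((2 * (p.1 - p.2.1 + (p.2.2.1 - p.2.2.2)) * (l' - l)) • γ) f₂)))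
    hζ0.le (by positivity) ?_ ?_ h2 ?_
  · refine le_trans ?_ h3
    have e1 : ζ / 2 * (ζ / 4) ^ 8 = 1 / (X ^ 36 * 2 ^ 53) := by
      rw [hζ]; field_simp; norm_num
    rw [e1]
    refine one_div_le_one_div_of_le (by positivity) ?_
    calc X ^ 36 * 2 ^ 53 ≤ X ^ 36 * X ^ 53 := by gcongr
      _ = X ^ 89 := by ring
  · rintro ⟨h, h', k, k'⟩ _
    refine norm_expect_le_of_le zero_le_one fun y _ => norm_expect_le_of_le zero_le_one fun x _ => ?_
    refine norm_mul_le_one (norm_mul_le_one (norm_mul_le_one ?_ ?_) ?_) ?_ <;>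
      simpa using h₂ _
  · intro p _
    exact Finset.expect_nonneg fun _ _ => Finset.expect_nonneg fun _ _ =>
      Finset.expect_nonneg fun _ _ => Finset.expect_nonneg fun _ _ => sqAvg_nonneg _ _ _
  · rintro ⟨h, h', k, k'⟩ _ hp
    have h4 := linFour_pow_eight_le γ M H hH
      ![2 * (h + k), 2 * (h' + k'), 2 * (h + k'), 2 * (h' + k)]
          ![fun x => f₂ (x + (((h + k) ^ 2) • γ - k • e)),
            fun x => f₂ (x + (((h' + k') ^ 2) • γ - k' • e)),
            fun x => conj (f₂ (x + (((h + k') ^ 2) • γ - k' • e))),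
            fun x => conj (f₂ (x + (((h' + k) ^ 2) • γ - k • e)))] ?_ ?_
    · refine (pow_le_pow_left₀ (by positivity) ?_ 8).trans (h4.trans (le_of_eq ?_))
      · simp only at hp; linarith
      refine Finset.expect_congr rfl fun l _ => Finset.expect_congr rfl fun l' _ =>
        Finset.expect_congr rfl fun m _ => Finset.expect_congr rfl fun m' _ => ?_
      have t1 : ∀ n : ℤ, (2 * (h + k) - 2 * (h' + k)) * n = 2 * (h - h') * n := fun n => by ring
      have t2 : (2 * (h + k) - 2 * (h + k')) * (m' - m) = 2 * (k - k') * (m' - m) := by ring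
      have t3 : (2 * (h + k) - 2 * (h' + k')) * (l' - l) =
        2 * (h - h' + (k - k')) * (l' - l) := by ring
      simp only [Matrix.cons_val, t1, t2, t3]
      rw [mulDeriv_translate, mulDeriv_translate, sqAvg_translate]
    · intro i x
      fin_cases i <;> simpa using h₂ _
    · simp only at hp; linarith

end Control

section CountInt

lemma card_Icc_one (H : ℕ) : #(Icc (1 : ℤ) H) = H := by simp

lemma card_le_of_dvd_sub {H w : ℕ} (hw : 0 < w) {A : Finset ℤ} (hA : A ⊆ Icc (1 : ℤ) H)
    (h : ∀ a ∈ A, ∀ b ∈ A, (w : ℤ) ∣ a - b) : (#A : ℝ) ≤ H / w + 1 := by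
  have h1 : #A ≤ #(Icc (0 : ℤ) (H / w : ℕ)) := by
    refine Finset.card_le_card_of_injOn (fun a => a / (w : ℤ)) ?_ ?_
    · intro a ha
      have := mem_Icc.1 (hA ha)
      simp only [coe_Icc, Set.mem_Icc]
      refine ⟨Int.ediv_nonneg (by omega) (by omega), ?_⟩
      push_cast
      exact Int.ediv_le_ediv (by exact_mod_cast hw) this.2
    · intro a ha b hb hab
      obtain ⟨k, hk⟩ := h a ha b hb
      simp only at hab
      have e : a = b + w * k := by linarith
      rw [e, Int.add_mul_ediv_left _ _ (by omega)] at hab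
      have : k = 0 := by linarith
      rw [e, this]; ring
  have h2 : #(Icc (0 : ℤ) (H / w : ℕ)) = H / w + 1 := by
    rw [Int.card_Icc, sub_zero]; norm_cast
  rw [h2] at h1
  calc (#A : ℝ) ≤ ((H / w : ℕ) : ℝ) + 1 := by exact_mod_cast h1
    _ ≤ _ := by gcongr; exact Nat.cast_div_le

lemma card_linear_fiber_le {H : ℕ} {c d : ℤ} (hd : d ≠ 0) (w : ℤ) :
    (#{p ∈ Icc (1 : ℤ) H ×ˢ Icc (1 : ℤ) H | d * p.2 - c * p.1 = w} : ℝ) ≤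
      H * (Int.gcd c d) / (d.natAbs : ℝ) + 1 := by
  classical
  set F := {p ∈ Icc (1 : ℤ) H ×ˢ Icc (1 : ℤ) H | d * p.2 - c * p.1 = w} with hF
  have hg : 0 < Int.gcd c d := Int.gcd_pos_of_ne_zero_right _ hd
  obtain ⟨c', d', hcd, hc', hd'⟩ := Int.exists_gcd_one hg
  have hcop : IsCoprime d' c' := (Int.isCoprime_iff_gcd_eq_one.2 hcd).symm
  generalize Int.gcd c d = g at *
  have hd'0 : d' ≠ 0 := by rintro rfl; exact hd (by rw [hd']; simp)
  have h1 : #F = #(F.image Prod.fst) := by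
    rw [Finset.card_image_of_injOn]
    intro p hp q hq hpq
    have hp' := (mem_filter.1 hp).2
    have hq' := (mem_filter.1 hq).2
    refine Prod.ext hpq ?_
    have hpq' : p.1 = q.1 := hpq
    rw [hpq'] at hp'
    exact mul_left_cancel₀ hd (by linarith)
  rw [h1]
  have h2 := card_le_of_dvd_sub (H := H) (w := d'.natAbs) (Int.natAbs_pos.2 hd'0)
    (A := F.image Prod.fst) ?_ ?_
  · refine h2.trans (le_of_eq ?_)
    have : (d.natAbs : ℝ) = (g : ℝ) * d'.natAbs := by
      rw [hd', Int.natAbs_mul, Int.natAbs_natCast]; push_cast; ring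
    rw [this]
    have : (0 : ℝ) < g := by exact_mod_cast hg
    have : (0 : ℝ) < d'.natAbs := by exact_mod_cast Int.natAbs_pos.2 hd'0
    field_simp
  · intro a ha
    obtain ⟨p, hp, rfl⟩ := mem_image.1 ha
    exact (mem_product.1 (mem_filter.1 hp).1).1
  · intro a ha b hb
    obtain ⟨p, hp, rfl⟩ := mem_image.1 ha
    obtain ⟨r, hr, rfl⟩ := mem_image.1 hb
    have hp' := (mem_filter.1 hp).2
    have hr' := (mem_filter.1 hr).2
    rw [Int.natAbs_dvd]
    refine hcop.dvd_of_dvd_mul_left ?_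
    refine ⟨p.2 - r.2, ?_⟩
    have : (g : ℤ) ≠ 0 := by exact_mod_cast hg.ne'
    refine mul_left_cancel₀ this ?_
    rw [hd', hc'] at hp' hr'
    linarith

/-- Integers in a window `κ + [H]` divisible by `g`, or small, are rare. -/
lemma card_dvd_le {H g : ℕ} (hg : 0 < g) (κ : ℤ) :
    (#{h ∈ Icc (1 : ℤ) H | (g : ℤ) ∣ h + κ} : ℝ) ≤ H / g + 1 := by
  refine card_le_of_dvd_sub hg (filter_subset _ _) fun a ha b hb => ?_
  have := dvd_sub (mem_filter.1 ha).2 (mem_filter.1 hb).2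
  simpa using this

lemma card_abs_lt_le {H : ℕ} (κ : ℤ) (T : ℝ) (hT : 0 ≤ T)
    [DecidablePred fun h : ℤ => |((h + κ : ℤ) : ℝ)| < T] :
    (#{h ∈ Icc (1 : ℤ) H | |((h + κ : ℤ) : ℝ)| < T} : ℝ) ≤ 2 * T + 1 := by
  have h1 : #{h ∈ Icc (1 : ℤ) H | |((h + κ : ℤ) : ℝ)| < T} ≤
      #(Icc (-⌊T⌋ - κ) (⌊T⌋ - κ)) := by
    refine Finset.card_le_card fun h hh => ?_
    have h2 := abs_lt.1 (mem_filter.1 hh).2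
    have h3 : (h + κ : ℤ) ≤ ⌊T⌋ := Int.le_floor.2 h2.2.le
    have h4 : -(h + κ : ℤ) ≤ ⌊T⌋ := Int.le_floor.2 (by push_cast at h2 ⊢; linarith)
    rw [mem_Icc]; omega
  rw [Int.card_Icc] at h1
  have h0 : 0 ≤ ⌊T⌋ := Int.floor_nonneg.2 hT
  have h5 : ((⌊T⌋ - κ + 1 - (-⌊T⌋ - κ)).toNat : ℤ) = 2 * ⌊T⌋ + 1 := by omega
  have h6 : ((⌊T⌋ - κ + 1 - (-⌊T⌋ - κ)).toNat : ℝ) = 2 * ⌊T⌋ + 1 := by exact_mod_cast h5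
  calc _ ≤ ((⌊T⌋ - κ + 1 - (-⌊T⌋ - κ)).toNat : ℝ) := by exact_mod_cast h1
    _ ≤ _ := by rw [h6]; linarith [Int.floor_le T]

/-- A pair of integers is generic at scale `H` if one of them is large and their gcd is small. -/
def Generic (H : ℕ) (X : ℝ) (c d : ℤ) : Prop :=
  (H / (16 * X) ≤ |(c : ℝ)| ∨ H / (16 * X) ≤ |(d : ℝ)|) ∧ (Int.gcd c d : ℝ) ≤ 128 * X

lemma card_not_generic_le {H : ℕ} (hH : 0 < H) {X : ℝ} (hX : 2 ≤ X) (hXH : 8 * X ≤ H)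
    {κ κ' : ℤ} (hκ : |κ| ≤ 2 * H) (hκ' : |κ'| ≤ 2 * H) [∀ c d, Decidable (Generic H X c d)] :
    (#{p ∈ Icc (1 : ℤ) H ×ˢ Icc (1 : ℤ) H | ¬ Generic H X (p.1 + κ) (p.2 + κ')} : ℝ) ≤
      1 / (2 * X) * H ^ 2 := by
  classical
  have hX0 : 0 < X := by linarith
  have hH0 : (0 : ℝ) < H := by exact_mod_cast hH
  set D := ⌊128 * X⌋₊ with hD
  have hD1 : 127 * X ≤ D := by
    have := (Nat.lt_floor_add_one (128 * X)).le
    rw [← hD] at this; linarith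
  have hD0 : D ≠ 0 := by
    intro h; rw [h] at hD1; norm_num at hD1; linarith
  set S := Icc (1 : ℤ) H
  have hsub : {p ∈ S ×ˢ S | ¬ Generic H X (p.1 + κ) (p.2 + κ')} ⊆
      ({h ∈ S | |((h + κ : ℤ) : ℝ)| < H / (16 * X)} ×ˢ S) ∪
      (Ioc D (3 * H)).biUnion fun g =>
        {h ∈ S | (g : ℤ) ∣ h + κ} ×ˢ {h ∈ S | (g : ℤ) ∣ h + κ'} := by
    intro p hp
    obtain ⟨hpS, hpg⟩ := mem_filter.1 hp
    obtain ⟨hp1, hp2⟩ := mem_product.1 hpS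
    rw [mem_union]
    by_cases hs : |((p.1 + κ : ℤ) : ℝ)| < H / (16 * X)
    · left; exact mem_product.2 ⟨mem_filter.2 ⟨hp1, hs⟩, hp2⟩
    · right
      have hs' := not_lt.1 hs
      have hgcd : 128 * X < (Int.gcd (p.1 + κ) (p.2 + κ') : ℝ) := by
        by_contra hcon
        exact hpg ⟨Or.inl hs', not_lt.1 hcon⟩
      have hne : p.1 + κ ≠ 0 := by
        intro h; rw [h] at hs'; simp at hs'
        have : 0 < (H : ℝ) / (16 * X) := by positivity
        linarith
      refine mem_biUnion.2 ⟨Int.gcd (p.1 + κ) (p.2 + κ'), ?_, ?_⟩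
      · rw [mem_Ioc]
        refine ⟨by rw [hD]; exact (Nat.floor_lt (by positivity)).2 hgcd, ?_⟩
        have h1 := Int.gcd_le_natAbs_left (p.2 + κ') hne
        have h2 := abs_le.1 hκ
        rw [mem_Icc] at hp1
        omega
      · exact mem_product.2 ⟨mem_filter.2 ⟨hp1, Int.gcd_dvd_left ..⟩,
          mem_filter.2 ⟨hp2, Int.gcd_dvd_right ..⟩⟩
  have h1 : (#{p ∈ S ×ˢ S | ¬ Generic H X (p.1 + κ) (p.2 + κ')} : ℝ) ≤
      (2 * (H / (16 * X)) + 1) * H + ∑ g ∈ Ioc D (3 * H), (16 * (H : ℝ) ^ 2) * ((g : ℝ) ^ 2)⁻¹ := by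
    have a1 : (#{p ∈ S ×ˢ S | ¬ Generic H X (p.1 + κ) (p.2 + κ')} : ℝ) ≤
        (#({h ∈ S | |((h + κ : ℤ) : ℝ)| < H / (16 * X)} ×ˢ S) : ℝ) +
        ∑ g ∈ Ioc D (3 * H), (#({h ∈ S | (g : ℤ) ∣ h + κ} ×ˢ {h ∈ S | (g : ℤ) ∣ h + κ'}) : ℝ) := by
      have := (Finset.card_le_card hsub).trans ((card_union_le _ _).trans
        (Nat.add_le_add_left card_biUnion_le _))
      exact_mod_cast this
    refine a1.trans (add_le_add ?_ (sum_le_sum fun g hg => ?_))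
    · rw [card_product, card_Icc_one, Nat.cast_mul]
      exact mul_le_mul_of_nonneg_right (card_abs_lt_le κ _ (by positivity)) hH0.le
    · rw [mem_Ioc] at hg
      have hg0 : (0 : ℝ) < g := by exact_mod_cast (by omega : 0 < g)
      have hg3 : (g : ℝ) ≤ 3 * H := by exact_mod_cast hg.2
      have b0 : (H : ℝ) / g + 1 ≤ 4 * H / g := by
        rw [div_add_one hg0.ne']; gcongr; linarith
      have b1 := (card_dvd_le (H := H) (g := g) (by omega) κ).trans b0
      have b2 := (card_dvd_le (H := H) (g := g) (by omega) κ').trans b0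
      rw [card_product]; push_cast
      calc _ ≤ (4 * (H : ℝ) / g) * (4 * H / g) := by gcongr
        _ = _ := by field_simp; norm_num
  refine h1.trans ?_
  rw [← mul_sum]
  have h3 : ∑ g ∈ Ioc D (3 * H), ((g : ℝ) ^ 2)⁻¹ ≤ 1 / (127 * X) := by
    by_cases hc : D ≤ 3 * H
    · refine (sum_Ioc_inv_sq_le_sub hD0 hc).trans ?_
      have : (D : ℝ)⁻¹ ≤ 1 / (127 * X) := by
        rw [← one_div]; exact one_div_le_one_div_of_le (by positivity) hD1
      linarith [show (0 : ℝ) ≤ (((3 * H : ℕ) : ℝ))⁻¹ by positivity]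
    · rw [Ioc_eq_empty (by omega)]; simp; positivity
  have h4 : (H : ℝ) ≤ 1 / (8 * X) * H ^ 2 := by
    rw [div_mul_eq_mul_div, le_div_iff₀ (by positivity)]; nlinarith
  have h5 : 16 * (H : ℝ) ^ 2 * ∑ g ∈ Ioc D (3 * H), ((g : ℝ) ^ 2)⁻¹ ≤
      16 * (H : ℝ) ^ 2 * (1 / (127 * X)) := by gcongr
  have e1 : (2 * ((H : ℝ) / (16 * X)) + 1) * H = (1 / 8) * (H ^ 2 / X) + H := by field_simp; ring
  have e2 : 1 / (8 * X) * (H : ℝ) ^ 2 = (1 / 8) * (H ^ 2 / X) := by field_simp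
  have e3 : 16 * (H : ℝ) ^ 2 * (1 / (127 * X)) = (16 / 127) * (H ^ 2 / X) := by field_simp
  have e4 : 1 / (2 * X) * (H : ℝ) ^ 2 = (1 / 2) * (H ^ 2 / X) := by field_simp
  have e5 : 0 ≤ (H : ℝ) ^ 2 / X := by positivity
  linarith

lemma card_generic_fiber_le {H : ℕ} (hH : 0 < H) {X : ℝ} (hX : 2 ≤ X) {c d : ℤ}
    (h : Generic H X c d) (w : ℤ) :
    (#{p ∈ Icc (1 : ℤ) H ×ˢ Icc (1 : ℤ) H | d * p.2 - c * p.1 = w} : ℝ) ≤ X ^ 14 := by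
  have hX0 : 0 < X := by linarith
  have hH0 : (0 : ℝ) < H := by exact_mod_cast hH
  have key : ∀ {a b : ℤ}, H / (16 * X) ≤ |(b : ℝ)| → (Int.gcd a b : ℝ) ≤ 128 * X → ∀ v,
      (#{p ∈ Icc (1 : ℤ) H ×ˢ Icc (1 : ℤ) H | b * p.2 - a * p.1 = v} : ℝ) ≤ X ^ 14 := by
    intro a b hb hab v
    have hb0 : 0 < |(b : ℝ)| := lt_of_lt_of_le (by positivity) hb
    have hb' : b ≠ 0 := by rintro rfl; simp at hb0
    have e0 : (b.natAbs : ℝ) = |(b : ℝ)| := by rw [Nat.cast_natAbs]; push_cast; rfl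
    refine (card_linear_fiber_le hb' v).trans ?_
    rw [e0]
    have h1 : (H : ℝ) * Int.gcd a b / |(b : ℝ)| ≤ 2048 * X ^ 2 := by
      rw [div_le_iff₀ hb0]
      calc (H : ℝ) * Int.gcd a b ≤ H * (128 * X) := by gcongr
        _ = 2048 * X ^ 2 * (H / (16 * X)) := by field_simp; norm_num
        _ ≤ _ := by gcongr
    have h2 : (4096 : ℝ) ≤ X ^ 12 := by have := two_pow_le_pow hX 12; norm_num at this; linarith
    have h3 : (4 : ℝ) ≤ X ^ 2 := by nlinarith
    calc _ ≤ 2048 * X ^ 2 + 1 := by linarith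
      _ ≤ 4096 * X ^ 2 := by linarith
      _ ≤ X ^ 12 * X ^ 2 := by gcongr
      _ = _ := by ring
  rcases h with ⟨h1 | h1, h2⟩
  · have := key h1 (by rwa [Int.gcd_comm]) (-w)
    refine le_trans (le_of_eq ?_) this
    norm_cast
    refine Finset.card_equiv (Equiv.prodComm _ _) fun p => ?_
    simp only [mem_filter, mem_product, Equiv.prodComm_apply, Prod.fst_swap, Prod.snd_swap]
    constructor
    · rintro ⟨⟨a, b⟩, c⟩; exact ⟨⟨b, a⟩, by linarith⟩
    · rintro ⟨⟨a, b⟩, c⟩; exact ⟨⟨b, a⟩, by linarith⟩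
  · exact key h1 h2 w

end CountInt

section CountGroup
variable {G : Type*} [AddCommGroup G] [Fintype G] (γ : G) [Fintype (AddSubgroup.zmultiples γ)]

lemma expect_generic_le {H : ℕ} (hH : 0 < H) {X : ℝ} (hX : 2 ≤ X)
    (hR : 12 * H ^ 2 < addOrderOf γ) (hR' : (addOrderOf γ : ℝ) ≤ X * H ^ 2)
    {c d : ℤ} (hc : |c| ≤ 3 * H) (hd : |d| ≤ 3 * H)
    (h : Generic H X c d) (V : G → ℝ) (hV : ∀ t, 0 ≤ V t) (k : ℤ) :
    𝔼 m ∈ Icc (1 : ℤ) H, 𝔼 n ∈ Icc (1 : ℤ) H, V ((2 * (d * n - c * m) + k) • γ) ≤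
      X ^ 15 * 𝔼 t : AddSubgroup.zmultiples γ, V (t : G) := by
  classical
  have hX0 : 0 < X := by linarith
  have hH0 : (0 : ℝ) < H := by exact_mod_cast hH
  set S := Icc (1 : ℤ) H
  let Γ := AddSubgroup.zmultiples γ
  let φ : ℤ × ℤ → Γ := fun p => ⟨(2 * (d * p.2 - c * p.1) + k) • γ, AddSubgroup.zsmul_mem_zmultiples γ _⟩
  have hcard : (Fintype.card Γ : ℝ) = addOrderOf γ := by
    rw [← Nat.card_zmultiples, Nat.card_eq_fintype_card]
  have hR0 : (0 : ℝ) < addOrderOf γ := by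
    have : 0 < addOrderOf γ := by omega
    exact_mod_cast this
  have hfib : ∀ t : Γ, (#{p ∈ S ×ˢ S | φ p = t} : ℝ) ≤ X ^ 14 := by
    intro t
    rcases ({p ∈ S ×ˢ S | φ p = t}).eq_empty_or_nonempty with he | ⟨p₀, hp₀⟩
    · rw [he]; simp; positivity
    refine le_trans ?_ (card_generic_fiber_le hH hX h (d * p₀.2 - c * p₀.1))
    norm_cast
    refine Finset.card_le_card fun p hp => ?_
    obtain ⟨h1, h2⟩ := mem_filter.1 hp
    obtain ⟨h3, h4⟩ := mem_filter.1 hp₀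
    refine mem_filter.2 ⟨h1, ?_⟩
    have h5 : (2 * (d * p.2 - c * p.1) + k) • γ = (2 * (d * p₀.2 - c * p₀.1) + k) • γ :=
      congrArg Subtype.val (h2.trans h4.symm)
    rw [zsmul_eq_zsmul_iff_modEq] at h5
    obtain ⟨h6, h7⟩ := mem_product.1 h1
    obtain ⟨h8, h9⟩ := mem_product.1 h3
    rw [mem_Icc] at h6 h7 h8 h9
    have h10 := Int.modEq_iff_dvd.1 h5
    have h11 : |(2 * (d * p₀.2 - c * p₀.1) + k) - (2 * (d * p.2 - c * p.1) + k)| <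
        (addOrderOf γ : ℤ) := by
      have e : (2 * (d * p₀.2 - c * p₀.1) + k) - (2 * (d * p.2 - c * p.1) + k) =
        2 * (d * (p₀.2 - p.2)) - 2 * (c * (p₀.1 - p.1)) := by ring
      rw [e]
      have a1 : |d * (p₀.2 - p.2)| ≤ 3 * H * H := by
        rw [abs_mul]
        exact mul_le_mul hd (abs_le.2 ⟨by omega, by omega⟩) (abs_nonneg _) (by omega)
      have a2 : |c * (p₀.1 - p.1)| ≤ 3 * H * H := by
        rw [abs_mul]
        exact mul_le_mul hc (abs_le.2 ⟨by omega, by omega⟩) (abs_nonneg _) (by omega)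
      have hR2 : (12 * H ^ 2 : ℤ) < addOrderOf γ := by exact_mod_cast hR
      have a3 := abs_le.1 a1
      have a4 := abs_le.1 a2
      rw [abs_lt]
      constructor <;> nlinarith
    have := Int.eq_zero_of_abs_lt_dvd h10 h11
    linarith
  have h1 : ∑ p ∈ S ×ˢ S, V (φ p : G) ≤ X ^ 14 * ∑ t : Γ, V (t : G) := by
    rw [← Finset.sum_fiberwise (S ×ˢ S) φ, mul_sum]
    refine sum_le_sum fun t _ => ?_
    rw [sum_congr rfl (g := fun _ => V (t : G)) fun p hp => by rw [(mem_filter.1 hp).2],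
      sum_const, nsmul_eq_mul]
    exact mul_le_mul_of_nonneg_right (hfib t) (hV _)
  have h2 : 𝔼 m ∈ S, 𝔼 n ∈ S, V ((2 * (d * n - c * m) + k) • γ) =
      (∑ p ∈ S ×ˢ S, V (φ p : G)) / (H : ℝ) ^ 2 := by
    rw [← Finset.expect_product (s := S) (t := S)
      (f := fun p : ℤ × ℤ => V ((2 * (d * p.2 - c * p.1) + k) • γ)),
      Finset.expect_eq_sum_div_card, card_product, card_Icc_one]
    push_cast
    rw [sq]
  rw [h2, Fintype.expect_eq_sum_div_card, hcard, div_le_iff₀ (by positivity)]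
  refine h1.trans ?_
  have h3 : 0 ≤ ∑ t : Γ, V (t : G) := sum_nonneg fun _ _ => hV _
  have h4 : 1 ≤ X * H ^ 2 / (addOrderOf γ : ℝ) := by rw [le_div_iff₀ hR0]; linarith
  calc X ^ 14 * ∑ t : Γ, V (t : G) ≤ X ^ 14 * (∑ t : Γ, V (t : G)) * (X * H ^ 2 / addOrderOf γ) :=
        le_mul_of_one_le_right (by positivity) h4
    _ = _ := by field_simp; rfl

/-- Averages of `V` over generic bilinear values along `γ` are dominated by averages over `Γ`. -/
lemma expect_bilinear_le {H : ℕ} (hH : 0 < H) {X : ℝ} (hX : 2 ≤ X) (hXH : 8 * X ≤ H)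
    (hR : 12 * H ^ 2 < addOrderOf γ) (hR' : (addOrderOf γ : ℝ) ≤ X * H ^ 2)
    {κ κ' : ℤ} (hκ : |κ| ≤ 2 * H) (hκ' : |κ'| ≤ 2 * H)
    (V : ℤ → ℤ → G → ℝ) (hV : ∀ h h' t, 0 ≤ V h h' t) (hV1 : ∀ h h' t, V h h' t ≤ 1) :
    𝔼 h ∈ Icc (1 : ℤ) H, 𝔼 h' ∈ Icc (1 : ℤ) H,
      𝔼 m₁ ∈ Icc (1 : ℤ) H, 𝔼 m₂ ∈ Icc (1 : ℤ) H, 𝔼 n₁ ∈ Icc (1 : ℤ) H, 𝔼 n₂ ∈ Icc (1 : ℤ) H,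
        V h h' ((2 * ((h' + κ') * (n₁ - n₂) - (h + κ) * (m₁ - m₂))) • γ) ≤
      1 / (2 * X) + X ^ 15 * 𝔼 h ∈ Icc (1 : ℤ) H, 𝔼 h' ∈ Icc (1 : ℤ) H,
        𝔼 t : AddSubgroup.zmultiples γ, V h h' (t : G) := by
  classical
  have hX0 : 0 < X := by linarith
  have hH0 : (0 : ℝ) < H := by exact_mod_cast hH
  set S := Icc (1 : ℤ) H
  have hS : S.Nonempty := Icc_one_nonempty hH
  have hpt : ∀ h ∈ S, ∀ h' ∈ S,
      𝔼 m₁ ∈ S, 𝔼 m₂ ∈ S, 𝔼 n₁ ∈ S, 𝔼 n₂ ∈ S,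
        V h h' ((2 * ((h' + κ') * (n₁ - n₂) - (h + κ) * (m₁ - m₂))) • γ) ≤
      (if ¬ Generic H X (h + κ) (h' + κ') then (1 : ℝ) else 0) +
        X ^ 15 * 𝔼 t : AddSubgroup.zmultiples γ, V h h' (t : G) := by
    intro h hh h' hh'
    have hnn : 0 ≤ X ^ 15 * 𝔼 t : AddSubgroup.zmultiples γ, V h h' (t : G) :=
      mul_nonneg (by positivity) (Finset.expect_nonneg fun _ _ => hV _ _ _)
    by_cases hg : Generic H X (h + κ) (h' + κ')
    · simp only [hg, not_true, if_false, zero_add]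
      have e1 : 𝔼 m₁ ∈ S, 𝔼 m₂ ∈ S, 𝔼 n₁ ∈ S, 𝔼 n₂ ∈ S,
          V h h' ((2 * ((h' + κ') * (n₁ - n₂) - (h + κ) * (m₁ - m₂))) • γ) =
          𝔼 m₂ ∈ S, 𝔼 n₂ ∈ S, 𝔼 m₁ ∈ S, 𝔼 n₁ ∈ S,
          V h h' ((2 * ((h' + κ') * n₁ - (h + κ) * m₁) +
            2 * ((h + κ) * m₂ - (h' + κ') * n₂)) • γ) := by
        rw [Finset.expect_comm]
        refine Finset.expect_congr rfl fun m₂ _ => ?_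
        simp_rw [Finset.expect_comm (s := S) (t := S) (f := fun n₁ n₂ =>
          V h h' ((2 * ((h' + κ') * (n₁ - n₂) - (h + κ) * (_ - m₂))) • γ))]
        rw [Finset.expect_comm]
        refine Finset.expect_congr rfl fun n₂ _ => Finset.expect_congr rfl fun m₁ _ =>
          Finset.expect_congr rfl fun n₁ _ => ?_
        congr 2; ring
      rw [e1]
      rw [mem_Icc] at hh hh'
      rw [abs_le] at hκ hκ'
      refine Finset.expect_le hS fun m₂ _ => Finset.expect_le hS fun n₂ _ => ?_
      exact expect_generic_le γ hH hX hR hR' (abs_le.2 ⟨by omega, by omega⟩)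
        (abs_le.2 ⟨by omega, by omega⟩) hg (V h h') (hV h h') _
    · simp only [hg, not_false_iff, if_true]
      have : 𝔼 m₁ ∈ S, 𝔼 m₂ ∈ S, 𝔼 n₁ ∈ S, 𝔼 n₂ ∈ S,
        V h h' ((2 * ((h' + κ') * (n₁ - n₂) - (h + κ) * (m₁ - m₂))) • γ) ≤ 1 :=
        expect_le_of_le zero_le_one fun _ _ => expect_le_of_le zero_le_one fun _ _ =>
          expect_le_of_le zero_le_one fun _ _ => expect_le_of_le zero_le_one fun _ _ => hV1 _ _ _
      linarith
  refine (Finset.expect_le_expect fun h hh => Finset.expect_le_expect fun h' hh' =>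
    hpt h hh h' hh').trans ?_
  simp_rw [Finset.expect_add_distrib, ← Finset.mul_expect]
  refine add_le_add ?_ le_rfl
  rw [← Finset.expect_product (s := S) (t := S)
      (f := fun p : ℤ × ℤ => if ¬ Generic H X (p.1 + κ) (p.2 + κ') then (1 : ℝ) else 0),
    Finset.expect_eq_sum_div_card, card_product, card_Icc_one, Finset.sum_boole]
  push_cast
  rw [div_le_iff₀ (by positivity), ← sq]
  exact card_not_generic_le hH hX hXH hκ hκ'

end CountGroup

section Degree
variable {G : Type*} [AddCommGroup G] [Fintype G] {ι κ μ ν : Type*}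

lemma expect_product_three (s : Finset ι) (t : Finset κ) (u : Finset μ) (F : ι → κ → μ → ℝ) :
    𝔼 p ∈ s ×ˢ t ×ˢ u, F p.1 p.2.1 p.2.2 = 𝔼 a ∈ s, 𝔼 b ∈ t, 𝔼 c ∈ u, F a b c := by
  simp_rw [Finset.expect_product]

lemma expect_rotate {E : Type*} [AddCommMonoid E] [Module ℚ≥0 E] (s : Finset ι) (t : Finset κ)
    (u : Finset μ) (f : ι → κ → μ → E) :
    𝔼 a ∈ s, 𝔼 b ∈ t, 𝔼 c ∈ u, f a b c = 𝔼 c ∈ u, 𝔼 a ∈ s, 𝔼 b ∈ t, f a b c := by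
  simp_rw [Finset.expect_comm (s := t) (t := u)]
  rw [Finset.expect_comm]

lemma expect_rotate_four {E : Type*} [AddCommMonoid E] [Module ℚ≥0 E] (s : Finset ι)
    (t : Finset κ) (u : Finset μ) (v : Finset ν) (f : ι → κ → μ → ν → E) :
    𝔼 a ∈ s, 𝔼 b ∈ t, 𝔼 c ∈ u, 𝔼 d ∈ v, f a b c d =
      𝔼 d ∈ v, 𝔼 a ∈ s, 𝔼 b ∈ t, 𝔼 c ∈ u, f a b c d := by
  simp_rw [expect_rotate t u v]
  rw [Finset.expect_comm]

lemma expect_rotate_five {E ρ : Type*} [AddCommMonoid E] [Module ℚ≥0 E] (s : Finset ι)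
    (t : Finset κ) (u : Finset μ) (v : Finset ν) (w : Finset ρ) (f : ι → κ → μ → ν → ρ → E) :
    𝔼 a ∈ s, 𝔼 b ∈ t, 𝔼 c ∈ u, 𝔼 d ∈ v, 𝔼 e ∈ w, f a b c d e =
      𝔼 e ∈ w, 𝔼 a ∈ s, 𝔼 b ∈ t, 𝔼 c ∈ u, 𝔼 d ∈ v, f a b c d e := by
  simp_rw [expect_rotate_four t u v w]
  rw [Finset.expect_comm]

lemma sq_expect_gowersOne_le (Γ : AddSubgroup G) [Fintype Γ] (I : Finset ι) (t : ι → G)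
    {w : G → ℂ} (hw : ∀ x, ‖w x‖ ≤ 1) :
    (𝔼 i ∈ I, gowersOne Γ (mulDeriv (t i) w)) ^ 2 ≤
      𝔼 i ∈ I, 𝔼 j ∈ I, gowersOne Γ (mulDeriv (t j - t i) w) := by
  rw [← expect_sqAvg_mulDeriv]
  have h1 : ((𝔼 i ∈ I, gowersOne Γ (mulDeriv (t i) w) : ℝ) : ℂ) =
      𝔼 s : Γ, 𝔼 x, mulDeriv (s : G) w x * 𝔼 i ∈ I, conj (mulDeriv (s : G) w (x + t i)) := by
    rw [ofReal_expect]
    simp_rw [gowersOne_eq, Finset.mul_expect]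
    rw [Finset.expect_comm]
    refine Finset.expect_congr rfl fun s _ => ?_
    rw [Finset.expect_comm]
    refine Finset.expect_congr rfl fun x _ => Finset.expect_congr rfl fun i _ => ?_
    rw [mulDeriv_comm]; rfl
  have h2 : (𝔼 i ∈ I, gowersOne Γ (mulDeriv (t i) w)) ^ 2 =
      ‖𝔼 s : Γ, 𝔼 x, mulDeriv (s : G) w x *
        𝔼 i ∈ I, conj (mulDeriv (s : G) w (x + t i))‖ ^ 2 := by
    rw [← h1, Complex.norm_real, Real.norm_eq_abs, sq_abs]
  rw [h2]
  refine (pow_le_pow_left₀ (norm_nonneg _) (norm_expect_le _ _) 2).trans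
    ((sq_expect_le _ _).trans (Finset.expect_le_expect fun s _ => ?_))
  refine (normSq_expect_mul_le _ _ _ fun x _ => norm_mulDeriv_le hw _ _).trans (le_of_eq ?_)
  refine Finset.expect_congr rfl fun x _ => ?_
  rw [← conj_expect, RCLike.norm_conj]

variable (γ : G) [Fintype (AddSubgroup.zmultiples γ)]
local notation "Γ" => AddSubgroup.zmultiples γ

/-- Averaged large values along thin bilinear directions give large `U²`. -/
lemma gowersTwo_of_bilinear {H : ℕ} {X : ℝ} (hX : 2 ≤ X) (hXH : X ^ 5 ≤ H)
    (hR : 12 * H ^ 2 < addOrderOf γ) (hR' : (addOrderOf γ : ℝ) ≤ X * H ^ 2)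
    (J : Finset ι) (c : ι → ℤ) (hc : ∀ j ∈ J, |c j| ≤ 2 * H) (w : ι → G → ℂ)
    (hw : ∀ j x, ‖w j x‖ ≤ 1)
    (h : 1 / X ≤ 𝔼 j ∈ J, 𝔼 h ∈ Icc (1 : ℤ) H, 𝔼 m ∈ Icc (1 : ℤ) H, 𝔼 m' ∈ Icc (1 : ℤ) H,
      gowersOne Γ (mulDeriv ((2 * (h + c j) * (m' - m)) • γ) (w j))) :
    1 / X ^ 33 ≤ 𝔼 j ∈ J, gowersTwo Γ (w j) := by
  have hX0 : 0 < X := by linarith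
  have hH0 : (0 : ℝ) < H := lt_of_lt_of_le (by positivity) hXH
  have hH : 0 < H := by exact_mod_cast hH0
  set S := Icc (1 : ℤ) H with hS
  have hSn : S.Nonempty := Icc_one_nonempty hH
  have hX1 : (1 : ℝ) ≤ X := by linarith
  have key : ∀ j ∈ J, (𝔼 h ∈ S, 𝔼 m ∈ S, 𝔼 m' ∈ S,
      gowersOne Γ (mulDeriv ((2 * (h + c j) * (m' - m)) • γ) (w j))) ^ 2 ≤
      1 / (2 * X ^ 2) + (X ^ 2) ^ 15 * gowersTwo Γ (w j) := by
    intro j hj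
    have h1 := sq_expect_gowersOne_le Γ (S ×ˢ S ×ˢ S)
      (fun p : ℤ × ℤ × ℤ => (2 * (p.1 + c j) * (p.2.2 - p.2.1)) • γ) (hw j)
    simp only [Finset.expect_product] at h1
    refine h1.trans ?_
    have h2 := expect_bilinear_le γ hH (X := X ^ 2) (by nlinarith) (by
        have : (8 : ℝ) ≤ X ^ 3 := by have := two_pow_le_pow hX 3; norm_num at this; linarith
        calc 8 * X ^ 2 ≤ X ^ 3 * X ^ 2 := by gcongr
          _ = X ^ 5 := by ring
          _ ≤ H := hXH) hR
      (hR'.trans (by gcongr; nlinarith)) (hc j hj) (hc j hj)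
      (fun _ _ t => gowersOne Γ (mulDeriv t (w j))) (fun _ _ _ => gowersOne_nonneg _ _)
      (fun _ _ _ => gowersOne_le_one _ (norm_mulDeriv_le (hw j) _))
    rw [Finset.expect_const hSn, Finset.expect_const hSn] at h2
    refine le_trans (le_of_eq ?_) h2
    refine Finset.expect_congr rfl fun h _ => ?_
    rw [expect_rotate]
    refine Finset.expect_congr rfl fun h' _ => ?_
    rw [Finset.expect_comm]
    refine Finset.expect_congr rfl fun m' _ => Finset.expect_congr rfl fun m _ => ?_
    rw [Finset.expect_comm]
    refine Finset.expect_congr rfl fun n' _ => Finset.expect_congr rfl fun n _ => ?_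
    congr 2
    rw [← sub_smul]; congr 1; ring
  have h1 : (1 / X) ^ 2 ≤ 1 / (2 * X ^ 2) + (X ^ 2) ^ 15 * 𝔼 j ∈ J, gowersTwo Γ (w j) := by
    have hJ : J.Nonempty := by
      by_contra hJ
      rw [not_nonempty_iff_eq_empty.1 hJ] at h
      simp only [Finset.expect_empty] at h
      have : 0 < 1 / X := by positivity
      linarith
    refine (pow_le_pow_left₀ (by positivity) h 2).trans ((sq_expect_le _ _).trans
      ((Finset.expect_le_expect key).trans (le_of_eq ?_)))
    rw [Finset.expect_add_distrib, Finset.expect_const hJ, ← Finset.mul_expect]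
  have h2 : 1 / (2 * X ^ 32) ≤ 𝔼 j ∈ J, gowersTwo Γ (w j) := by
    have e : (1 / X) ^ 2 = 1 / (2 * X ^ 2) + 1 / (2 * X ^ 2) := by field_simp; norm_num
    have h3 : 1 / (2 * X ^ 2) ≤ (X ^ 2) ^ 15 * 𝔼 j ∈ J, gowersTwo Γ (w j) := by linarith
    have h4 : 1 / (2 * X ^ 32) = 1 / (2 * X ^ 2) / X ^ 30 := by field_simp
    rw [h4, div_le_iff₀ (by positivity)]
    calc _ ≤ _ := h3
      _ = _ := by ring
  refine le_trans (one_div_le_one_div_of_le (by positivity) ?_) h2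
  calc 2 * X ^ 32 ≤ X * X ^ 32 := by gcongr
    _ = _ := by ring

lemma pair_quadruple_le (S : Finset ℤ) (u v : ℤ → G) (p q : G) {g : G → ℂ}
    (hg : ∀ x, ‖g x‖ ≤ 1) :
    ‖𝔼 x, (𝔼 m' ∈ S, 𝔼 m ∈ S, g (x + (u m' - u m)) * mulDeriv (u m' - u m) g (x + p)) *
      conj (𝔼 k' ∈ S, 𝔼 k ∈ S, g (x + (v k' - v k)) * mulDeriv (v k' - v k) g (x + q))‖ ^ 4 ≤
    𝔼 m ∈ S, 𝔼 m' ∈ S, sqAvg S v (mulDeriv (u m' - u m) (mulDeriv (q - p) g)) := by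
  set B := 𝔼 m ∈ S, 𝔼 m' ∈ S, sqAvg S v (mulDeriv (u m' - u m) (mulDeriv (q - p) g)) with hB
  have hB0 : 0 ≤ B := Finset.expect_nonneg fun _ _ => Finset.expect_nonneg fun _ _ =>
    sqAvg_nonneg _ _ _
  set T : G → ℤ → ℤ → ℂ := fun x m k => mulDeriv (q - p) g (x + p + (u m + v k)) with hT
  set b₁ : ℤ → G → ℤ → ℂ := fun m' x k => g (x + u m' + v k) * conj (g (x + u m' + v k + p))
    with hb₁
  set b₂ : ℤ → G → ℤ → ℂ := fun k' x m => conj (g (x + u m + v k')) * g (x + u m + v k' + q)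
    with hb₂
  have e1 : 𝔼 x, (𝔼 m' ∈ S, 𝔼 m ∈ S, g (x + (u m' - u m)) * mulDeriv (u m' - u m) g (x + p)) *
      conj (𝔼 k' ∈ S, 𝔼 k ∈ S, g (x + (v k' - v k)) * mulDeriv (v k' - v k) g (x + q)) =
      𝔼 m' ∈ S, 𝔼 k' ∈ S, 𝔼 x, 𝔼 m ∈ S, 𝔼 k ∈ S, b₁ m' x k * b₂ k' x m * T x m k := by
    simp_rw [conj_expect, Finset.expect_mul_expect]
    rw [Finset.expect_comm]
    refine Finset.expect_congr rfl fun m' _ => ?_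
    rw [Finset.expect_comm]
    refine Finset.expect_congr rfl fun k' _ => ?_
    rw [← expect_rotate, Finset.expect_comm (s := univ)]
    refine Finset.expect_congr rfl fun m _ => ?_
    rw [Finset.expect_comm (s := univ)]
    refine Finset.expect_congr rfl fun k _ => ?_
    rw [← expect_add_right _ (u m + v k)]
    refine Finset.expect_congr rfl fun x _ => ?_
    simp only [hb₁, hb₂, hT, mulDeriv, map_mul, RingHomCompTriple.comp_apply, RingHom.id_apply]
    have a1 : x + (u m + v k) + (u m' - u m) = x + u m' + v k := by abel
    have a2 : x + (u m + v k) + (v k' - v k) = x + u m + v k' := by abel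
    have a3 : x + (u m + v k) + p + (u m' - u m) = x + u m' + v k + p := by abel
    have a4 : x + (u m + v k) + q + (v k' - v k) = x + u m + v k' + q := by abel
    have a5 : x + p + (u m + v k) + (q - p) = x + (u m + v k) + q := by abel
    have a6 : x + p + (u m + v k) = x + (u m + v k) + p := by abel
    rw [a1, a2, a3, a4, a5, a6]
    ring
  have e2 : ∀ m' ∈ S, ∀ k' ∈ S, ‖𝔼 x, 𝔼 m ∈ S, 𝔼 k ∈ S, b₁ m' x k * b₂ k' x m * T x m k‖ ^ 4 ≤
      B := by
    intro m' _ k' _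
    have h1 : ‖𝔼 x, 𝔼 m ∈ S, 𝔼 k ∈ S, b₁ m' x k * b₂ k' x m * T x m k‖ ^ 4 ≤
        𝔼 x, 𝔼 m ∈ S, 𝔼 m₂ ∈ S, ‖𝔼 k ∈ S, T x m k * conj (T x m₂ k)‖ ^ 2 := by
      refine le_trans (pow_le_pow_left₀ (norm_nonneg _) (norm_expect_le _ _) 4)
        ((pow_four_expect_le _ _).trans (Finset.expect_le_expect fun x _ => ?_))
      refine box_two S S _ _ (T x) (fun k _ => norm_mul_conj_le_one (hg _) (hg _)) fun m _ => ?_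
      simp only [hb₂]
      refine norm_mul_le_one ?_ (hg _)
      rw [RCLike.norm_conj]; exact hg _
    refine h1.trans (le_of_eq ?_)
    rw [hB, Finset.expect_comm]
    refine Finset.expect_congr rfl fun m _ => ?_
    rw [Finset.expect_comm]
    refine Finset.expect_congr rfl fun m₂ _ => ?_
    symm
    rw [sqAvg, ← expect_add_right _ (p + u m)]
    refine Finset.expect_congr rfl fun x _ => ?_
    congr 2
    refine Finset.expect_congr rfl fun k _ => ?_
    simp only [hT]
    rw [mulDeriv]
    congr 2
    · abel
    · congr 1; abel
  rw [e1]
  refine le_trans (pow_le_pow_left₀ (norm_nonneg _) (norm_expect_le _ _) 4)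
    ((pow_four_expect_le _ _).trans (expect_le_of_le hB0 fun m' hm' => ?_))
  refine le_trans (pow_le_pow_left₀ (norm_nonneg _) (norm_expect_le _ _) 4)
    ((pow_four_expect_le _ _).trans (expect_le_of_le hB0 fun k' hk' => ?_))
  exact e2 m' hm' k' hk'

lemma pair_pow_eight_le (S : Finset ℤ) {ι : Type*} (I : Finset ι) (r : ι → ℤ → G) (P : ι → G)
    {g : G → ℂ} (hg : ∀ x, ‖g x‖ ≤ 1) :
    (𝔼 p ∈ I, sqAvg S (r p) (mulDeriv (P p) g)) ^ 8 ≤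
    𝔼 p ∈ I, 𝔼 q ∈ I, 𝔼 m ∈ S, 𝔼 m' ∈ S,
      sqAvg S (r q) (mulDeriv (r p m' - r p m) (mulDeriv (P q - P p) g)) := by
  set E := 𝔼 p ∈ I, sqAvg S (r p) (mulDeriv (P p) g) with hE
  set F : G → ι → ℂ := fun x p => 𝔼 m' ∈ S, 𝔼 m ∈ S,
    g (x + (r p m' - r p m)) * mulDeriv (r p m' - r p m) g (x + P p) with hF
  have e1 : (E : ℂ) = 𝔼 x, g x * 𝔼 p ∈ I, conj (F x p) := by
    rw [hE, ofReal_expect]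
    simp_rw [sqAvg_eq, Finset.mul_expect]
    rw [Finset.expect_comm (s := univ)]
    refine Finset.expect_congr rfl fun p _ => ?_
    rw [Finset.expect_comm]
    simp_rw [hF, conj_expect, Finset.mul_expect]
    rw [Finset.expect_comm (s := univ)]
    refine Finset.expect_congr rfl fun m' _ => ?_
    rw [Finset.expect_comm (s := univ)]
    refine Finset.expect_congr rfl fun m _ => Finset.expect_congr rfl fun x _ => ?_
    simp only [mulDeriv, map_mul, RingHomCompTriple.comp_apply, RingHom.id_apply]
    rw [add_right_comm]
    ring
  have e2 : E ^ 2 ≤ 𝔼 x, ‖𝔼 p ∈ I, F x p‖ ^ 2 := by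
    have : E ^ 2 = ‖𝔼 x, g x * 𝔼 p ∈ I, conj (F x p)‖ ^ 2 := by
      rw [← e1, Complex.norm_real, Real.norm_eq_abs, sq_abs]
    rw [this]
    refine (normSq_expect_mul_le _ _ _ fun x _ => hg x).trans (le_of_eq ?_)
    refine Finset.expect_congr rfl fun x _ => ?_
    rw [← conj_expect, RCLike.norm_conj]
  have e3 := e2.trans (expect_normSq_expect_le univ I F)
  have e4 : E ^ 8 = (E ^ 2) ^ 4 := by ring
  rw [e4]
  refine (pow_le_pow_left₀ (sq_nonneg _) e3 4).trans ((pow_four_expect_le _ _).trans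
    (Finset.expect_le_expect fun p _ => (pow_four_expect_le _ _).trans
    (Finset.expect_le_expect fun q _ => ?_)))
  exact pair_quadruple_le S (r p) (r q) (P p) (P q) hg

lemma expect_gowersOne_of_pair {H : ℕ} {X : ℝ} (hX : 2 ≤ X) (hXH : X ^ 11 ≤ H)
    (hR : 12 * H ^ 2 < addOrderOf γ) (hR' : (addOrderOf γ : ℝ) ≤ X * H ^ 2)
    {b : ℤ} (hb : |b| ≤ H) {g : G → ℂ} (hg : ∀ x, ‖g x‖ ≤ 1) :
    (𝔼 h' ∈ Icc (1 : ℤ) H, 𝔼 h ∈ Icc (1 : ℤ) H, 𝔼 n ∈ Icc (1 : ℤ) H, 𝔼 n' ∈ Icc (1 : ℤ) H,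
      sqAvg (Icc (1 : ℤ) H) (fun m : ℤ => (2 * (h - h') * m) • γ)
        (mulDeriv ((2 * (h - h' + b) * (n' - n)) • γ) g)) ^ 8 ≤
    1 / (2 * X ^ 8) + X ^ 120 *
      𝔼 h' ∈ Icc (1 : ℤ) H, 𝔼 k' ∈ Icc (1 : ℤ) H, 𝔼 h ∈ Icc (1 : ℤ) H, 𝔼 k ∈ Icc (1 : ℤ) H,
      𝔼 m ∈ Icc (1 : ℤ) H, 𝔼 m' ∈ Icc (1 : ℤ) H, 𝔼 n ∈ Icc (1 : ℤ) H, 𝔼 n' ∈ Icc (1 : ℤ) H,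
        gowersOne Γ (mulDeriv ((2 * (k - k') * (n' - n)) • γ)
          (mulDeriv ((2 * (h - h') * (m' - m)) • γ) g)) := by
  have hX0 : 0 < X := by linarith
  have hX1 : 1 ≤ X := by linarith
  have hH0 : (0 : ℝ) < H := lt_of_lt_of_le (by positivity) hXH
  have hH : 0 < H := by exact_mod_cast hH0
  set S := Icc (1 : ℤ) H with hS
  have hSn : S.Nonempty := Icc_one_nonempty hH
  have h1 := pair_pow_eight_le S (S ×ˢ S ×ˢ S ×ˢ S)
    (fun p : ℤ × ℤ × ℤ × ℤ => fun m : ℤ => (2 * (p.2.1 - p.1) * m) • γ)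
    (fun p => (2 * (p.2.1 - p.1 + b) * (p.2.2.2 - p.2.2.1)) • γ) hg
  simp only [Finset.expect_product] at h1
  refine h1.trans ?_
  have h2 : ∀ h' ∈ S, ∀ k' ∈ S, _ := fun h' hh' k' hk' =>
    expect_bilinear_le γ hH (X := X ^ 8) (κ := b - h') (κ' := b - k')
      (by have := two_pow_le_pow hX 8; norm_num at this; linarith)
      (by
        have : (8 : ℝ) ≤ X ^ 3 := by have := two_pow_le_pow hX 3; norm_num at this; linarith
        calc 8 * X ^ 8 ≤ X ^ 3 * X ^ 8 := by gcongr
          _ = X ^ 11 := by ring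
          _ ≤ H := hXH) hR
      (hR'.trans (by gcongr; exact le_self_pow₀ hX1 (by norm_num)))
      (by rw [abs_le] at hb ⊢; rw [mem_Icc] at hh'; omega)
      (by rw [abs_le] at hb ⊢; rw [mem_Icc] at hk'; omega)
      (fun h k t => 𝔼 m ∈ S, 𝔼 m' ∈ S, sqAvg S (fun n => (2 * (k - k') * n) • γ)
        (mulDeriv ((2 * (h - h') * m') • γ - (2 * (h - h') * m) • γ) (mulDeriv t g)))
      (fun _ _ _ => Finset.expect_nonneg fun _ _ => Finset.expect_nonneg fun _ _ =>
        sqAvg_nonneg _ _ _)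
      (fun _ _ _ => expect_le_of_le zero_le_one fun _ _ => expect_le_of_le zero_le_one fun _ _ =>
        sqAvg_le_one _ _ (norm_mulDeriv_le (norm_mulDeriv_le hg _) _))
  have h3 := Finset.expect_le_expect fun h' (hh' : h' ∈ S) =>
    Finset.expect_le_expect fun k' (hk' : k' ∈ S) => h2 h' hh' k' hk'
  simp_rw [Finset.expect_add_distrib, ← Finset.mul_expect] at h3
  rw [Finset.expect_const hSn, Finset.expect_const hSn] at h3
  refine le_trans (le_of_eq ?_) (h3.trans (le_of_eq ?_))
  · refine Finset.expect_congr rfl fun h' _ => ?_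
    rw [expect_rotate_four]
    refine Finset.expect_congr rfl fun k' _ => Finset.expect_congr rfl fun h _ => ?_
    rw [expect_rotate]
    refine Finset.expect_congr rfl fun k _ => ?_
    rw [Finset.expect_comm]
    refine Finset.expect_congr rfl fun n' _ => Finset.expect_congr rfl fun n _ => ?_
    rw [Finset.expect_comm]
    refine Finset.expect_congr rfl fun l' _ => Finset.expect_congr rfl fun l _ =>
      Finset.expect_congr rfl fun m _ => Finset.expect_congr rfl fun m' _ => ?_
    congr 3
    module
  · have hp : (X ^ 8) ^ 15 = X ^ 120 := by ring
    rw [hp]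
    refine congrArg (fun z => 1 / (2 * X ^ 8) + X ^ 120 * z) ?_
    refine Finset.expect_congr rfl fun h' _ => Finset.expect_congr rfl fun k' _ =>
      Finset.expect_congr rfl fun h _ => Finset.expect_congr rfl fun k _ => ?_
    rw [Finset.expect_comm]
    refine Finset.expect_congr rfl fun m _ => ?_
    rw [Finset.expect_comm]
    refine Finset.expect_congr rfl fun m' _ => ?_
    simp_rw [mulDeriv_comm _ _ g]
    rw [expect_sqAvg_mulDeriv]
    refine Finset.expect_congr rfl fun n _ => Finset.expect_congr rfl fun n' _ => ?_
    rw [← sub_smul, ← sub_smul, ← mul_sub, ← mul_sub, mulDeriv_comm]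

/-- Averaged large values along a pair of thin directions give large `U³`. -/
lemma gowersThree_of_pair {H : ℕ} {X : ℝ} (hX : 2 ≤ X) (hXH : X ^ 30000 ≤ H)
    (hR : 12 * H ^ 2 < addOrderOf γ) (hR' : (addOrderOf γ : ℝ) ≤ X * H ^ 2)
    (J : Finset ι) (b : ι → ℤ) (hb : ∀ j ∈ J, |b j| ≤ H) (g : ι → G → ℂ)
    (hg : ∀ j x, ‖g j x‖ ≤ 1)
    (h : 1 / X ≤ 𝔼 j ∈ J, 𝔼 h' ∈ Icc (1 : ℤ) H, 𝔼 h ∈ Icc (1 : ℤ) H,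
      𝔼 n ∈ Icc (1 : ℤ) H, 𝔼 n' ∈ Icc (1 : ℤ) H,
      sqAvg (Icc (1 : ℤ) H) (fun m : ℤ => (2 * (h - h') * m) • γ)
        (mulDeriv ((2 * (h - h' + b j) * (n' - n)) • γ) (g j))) :
    1 / X ^ 140481 ≤ 𝔼 j ∈ J, gowersThree Γ (g j) := by
  have hX0 : 0 < X := by linarith
  have hX1 : 1 ≤ X := by linarith
  have hH0 : (0 : ℝ) < H := lt_of_lt_of_le (by positivity) hXH
  have hH : 0 < H := by exact_mod_cast hH0
  have hpow : ∀ n, n ≤ 30000 → X ^ n ≤ H := fun n hn => (pow_le_pow_right₀ hX1 hn).trans hXH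
  have hR'' : ∀ n, 1 ≤ n → (addOrderOf γ : ℝ) ≤ X ^ n * H ^ 2 := fun n hn =>
    hR'.trans (by gcongr; exact le_self_pow₀ hX1 (by omega))
  have h2n : ∀ n, 1 ≤ n → 2 ≤ X ^ n := fun n hn => hX.trans (le_self_pow₀ hX1 (by omega))
  set S := Icc (1 : ℤ) H with hS
  have hSn : S.Nonempty := Icc_one_nonempty hH
  have hJ : J.Nonempty := by
    by_contra hJ
    rw [not_nonempty_iff_eq_empty.1 hJ] at h
    simp only [Finset.expect_empty] at h
    have : 0 < 1 / X := by positivity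
    linarith
  set Q : ι → ℝ := fun j => 𝔼 h' ∈ S, 𝔼 k' ∈ S, 𝔼 h ∈ S, 𝔼 k ∈ S,
      𝔼 m ∈ S, 𝔼 m' ∈ S, 𝔼 n ∈ S, 𝔼 n' ∈ S,
        gowersOne Γ (mulDeriv ((2 * (k - k') * (n' - n)) • γ)
          (mulDeriv ((2 * (h - h') * (m' - m)) • γ) (g j))) with hQ
  have h1 : (1 / X) ^ 8 ≤ 1 / (2 * X ^ 8) + X ^ 120 * 𝔼 j ∈ J, Q j := by
    refine (pow_le_pow_left₀ (by positivity) h 8).trans ((pow_eight_expect_le _ _).trans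
      ((Finset.expect_le_expect fun j hj => expect_gowersOne_of_pair γ hX (hpow 11 (by norm_num))
        hR hR' (hb j hj) (hg j)).trans (le_of_eq ?_)))
    rw [Finset.expect_add_distrib, Finset.expect_const hJ, ← Finset.mul_expect]
  have h2 : 1 / X ^ 129 ≤ 𝔼 j ∈ J, Q j := by
    have e : (1 / X) ^ 8 = 1 / (2 * X ^ 8) + 1 / (2 * X ^ 8) := by field_simp; norm_num
    have h3 : 1 / (2 * X ^ 8) ≤ X ^ 120 * 𝔼 j ∈ J, Q j := by linarith
    have h4 : 1 / X ^ 129 ≤ 1 / (2 * X ^ 8) / X ^ 120 := by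
      rw [div_div]
      refine one_div_le_one_div_of_le (by positivity) ?_
      calc 2 * X ^ 8 * X ^ 120 = 2 * X ^ 128 := by ring
        _ ≤ X * X ^ 128 := by gcongr
        _ = _ := by ring
    refine h4.trans ?_
    rw [div_le_iff₀ (by positivity)]
    linarith
  -- first direction
  have h3 : 1 / (X ^ 129) ^ 33 ≤ 𝔼 a ∈ J ×ˢ S ×ˢ S ×ˢ S ×ˢ S ×ˢ S,
      gowersTwo Γ (mulDeriv ((2 * (a.2.2.2.1 - a.2.1) * (a.2.2.2.2.2 - a.2.2.2.2.1)) • γ)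
        (g a.1)) := by
    refine gowersTwo_of_bilinear γ (h2n 129 (by norm_num))
      (by rw [← pow_mul]; exact hpow _ (by norm_num)) hR (hR'' _ (by norm_num))
      (J ×ˢ S ×ˢ S ×ˢ S ×ˢ S ×ˢ S) (fun a => -a.2.2.1) ?_ _
      (fun a => norm_mulDeriv_le (hg a.1) _) ?_
    · rintro a ha
      simp only [mem_product] at ha
      have := ha.2.2.1
      rw [mem_Icc] at this
      rw [abs_le]; omega
    · refine h2.trans (le_of_eq ?_)
      simp only [Finset.expect_product]
      refine Finset.expect_congr rfl fun j _ => Finset.expect_congr rfl fun h' _ =>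
        Finset.expect_congr rfl fun k' _ => Finset.expect_congr rfl fun h _ => ?_
      rw [Finset.expect_comm]
      refine Finset.expect_congr rfl fun m _ => ?_
      rw [Finset.expect_comm]
      rfl
  -- second direction
  have h4 : 1 / ((X ^ 129) ^ 33) ^ 33 ≤ 𝔼 a ∈ J ×ˢ (univ : Finset Γ) ×ˢ S,
      gowersTwo Γ (mulDeriv (a.2.1 : G) (g a.1)) := by
    refine gowersTwo_of_bilinear γ (by rw [← pow_mul]; exact h2n _ (by norm_num))
      (by rw [← pow_mul, ← pow_mul]; exact hpow _ (by norm_num)) hR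
      (by rw [← pow_mul]; exact hR'' _ (by norm_num))
      (J ×ˢ (univ : Finset Γ) ×ˢ S) (fun a => -a.2.2) ?_ _
      (fun a => norm_mulDeriv_le (hg a.1) _) ?_
    · rintro a ha
      simp only [mem_product] at ha
      have := ha.2.2
      rw [mem_Icc] at this
      rw [abs_le]; omega
    · refine h3.trans (le_of_eq ?_)
      simp only [Finset.expect_product]
      refine Finset.expect_congr rfl fun j _ => ?_
      rw [Finset.expect_comm (s := univ)]
      refine Finset.expect_congr rfl fun h' _ => ?_
      rw [Finset.expect_const hSn, ← expect_rotate_four]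
      refine Finset.expect_congr rfl fun h _ => Finset.expect_congr rfl fun m _ =>
        Finset.expect_congr rfl fun m' _ => ?_
      rw [gowersTwo]
      refine Finset.expect_congr rfl fun t _ => ?_
      rw [mulDeriv_comm]
      rfl
  rw [← pow_mul, ← pow_mul] at h4
  refine h4.trans (le_of_eq ?_)
  simp only [Finset.expect_product]
  refine Finset.expect_congr rfl fun j _ => ?_
  rw [gowersThree]
  refine Finset.expect_congr rfl fun t _ => ?_
  rw [Finset.expect_const hSn]

end Degree

/-- The order of `γ` is comparable to `M²`. -/
def OrderScale {G : Type*} [AddCommGroup G] (γ : G) (M : ℕ) : Prop :=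
  4 * M ^ 2 ≤ addOrderOf γ ∧ addOrderOf γ ≤ 16 * M ^ 2

lemma one_div_le_one_div_pow {X : ℝ} (hX : 1 ≤ X) {m n : ℕ} (h : m ≤ n) :
    1 / X ^ n ≤ 1 / X ^ m :=
  one_div_le_one_div_of_le (by positivity) (pow_le_pow_right₀ hX h)

/-- A large count forces large `U⁴` of the third function. -/
theorem gowersFour_of_Lam : ∃ K : ℕ, ∀ (G : Type) [AddCommGroup G] [Fintype G] (e γ : G)
    [Fintype (AddSubgroup.zmultiples γ)] (M : ℕ) (X : ℝ) (f₀ f₁ f₂ : G → ℂ), 2 ≤ X → X ^ K ≤ M →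
    OrderScale γ M → (∀ x, ‖f₀ x‖ ≤ 1) → (∀ x, ‖f₁ x‖ ≤ 1) → (∀ x, ‖f₂ x‖ ≤ 1) →
    1 / X ≤ ‖Lam e γ M f₀ f₁ f₂‖ →
    1 / X ^ K ≤ gowersFour (AddSubgroup.zmultiples γ) f₂ := by
  obtain ⟨E, hE⟩ : ∃ E : ℕ, E = 89 * 140481 := ⟨_, rfl⟩
  refine ⟨33 * E + 17, fun G _ _ e γ _ M X f₀ f₁ f₂ hX hM hR h₀ h₁ h₂ hL => ?_⟩
  have hX0 : 0 < X := by linarith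
  have hX1 : 1 ≤ X := by linarith
  have hM0 : (0 : ℝ) < M := lt_of_lt_of_le (by positivity) hM
  set H := ⌊(M : ℝ) / X ^ 16⌋₊ with hHdef
  have hH1 : (H : ℝ) * X ^ 16 ≤ M := by
    have := Nat.floor_le (show 0 ≤ (M : ℝ) / X ^ 16 by positivity)
    rwa [← hHdef, le_div_iff₀ (by positivity)] at this
  have hH2 : (M : ℝ) / X ^ 17 ≤ H := by
    have h1 := (Nat.lt_floor_add_one ((M : ℝ) / X ^ 16)).le
    rw [← hHdef] at h1
    have h2 : 1 ≤ (M : ℝ) / X ^ 17 := by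
      rw [le_div_iff₀ (by positivity), one_mul]
      exact (pow_le_pow_right₀ hX1 (by omega)).trans hM
    have h3 : 2 * ((M : ℝ) / X ^ 17) ≤ (M : ℝ) / X ^ 16 := by
      have : (M : ℝ) / X ^ 16 = X * (M / X ^ 17) := by field_simp
      rw [this]; gcongr
    linarith
  have hpow : ∀ n, n ≤ 33 * E → X ^ n ≤ H := by
    intro n hn
    refine le_trans ?_ hH2
    rw [le_div_iff₀ (by positivity), ← pow_add]
    exact (pow_le_pow_right₀ hX1 (by omega)).trans hM
  have hH : 0 < H := by
    have : (0 : ℝ) < H := lt_of_lt_of_le (by positivity) (hpow 0 (by omega))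
    exact_mod_cast this
  have hHR : 12 * H ^ 2 < addOrderOf γ := by
    have h2 : (2 : ℝ) * H ≤ M := by
      refine le_trans ?_ hH1
      rw [mul_comm]; gcongr
      exact hX.trans (le_self_pow₀ hX1 (by norm_num))
    have h3 : 2 * H ≤ M := by exact_mod_cast h2
    have h4 := hR.1
    nlinarith [hH]
  have hHR' : ∀ n, 89 ≤ n → (addOrderOf γ : ℝ) ≤ X ^ n * H ^ 2 := by
    intro n hn
    have h1 : (addOrderOf γ : ℝ) ≤ 16 * M ^ 2 := by exact_mod_cast hR.2
    have h2 : (M : ℝ) ≤ X ^ 17 * H := by rw [div_le_iff₀ (by positivity)] at hH2; linarith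
    have h3 : (16 : ℝ) ≤ X ^ 4 := by have := two_pow_le_pow hX 4; norm_num at this; linarith
    calc (addOrderOf γ : ℝ) ≤ 16 * M ^ 2 := h1
      _ ≤ X ^ 4 * (X ^ 17 * H) ^ 2 := by gcongr
      _ = X ^ 38 * H ^ 2 := by ring
      _ ≤ X ^ n * H ^ 2 := by gcongr; omega
  have h2n : ∀ n, 1 ≤ n → 2 ≤ X ^ n := fun n hn => hX.trans (le_self_pow₀ hX1 (by omega))
  set S := Icc (1 : ℤ) H with hS
  have hSn : S.Nonempty := Icc_one_nonempty hH
  have c1 := Lam_control e γ M H hH hX hH1 h₀ h₁ h₂ hL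
  have c2 : 1 / (X ^ 89) ^ 140481 ≤ 𝔼 a ∈ S ×ˢ S ×ˢ S ×ˢ S,
      gowersThree (AddSubgroup.zmultiples γ)
        (mulDeriv ((2 * (a.2.1 - a.1) * (a.2.2.2 - a.2.2.1)) • γ) f₂) := by
    refine gowersThree_of_pair γ (h2n _ (by norm_num))
      (by rw [← pow_mul]; exact hpow _ (by omega)) hHR
      (hHR' _ (by norm_num)) (S ×ˢ S ×ˢ S ×ˢ S) (fun a => a.2.1 - a.1) ?_ _
      (fun a => norm_mulDeriv_le h₂ _) ?_
    · rintro a ha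
      simp only [mem_product, hS, mem_Icc] at ha
      rw [abs_le]; omega
    · refine c1.trans (le_of_eq ?_)
      simp only [Finset.expect_product]
      rw [Finset.expect_comm, expect_rotate_four]
      refine Finset.expect_congr rfl fun k' _ => ?_
      rw [expect_rotate]
      refine Finset.expect_congr rfl fun k _ => ?_
      rw [expect_rotate_five]
      refine Finset.expect_congr rfl fun m _ => ?_
      rw [expect_rotate_five]
      refine Finset.expect_congr rfl fun m' _ => Finset.expect_congr rfl fun h' _ =>
        Finset.expect_congr rfl fun h _ => Finset.expect_congr rfl fun l _ =>
        Finset.expect_congr rfl fun l' _ => ?_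
      rw [mulDeriv_comm]
  rw [← pow_mul, ← hE] at c2
  have c3 : 1 / (X ^ E) ^ 33 ≤ 𝔼 a ∈ S ×ˢ (univ : Finset (AddSubgroup.zmultiples γ)) ×ˢ
      (univ : Finset (AddSubgroup.zmultiples γ)),
      gowersTwo (AddSubgroup.zmultiples γ) (mulDeriv (a.2.2 : G) (mulDeriv (a.2.1 : G) f₂)) := by
    refine gowersTwo_of_bilinear γ (h2n _ (by omega))
      (by rw [← pow_mul]; exact hpow _ (by omega)) hHR (hHR' _ (by omega))
      (S ×ˢ univ ×ˢ univ) (fun a => -a.1) ?_ _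
      (fun a => norm_mulDeriv_le (norm_mulDeriv_le h₂ _) _) ?_
    · rintro a ha
      simp only [mem_product, hS, mem_Icc] at ha
      rw [abs_le]; omega
    · refine c2.trans (le_of_eq ?_)
      simp only [Finset.expect_product]
      refine Finset.expect_congr rfl fun k' _ => ?_
      simp only [gowersThree, gowersTwo]
      have : ∀ t s : AddSubgroup.zmultiples γ, ∀ v : G, mulDeriv (s : G) (mulDeriv (t : G)
          (mulDeriv v f₂)) = mulDeriv v (mulDeriv (s : G) (mulDeriv (t : G) f₂)) := by
        intro t s v; rw [mulDeriv_comm (t : G) v, mulDeriv_comm (s : G) v]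
      simp only [this]
      rw [expect_rotate_four]
      refine Finset.expect_congr rfl fun t _ => ?_
      rw [expect_rotate_four]
      rfl
  rw [← pow_mul] at c3
  refine le_trans (one_div_le_one_div_pow hX1 (by omega)) (c3.trans (le_of_eq ?_))
  simp only [Finset.expect_product]
  rw [Finset.expect_const hSn]
  rfl

section Phase

/-- The additive character `θ ↦ exp (2πiθ)` of the circle. -/
noncomputable def ee (θ : ℝ) : ℂ := Complex.exp (Complex.I * ((2 * Real.pi * θ : ℝ) : ℂ))

/-- The distance from a real number to the nearest integer. -/
noncomputable def nd (θ : ℝ) : ℝ := |θ - round θ|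

lemma ee_add (a b : ℝ) : ee (a + b) = ee a * ee b := by
  rw [ee, ee, ee, ← Complex.exp_add]; congr 1; push_cast; ring

lemma ee_intCast (k : ℤ) : ee k = 1 := by
  rw [ee, Complex.exp_eq_one_iff]; exact ⟨k, by push_cast; ring⟩

@[simp] lemma ee_zero : ee 0 = 1 := by simpa using ee_intCast 0

@[simp] lemma norm_ee (θ : ℝ) : ‖ee θ‖ = 1 := by rw [ee, mul_comm, Complex.norm_exp_ofReal_mul_I]

lemma conj_ee (θ : ℝ) : conj (ee θ) = ee (-θ) := by
  rw [ee, ee, ← Complex.exp_conj]; congr 1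
  rw [map_mul, Complex.conj_I, Complex.conj_ofReal]; push_cast; ring

lemma ee_mul_conj (a b : ℝ) : ee a * conj (ee b) = ee (a - b) := by
  rw [conj_ee, ← ee_add, sub_eq_add_neg]

lemma ee_add_intCast (θ : ℝ) (k : ℤ) : ee (θ + k) = ee θ := by rw [ee_add, ee_intCast, mul_one]

lemma norm_ee_sub_one_le (θ : ℝ) : ‖ee θ - 1‖ ≤ 7 * |θ| := by
  refine Real.norm_exp_I_mul_ofReal_sub_one_le.trans ?_
  rw [Real.norm_eq_abs, abs_mul, abs_of_pos (by positivity)]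
  gcongr
  linarith [Real.pi_lt_d2]

lemma nd_nonneg (θ : ℝ) : 0 ≤ nd θ := abs_nonneg _

lemma nd_le_abs_sub (θ : ℝ) (k : ℤ) : nd θ ≤ |θ - k| := round_le θ k

lemma nd_add_le (a b : ℝ) : nd (a + b) ≤ nd a + nd b := by
  refine (nd_le_abs_sub (a + b) (round a + round b)).trans ?_
  push_cast
  rw [add_sub_add_comm]
  exact abs_add_le _ _

lemma nd_neg (a : ℝ) : nd (-a) = nd a := by
  have h : ∀ a, nd (-a) ≤ nd a := fun a => by
    refine (nd_le_abs_sub (-a) (-round a)).trans (le_of_eq ?_)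
    push_cast
    rw [nd, ← abs_neg]; congr 1; ring
  exact le_antisymm (h a) (by simpa using h (-a))

lemma nd_sub_le (a b : ℝ) : nd (a - b) ≤ nd a + nd b := by
  rw [sub_eq_add_neg]; simpa [nd_neg] using nd_add_le a (-b)

lemma nd_intCast_mul_le (n : ℤ) (a : ℝ) : nd (n * a) ≤ |(n : ℝ)| * nd a := by
  refine (nd_le_abs_sub _ (n * round a)).trans (le_of_eq ?_)
  push_cast
  rw [nd, ← abs_mul]; congr 1; ring

lemma four_mul_nd_le (θ : ℝ) : 4 * nd θ ≤ ‖ee θ - 1‖ := by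
  have h1 : ee θ = ee (θ - round θ) := by
    rw [← ee_add_intCast (θ - round θ) (round θ)]; congr 1; ring
  rw [h1, ee, Complex.norm_exp_I_mul_ofReal_sub_one, Real.norm_eq_abs, abs_mul, abs_two]
  have h2 : |θ - round θ| ≤ 1 / 2 := abs_sub_round θ
  have h3 := Real.mul_abs_le_abs_sin (x := 2 * Real.pi * (θ - round θ) / 2) (by
    rw [abs_div, abs_mul, abs_of_pos (by positivity : (0 : ℝ) < 2 * Real.pi), abs_two]
    nlinarith [Real.pi_pos])
  have h4 : 2 / Real.pi * |2 * Real.pi * (θ - round θ) / 2| = 2 * nd θ := by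
    rw [abs_div, abs_mul, abs_of_pos (by positivity : (0 : ℝ) < 2 * Real.pi), abs_two, nd]
    field_simp
  linarith

/-- A large linear exponential sum has small frequency. -/
lemma nd_le_of_linear {M : ℕ} {θ β ε : ℝ} (hε : 0 < ε) (hM : 0 < M)
    (h : ε ≤ ‖𝔼 y ∈ Icc (1 : ℤ) M, ee (θ * y + β)‖) : nd θ ≤ 1 / (ε * M) := by
  have h1 := expect_Icc_shift_le M (fun y : ℤ => ee (θ * y + β)) (fun _ => (norm_ee _).le) 1
    (by norm_num)
  have h2 : 𝔼 y ∈ Icc (1 : ℤ) M, ee (θ * ((y + 1 : ℤ) : ℝ) + β) =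
      ee θ * 𝔼 y ∈ Icc (1 : ℤ) M, ee (θ * y + β) := by
    rw [Finset.mul_expect]
    refine Finset.expect_congr rfl fun y _ => ?_
    rw [← ee_add]; congr 1; push_cast; ring
  rw [h2, ← sub_one_mul, norm_mul] at h1
  have h3 := four_mul_nd_le θ
  have h4 : 4 * nd θ * ε ≤ 2 / M := by
    calc 4 * nd θ * ε ≤ ‖ee θ - 1‖ * ‖𝔼 y ∈ Icc (1 : ℤ) M, ee (θ * y + β)‖ := by
          gcongr
      _ ≤ 2 / M := by simpa using h1
  have hM0 : (0 : ℝ) < M := by exact_mod_cast hM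
  rw [le_div_iff₀ hM0] at h4
  rw [le_div_iff₀ (by positivity)]
  nlinarith [nd_nonneg θ]

lemma card_le_of_mem_interval {A : Finset ℤ} {a b : ℝ} (hab : a ≤ b)
    (h : ∀ t ∈ A, a ≤ t ∧ (t : ℝ) ≤ b) : (#A : ℝ) ≤ b - a + 1 := by
  have h1 : A ⊆ Icc ⌈a⌉ ⌊b⌋ := fun t ht =>
    mem_Icc.2 ⟨Int.ceil_le.2 (h t ht).1, Int.le_floor.2 (h t ht).2⟩
  have h2 := Finset.card_le_card h1
  rw [Int.card_Icc] at h2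
  have h3 : (#A : ℝ) ≤ ((⌊b⌋ + 1 - ⌈a⌉).toNat : ℝ) := by exact_mod_cast h2
  rcases le_total 0 (⌊b⌋ + 1 - ⌈a⌉) with h0 | h0
  · have : ((⌊b⌋ + 1 - ⌈a⌉).toNat : ℝ) = ⌊b⌋ + 1 - ⌈a⌉ := by
      exact_mod_cast Int.toNat_of_nonneg h0
    linarith [Int.floor_le b, Int.le_ceil a]
  · rw [Int.toNat_eq_zero.2 h0] at h3
    push_cast at h3; linarith

lemma card_nd_le {φ β δ L : ℝ} (hφ : φ ≠ 0) (hδ : 0 ≤ δ) (hL : 0 ≤ L) {A : Finset ℤ}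
    (hA : ∀ s ∈ A, 0 ≤ s ∧ (s : ℝ) ≤ L) (h : ∀ s ∈ A, nd (φ * s + β) ≤ δ) :
    (#A : ℝ) ≤ (|φ| * L + 2 * δ + 1) * (2 * δ / |φ| + 1) := by
  classical
  have hφ0 : 0 < |φ| := abs_pos.2 hφ
  set r : ℤ → ℤ := fun s => round (φ * s + β) with hr
  have h1 : ∀ k ∈ A.image r, (#{s ∈ A | r s = k} : ℝ) ≤ 2 * δ / |φ| + 1 := by
    intro k _
    have e : (k - β) / φ + δ / |φ| - ((k - β) / φ - δ / |φ|) + 1 = 2 * δ / |φ| + 1 := by ring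
    rw [← e]
    refine card_le_of_mem_interval ?_ ?_
    · have : 0 ≤ δ / |φ| := by positivity
      linarith
    intro s hs
    obtain ⟨hsA, hsk⟩ := mem_filter.1 hs
    have h2 := h s hsA
    rw [nd] at h2
    simp only [hr] at hsk
    rw [hsk] at h2
    have h3 : |(s : ℝ) - (k - β) / φ| ≤ δ / |φ| := by
      have : (s : ℝ) - (k - β) / φ = (φ * s + β - k) / φ := by field_simp; ring
      rw [this, abs_div]; gcongr
    have := abs_le.1 h3
    constructor <;> linarith
  have h2 : (#(A.image r) : ℝ) ≤ |φ| * L + 2 * δ + 1 := by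
    have e : max (φ * L) 0 + β + δ - (min (φ * L) 0 + β - δ) + 1 = |φ| * L + 2 * δ + 1 := by
      have : max (φ * L) 0 - min (φ * L) 0 = |φ| * L := by
        rw [max_sub_min_eq_abs, zero_sub, abs_neg, abs_mul, abs_of_nonneg hL]
      linarith
    rw [← e]
    refine card_le_of_mem_interval ?_ ?_
    · linarith [min_le_max (a := φ * L) (b := 0)]
    intro k hk
    obtain ⟨s, hs, rfl⟩ := mem_image.1 hk
    have h3 := abs_le.1 (h s hs)
    obtain ⟨hs0, hsL⟩ := hA s hs
    have hs0' : (0 : ℝ) ≤ s := by exact_mod_cast hs0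
    have h4 : φ * s ≤ max (φ * L) 0 := by
      rcases le_total 0 φ with hp | hp
      · exact le_max_of_le_left (by gcongr)
      · exact le_max_of_le_right (mul_nonpos_of_nonpos_of_nonneg hp hs0')
    have h5 : min (φ * L) 0 ≤ φ * s := by
      rcases le_total 0 φ with hp | hp
      · exact min_le_of_right_le (by positivity)
      · exact min_le_of_left_le (mul_le_mul_of_nonpos_left hsL hp)
    constructor <;> simp only [hr] <;> linarith
  have h3 : (#A : ℝ) = ∑ k ∈ A.image r, (#{s ∈ A | r s = k} : ℝ) := by
    exact_mod_cast Finset.card_eq_sum_card_image r A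
  rw [h3]
  refine (sum_le_sum h1).trans ?_
  rw [sum_const, nsmul_eq_mul]
  gcongr

set_option maxHeartbeats 1000000 in
/-- If many multiples of `θ` are close to a common point, then a small multiple of `θ` is very
close to an integer. -/
lemma exists_small_denominator {H : ℕ} {X θ β δ : ℝ} (hX : 2 ≤ X) (hH : X ^ 8 ≤ H) (hδ : 0 ≤ δ)
    (hδX : δ ≤ 1 / X ^ 8) {T : Finset ℤ} (hT : T ⊆ Icc (1 : ℤ) H) (hTc : H / X ≤ #T)
    (h : ∀ t ∈ T, nd (θ * t + β) ≤ δ) :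
    ∃ d : ℕ, 0 < d ∧ (d : ℝ) ≤ X ^ 3 ∧ nd (d * θ) ≤ δ * X ^ 10 / H := by
  classical
  have hX0 : 0 < X := by linarith
  have hH0 : (0 : ℝ) < H := lt_of_lt_of_le (by positivity) hH
  have hX3 : (8 : ℝ) ≤ X ^ 3 := by have := two_pow_le_pow hX 3; norm_num at this; linarith
  have hX8 : 32 * X ^ 3 ≤ X ^ 8 := by
    have := two_pow_le_pow hX 5; norm_num at this
    calc 32 * X ^ 3 ≤ X ^ 5 * X ^ 3 := by gcongr
      _ = _ := by ring
  have hX23 : 2 * X ^ 2 ≤ X ^ 3 := by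
    calc 2 * X ^ 2 ≤ X * X ^ 2 := by gcongr
      _ = _ := by ring
  have hX2 : 2 * X ≤ X ^ 2 := by nlinarith
  -- two elements of `T` are close
  set w := ⌈2 * X⌉₊ with hw
  have hw1 : 2 * X ≤ w := Nat.le_ceil _
  have hw2 : (w : ℝ) ≤ 2 * X + 1 := (Nat.ceil_lt_add_one (by positivity)).le
  have hw0 : (0 : ℝ) < w := by linarith
  have hw0' : 0 < w := by exact_mod_cast hw0
  obtain ⟨t, ht, t', ht', hne, htt⟩ : ∃ t ∈ T, ∃ t' ∈ T, t ≠ t' ∧ t / (w : ℤ) = t' / (w : ℤ) := by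
    refine Finset.exists_ne_map_eq_of_card_lt_of_maps_to (t := Icc (0 : ℤ) (H / w : ℕ)) ?_ ?_
    · have h1 : (#(Icc (0 : ℤ) (H / w : ℕ)) : ℝ) ≤ H / (2 * X) + 1 := by
        have e : #(Icc (0 : ℤ) (H / w : ℕ)) = H / w + 1 := by
          rw [Int.card_Icc, sub_zero]; norm_cast
        rw [e]; push_cast
        gcongr
        exact Nat.cast_div_le.trans (by gcongr)
      have h2 : (H : ℝ) / (2 * X) + 1 < H / X := by
        have : (H : ℝ) / X = H / (2 * X) + H / (2 * X) := by field_simp; norm_num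
        rw [this]
        gcongr
        rw [one_lt_div (by positivity)]
        nlinarith
      have : (#(Icc (0 : ℤ) (H / w : ℕ)) : ℝ) < #T := by linarith
      exact_mod_cast this
    · intro a ha
      have := mem_Icc.1 (hT ha)
      simp only [coe_Icc, Set.mem_Icc]
      refine ⟨Int.ediv_nonneg (by omega) (by omega), ?_⟩
      push_cast
      exact Int.ediv_le_ediv (by exact_mod_cast hw0') this.2
  set d := (t - t').natAbs with hd
  have hd0 : 0 < d := Int.natAbs_pos.2 (sub_ne_zero.2 hne)
  have hd0' : (0 : ℝ) < d := by exact_mod_cast hd0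
  have hdw : (d : ℝ) ≤ 2 * X + 1 := by
    have h1 := Int.emod_add_mul_ediv t w
    have h2 := Int.emod_add_mul_ediv t' w
    rw [htt] at h1
    have a1 := Int.emod_nonneg t (b := w) (by omega)
    have a2 := Int.emod_nonneg t' (b := w) (by omega)
    have a3 := Int.emod_lt_of_pos t (b := w) (by omega)
    have a4 := Int.emod_lt_of_pos t' (b := w) (by omega)
    have : d ≤ w := by omega
    exact le_trans (by exact_mod_cast this) hw2
  have hdX : (d : ℝ) ≤ X ^ 2 * 2 := by nlinarith
  have hdθ : nd (d * θ) ≤ 2 * δ := by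
    have h1 : nd ((t - t' : ℤ) * θ) ≤ 2 * δ := by
      have e : ((t - t' : ℤ) : ℝ) * θ = (θ * t + β) - (θ * t' + β) := by push_cast; ring
      rw [e]
      linarith [nd_sub_le (θ * t + β) (θ * t' + β), h t ht, h t' ht']
    rcases Int.natAbs_eq (t - t') with e | e
    · rw [e] at h1; simpa [hd] using h1
    · rw [e] at h1
      push_cast at h1
      rw [neg_mul, nd_neg] at h1
      simpa [hd] using h1
  refine ⟨d, hd0, by linarith, ?_⟩
  -- restrict to a residue class modulo `d`
  obtain ⟨c, -, hc⟩ : ∃ c ∈ Ico (0 : ℤ) d, (#T : ℝ) / d ≤ #{s ∈ T | s % (d : ℤ) = c} := by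
    have hmaps : ∀ s ∈ T, s % (d : ℤ) ∈ Ico (0 : ℤ) d := fun s _ =>
      mem_Ico.2 ⟨Int.emod_nonneg _ (by omega), Int.emod_lt_of_pos _ (by omega)⟩
    have hcard : #T = ∑ c ∈ Ico (0 : ℤ) d, #{s ∈ T | s % (d : ℤ) = c} :=
      Finset.card_eq_sum_card_fiberwise hmaps
    by_contra hcon
    push Not at hcon
    have hne' : (Ico (0 : ℤ) d).Nonempty := ⟨0, mem_Ico.2 ⟨le_rfl, by exact_mod_cast hd0⟩⟩
    have h1 : (#T : ℝ) < ∑ c ∈ Ico (0 : ℤ) d, (#T : ℝ) / d := by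
      have e : (#T : ℝ) = ∑ c ∈ Ico (0 : ℤ) d, (#{s ∈ T | s % (d : ℤ) = c} : ℝ) := by
        exact_mod_cast hcard
      exact e.trans_lt (Finset.sum_lt_sum_of_nonempty hne' hcon)
    rw [sum_const, Int.card_Ico, nsmul_eq_mul] at h1
    simp only [sub_zero, Int.toNat_natCast] at h1
    rw [mul_div_cancel₀ _ hd0'.ne'] at h1
    exact lt_irrefl _ h1
  set A := {s ∈ T | s % (d : ℤ) = c}.image (fun s => s / (d : ℤ)) with hA
  have hAc : (#A : ℝ) = #{s ∈ T | s % (d : ℤ) = c} := by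
    rw [hA, Finset.card_image_of_injOn]
    intro a ha b hb hab
    have h1 := (mem_filter.1 ha).2
    have h2 := (mem_filter.1 hb).2
    have h3 := Int.emod_add_mul_ediv a d
    have h4 := Int.emod_add_mul_ediv b d
    simp only at hab
    rw [← h3, ← h4, h1, h2, hab]
  set φ := d * θ - round (d * θ) with hφ
  have hndφ : nd (d * θ) = |φ| := rfl
  rw [hndφ] at hdθ ⊢
  rcases eq_or_ne φ 0 with hz | hz
  · rw [hz]; simp; positivity
  have hφ0 : 0 < |φ| := abs_pos.2 hz
  have hcount := card_nd_le (A := A) (L := H / d) (β := θ * c + β) hz hδ (by positivity) ?_ ?_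
  · rw [hAc] at hcount
    have h1 : (H : ℝ) / (X * d) ≤ (|φ| * (H / d) + 2 * δ + 1) * (2 * δ / |φ| + 1) := by
      refine le_trans ?_ (hc.trans hcount)
      rw [← div_div]; gcongr
    have hδ1 : δ * X ^ 8 ≤ 1 := by rwa [le_div_iff₀ (by positivity)] at hδX
    have e1 : (|φ| * (H / d) + 2 * δ + 1) * (2 * δ / |φ| + 1) =
        2 * δ * (H / d) + |φ| * (H / d) + (2 * δ + 1) + (2 * δ + 1) * (2 * δ / |φ|) := by
      field_simp; ring
    rw [e1] at h1
    have hHd : 0 < (H : ℝ) / d := by positivity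
    have hδ32 : 32 * X * δ ≤ 1 := by
      have : 32 * X ≤ X ^ 8 := by nlinarith
      nlinarith
    have b1 : (H : ℝ) / (X * d) = H / d / X := by field_simp
    have b2 : 2 * δ * ((H : ℝ) / d) + |φ| * (H / d) ≤ H / d / X * (1 / 8) := by
      have : 4 * δ ≤ 1 / X * (1 / 8) := by
        rw [div_mul_eq_mul_div, le_div_iff₀ hX0]; linarith
      calc 2 * δ * ((H : ℝ) / d) + |φ| * (H / d) ≤ 4 * δ * (H / d) := by
            have := mul_le_mul_of_nonneg_right hdθ hHd.le
            linarith
        _ ≤ 1 / X * (1 / 8) * (H / d) := by gcongr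
        _ = _ := by ring
    have b3 : (2 : ℝ) ≤ H / d / X * (1 / 2) := by
      rw [div_div, div_mul_eq_mul_div, le_div_iff₀ (by positivity)]
      have : (d : ℝ) * X ≤ 2 * X ^ 3 := by nlinarith
      nlinarith
    have b4 : 2 * δ + 1 ≤ 2 := by nlinarith
    have b5 : (2 * δ + 1) * (2 * δ / |φ|) ≤ 2 * (2 * δ / |φ|) := by gcongr
    have b6 : H / d / X * (3 / 8) ≤ 4 * δ / |φ| := by
      rw [b1] at h1
      have : 2 * (2 * δ / |φ|) = 4 * δ / |φ| := by ring
      linarith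
    rw [le_div_iff₀ hφ0] at b6
    rw [le_div_iff₀ hH0]
    have b7 : |φ| * H * 3 ≤ 32 * δ * (d * X) := by
      have : H / d / X * (3 / 8) * |φ| = |φ| * H * 3 / (8 * (d * X)) := by field_simp
      rw [this, div_le_iff₀ (by positivity)] at b6
      linarith
    have b8 : (d : ℝ) * X ≤ X ^ 3 * 2 := by nlinarith
    calc |φ| * H ≤ 32 * δ * (d * X) := by nlinarith [mul_pos hφ0 hH0]
      _ ≤ 32 * δ * (X ^ 3 * 2) := by gcongr
      _ = δ * (2 ^ 6 * X ^ 3) := by ring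
      _ ≤ δ * (X ^ 7 * X ^ 3) := by
        have : (2 : ℝ) ^ 6 ≤ X ^ 7 :=
          (two_pow_le_pow hX 6).trans (pow_le_pow_right₀ (by linarith) (by norm_num))
        gcongr
      _ = _ := by ring
  · intro s hs
    obtain ⟨a, ha, rfl⟩ := mem_image.1 hs
    have h1 := mem_Icc.1 (hT (mem_filter.1 ha).1)
    have h3 := Int.emod_add_mul_ediv a d
    have h4 := Int.emod_nonneg a (b := d) (by omega)
    refine ⟨Int.ediv_nonneg (by omega) (by omega), ?_⟩
    rw [le_div_iff₀ hd0']
    have : a / (d : ℤ) * d ≤ H := by linarith [mul_comm (a / (d : ℤ)) (d : ℤ)]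
    exact_mod_cast this
  · intro s hs
    obtain ⟨a, ha, rfl⟩ := mem_image.1 hs
    obtain ⟨h1, h2⟩ := mem_filter.1 ha
    have h3 := Int.emod_add_mul_ediv a d
    rw [h2] at h3
    refine le_trans (le_of_eq ?_) (h a h1)
    have e : φ * ((a / (d : ℤ) : ℤ) : ℝ) + (θ * c + β) =
        (θ * a + β) - ((round (d * θ) * (a / (d : ℤ)) : ℤ) : ℝ) := by
      have : (a : ℝ) = c + d * ((a / (d : ℤ) : ℤ) : ℝ) := by exact_mod_cast h3.symm
      rw [hφ, this]; push_cast; ring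
    rw [e, nd, nd, round_sub_intCast]; push_cast; congr 1; ring

end Phase

section Weyl
variable {ι κ : Type*}

lemma exists_scale {X : ℝ} (hX : 2 ≤ X) {M k : ℕ} (hM : X ^ (k + 1) ≤ M) :
    ∃ H : ℕ, 0 < H ∧ H * X ^ k ≤ M ∧ M ≤ H * X ^ (k + 1) := by
  have hX0 : 0 < X := by linarith
  refine ⟨⌊(M : ℝ) / X ^ k⌋₊, ?_, ?_, ?_⟩
  · refine Nat.floor_pos.2 ?_
    rw [one_le_div (by positivity)]
    refine le_trans ?_ hM
    exact pow_le_pow_right₀ (by linarith) (by omega)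
  · have := Nat.floor_le (show 0 ≤ (M : ℝ) / X ^ k by positivity)
    rwa [le_div_iff₀ (by positivity)] at this
  · have h1 := (Nat.lt_floor_add_one ((M : ℝ) / X ^ k)).le
    have h2 : 2 ≤ (M : ℝ) / X ^ k := by
      rw [le_div_iff₀ (by positivity)]
      refine le_trans ?_ hM
      rw [pow_succ']; gcongr
    have h3 : (M : ℝ) / X ^ k ≤ 2 * ⌊(M : ℝ) / X ^ k⌋₊ := by linarith
    rw [div_le_iff₀ (by positivity)] at h3
    calc (M : ℝ) ≤ 2 * ⌊(M : ℝ) / X ^ k⌋₊ * X ^ k := h3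
      _ ≤ X * ⌊(M : ℝ) / X ^ k⌋₊ * X ^ k := by gcongr
      _ = _ := by ring

lemma exists_le_dens_of_exists {s : Finset ι} {t : Finset κ} {P : κ → ι → Prop} {η : ℝ}
    (hη : 0 < η) (h : η ≤ dens s (fun i => ∃ c ∈ t, P c i)) : ∃ c ∈ t, η / #t ≤ dens s (P c) := by
  classical
  have h1 : dens s (fun i => ∃ c ∈ t, P c i) ≤ ∑ c ∈ t, dens s (P c) := by
    simp only [dens]
    rw [← Finset.expect_sum_comm]
    refine Finset.expect_le_expect fun i _ => ?_
    split_ifs with hi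
    · obtain ⟨c, hc, hp⟩ := hi
      have := Finset.single_le_sum (f := fun c => if P c i then (1 : ℝ) else 0)
        (fun c _ => by split_ifs <;> norm_num) hc
      simpa [hp] using this
    · exact sum_nonneg fun c _ => by split_ifs <;> norm_num
  have ht : t.Nonempty := by
    by_contra ht
    rw [not_nonempty_iff_eq_empty.1 ht] at h1 h
    simp only [sum_empty] at h1
    linarith
  have h2 : ∑ c ∈ t, η / #t ≤ ∑ c ∈ t, dens s (P c) := by
    rw [sum_const, nsmul_eq_mul, mul_div_cancel₀]
    · linarith
    · exact_mod_cast ht.card_ne_zero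
  exact exists_le_of_sum_le ht h2

lemma exists_small_denominator_of_dens {H : ℕ} {X θ β δ : ℝ} (hX : 2 ≤ X) (hH : X ^ 8 ≤ H)
    (hδ : 0 ≤ δ) (hδX : δ ≤ 1 / X ^ 8)
    (h : 1 / X ≤ dens (Icc (1 : ℤ) H) (fun t => nd (θ * t + β) ≤ δ)) :
    ∃ d : ℕ, 0 < d ∧ (d : ℝ) ≤ X ^ 3 ∧ nd (d * θ) ≤ δ * X ^ 10 / H := by
  classical
  have hH0 : (0 : ℝ) < H := lt_of_lt_of_le (by positivity) hH
  refine exists_small_denominator (T := {t ∈ Icc (1 : ℤ) H | nd (θ * t + β) ≤ δ})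
    hX hH hδ hδX (filter_subset _ _) ?_ (fun t ht => (mem_filter.1 ht).2)
  rw [dens_eq_card_div, card_Icc_one, div_le_div_iff₀ (by linarith) hH0] at h
  rw [div_le_iff₀ (by linarith)]
  linarith

lemma nd_natCast_mul_le (n : ℕ) (a : ℝ) : nd (n * a) ≤ n * nd a := by
  simpa using nd_intCast_mul_le n a

set_option maxHeartbeats 1000000 in
/-- Weyl's inequality for quadratic phases, inverse form. -/
lemma weyl_quadratic {M : ℕ} {X α β : ℝ} (hX : 2 ≤ X) (hM : X ^ 80 ≤ M)
    (h : 1 / X ≤ ‖𝔼 y ∈ Icc (1 : ℤ) M, ee (α * y ^ 2 + β * y)‖) :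
    ∃ d : ℕ, 0 < d ∧ (d : ℝ) ≤ X ^ 16 ∧ nd (d * α) ≤ X ^ 59 / M ^ 2 ∧ nd (d * β) ≤ X ^ 75 / M := by
  have hX0 : 0 < X := by linarith
  have hX1 : 1 ≤ X := by linarith
  have hM0 : (0 : ℝ) < M := lt_of_lt_of_le (by positivity) hM
  have hM0' : 0 < M := by exact_mod_cast hM0
  have hpow : ∀ n, n ≤ 80 → X ^ n ≤ M := fun n hn => (pow_le_pow_right₀ hX1 hn).trans hM
  set a : ℤ → ℂ := fun y => ee (α * y ^ 2 + β * y) with ha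
  have ha1 : ∀ y, ‖a y‖ ≤ 1 := fun y => (norm_ee _).le
  obtain ⟨d₁, hd₁, hd₁X, hd₁α⟩ : ∃ d : ℕ, 0 < d ∧ (d : ℝ) ≤ X ^ 15 ∧
      nd (d * (2 * α)) ≤ X ^ 59 / M ^ 2 := by
    obtain ⟨H, hH, hH1, hH2⟩ := exists_scale hX (k := 3) (hpow 4 (by norm_num))
    have hH0 : (0 : ℝ) < H := by exact_mod_cast hH
    set S := Icc (1 : ℤ) H with hS
    have hSn : S.Nonempty := Icc_one_nonempty hH
    have h1 := norm_expect_sub_expect_shift_le M a ha1 S hSn (fun i => i) H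
      (fun i hi => mem_Icc_cast hi)
    have h2 : 2 * (H : ℝ) / M ≤ 1 / (2 * X) := by
      rw [div_le_div_iff₀ hM0 (by positivity)]
      have : 4 * X ≤ X ^ 3 := by nlinarith [mul_le_mul hX hX (by norm_num) hX0.le]
      nlinarith
    have h3 : 1 / (2 * X) ≤ ‖𝔼 i ∈ S, 𝔼 y ∈ Icc (1 : ℤ) M, a (y + i)‖ := by
      have e : 1 / X = 1 / (2 * X) + 1 / (2 * X) := by field_simp; norm_num
      have := norm_sub_norm_le (𝔼 y ∈ Icc (1 : ℤ) M, a y) (𝔼 i ∈ S, 𝔼 y ∈ Icc (1 : ℤ) M, a (y + i))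
      linarith
    have h4 : (1 / (2 * X)) ^ 2 ≤ 𝔼 i ∈ S, 𝔼 j ∈ S,
        ‖𝔼 y ∈ Icc (1 : ℤ) M, a (y + i) * conj (a (y + j))‖ := by
      refine (pow_le_pow_left₀ (by positivity) h3 2).trans ?_
      rw [Finset.expect_comm]
      refine le_trans (pow_le_pow_left₀ (norm_nonneg _) (norm_expect_le _ _) 2)
        ((sq_expect_le _ _).trans ?_)
      exact expect_normSq_expect_le (Icc (1 : ℤ) M) S (fun y i => a (y + i))
    rw [Finset.expect_comm] at h4
    obtain ⟨j, hj, hj4⟩ := Finset.exists_le_of_le_expect hSn h4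
    have h5 := le_dens_of_le_expect (by positivity) (fun i _ =>
      norm_expect_le_of_le zero_le_one fun y _ => norm_mul_conj_le_one (ha1 _) (ha1 _)) hj4
    have e8 : (1 / (2 * X)) ^ 2 / 2 = 1 / (8 * X ^ 2) := by field_simp; norm_num
    rw [e8] at h5
    have h85 : 8 * X ^ 2 ≤ X ^ 5 := by
      have := two_pow_le_pow hX 3; norm_num at this
      calc 8 * X ^ 2 ≤ X ^ 3 * X ^ 2 := by gcongr
        _ = _ := by ring
    have h6 : 1 / X ^ 5 ≤ dens S (fun i => nd (2 * α * i + (-(2 * α * j))) ≤ X ^ 5 / M) := by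
      refine (one_div_le_one_div_of_le (by positivity) h85).trans (h5.trans (dens_mono ?_))
      intro i _ hi
      have e : ∀ y : ℤ, a (y + i) * conj (a (y + j)) =
          ee ((2 * α * i + (-(2 * α * j))) * y + (α * (i ^ 2 - j ^ 2) + β * (i - j))) := by
        intro y
        simp only [ha]
        rw [ee_mul_conj]; congr 1; push_cast; ring
      simp only [e] at hi
      refine (nd_le_of_linear (by positivity) hM0' hi).trans ?_
      rw [div_mul_eq_mul_div, one_mul, one_div_div]
      gcongr
    have hHM : (M : ℝ) ≤ H * X ^ 4 := hH2
    obtain ⟨d, hd0, hdX, hdn⟩ := exists_small_denominator_of_dens (X := X ^ 5)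
      (hX.trans (le_self_pow₀ hX1 (by norm_num)))
      (by
        have h44 := hpow 44 (by norm_num)
        have : X ^ 40 * X ^ 4 ≤ H * X ^ 4 := by
          rw [← pow_add]; exact h44.trans hHM
        rw [← pow_mul]
        exact le_of_mul_le_mul_right this (by positivity))
      (by positivity)
      (by
        rw [div_le_div_iff₀ hM0 (by positivity)]
        calc X ^ 5 * (X ^ 5) ^ 8 = X ^ 45 := by ring
          _ ≤ 1 * (M : ℝ) := by rw [one_mul]; exact hpow _ (by norm_num)) h6
    refine ⟨d, hd0, by rw [← pow_mul] at hdX; exact hdX, hdn.trans ?_⟩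
    rw [div_mul_eq_mul_div, div_div, div_le_div_iff₀ (by positivity) (by positivity)]
    calc X ^ 5 * (X ^ 5) ^ 10 * (M : ℝ) ^ 2 = X ^ 55 * M * M := by ring
      _ ≤ X ^ 55 * M * (H * X ^ 4) := by gcongr
      _ = _ := by ring
  refine ⟨2 * d₁, by omega, ?_, ?_, ?_⟩
  · push_cast
    calc (2 : ℝ) * d₁ ≤ X * X ^ 15 := by gcongr
      _ = _ := by ring
  · push_cast
    convert hd₁α using 2; ring
  -- the linear coefficient
  set d := 2 * d₁ with hd
  have hdX : (d : ℝ) ≤ X ^ 16 := by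
    rw [hd]; push_cast
    calc (2 : ℝ) * d₁ ≤ X * X ^ 15 := by gcongr
      _ = _ := by ring
  have hd0 : (0 : ℝ) < d := by exact_mod_cast (by omega : 0 < d)
  have hdα : nd (d * α) ≤ X ^ 59 / M ^ 2 := by
    rw [hd]; push_cast
    convert hd₁α using 2; ring
  set φ := d * α - round (d * α) with hφ
  have hφn : |φ| ≤ X ^ 59 / M ^ 2 := hdα
  obtain ⟨J, hJ, hJ1, hJ2⟩ := exists_scale hX (k := 70) (hpow 71 (by norm_num))
  have hJ0 : (0 : ℝ) < J := by exact_mod_cast hJ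
  set S := Icc (1 : ℤ) J with hS
  have hSn : S.Nonempty := Icc_one_nonempty hJ
  have h1 := norm_expect_sub_expect_shift_le M a ha1 S hSn (fun j => d * j) (d * J)
    (fun i hi => by
      have := mem_Icc_cast hi
      refine ⟨mul_nonneg (by omega) this.1, ?_⟩
      push_cast; exact mul_le_mul_of_nonneg_left this.2 hd0.le)
  have h2 : 2 * ((d : ℝ) * J) / M ≤ 1 / (4 * X) := by
    rw [div_le_div_iff₀ hM0 (by positivity)]
    calc 2 * ((d : ℝ) * J) * (4 * X) = 8 * d * X * J := by ring
      _ ≤ X ^ 3 * X ^ 16 * X * J := by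
        have := two_pow_le_pow hX 3; norm_num at this
        gcongr
      _ = J * X ^ 20 := by ring
      _ ≤ J * X ^ 70 := by gcongr; norm_num
      _ ≤ 1 * M := by linarith
  have h3 : ‖(𝔼 j ∈ S, 𝔼 y ∈ Icc (1 : ℤ) M, a (y + d * j)) -
      (𝔼 y ∈ Icc (1 : ℤ) M, a y) * 𝔼 j ∈ S, ee (d * β * j + 0)‖ ≤ 1 / (4 * X) := by
    rw [mul_comm, Finset.expect_mul_expect, ← Finset.expect_sub_distrib]
    refine norm_expect_le_of_le (by positivity) fun j hj => ?_
    rw [← Finset.expect_sub_distrib]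
    refine norm_expect_le_of_le (by positivity) fun y hy => ?_
    have e : a (y + d * j) - ee (d * β * j + 0) * a y =
        ee (d * β * j + 0) * a y * (ee (φ * (2 * y * j + d * j ^ 2)) - 1) := by
      have : a (y + d * j) = ee (d * β * j + 0) * a y * ee (φ * (2 * y * j + d * j ^ 2)) := by
        simp only [ha]
        rw [← ee_add, ← ee_add, ← ee_add_intCast _ (-(round (d * α) * (2 * y * j + d * j ^ 2)))]
        congr 1
        rw [hφ]; push_cast; ring
      rw [this]; ring
    rw [e, norm_mul, norm_mul, norm_ee]
    simp only [ha, norm_ee, one_mul]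
    refine (norm_ee_sub_one_le _).trans ?_
    have hy' := mem_Icc_cast hy
    have hj' := mem_Icc_cast hj
    have hy0 : (0 : ℝ) ≤ y := by exact_mod_cast hy'.1
    have hj0 : (0 : ℝ) ≤ j := by exact_mod_cast hj'.1
    have hJM : (J : ℝ) ≤ M / X ^ 70 := by rw [le_div_iff₀ (by positivity)]; exact hJ1
    have b1 : |2 * (y : ℝ) * j + d * j ^ 2| ≤ 3 * M ^ 2 / X ^ 70 := by
      rw [abs_of_nonneg (by positivity)]
      calc 2 * (y : ℝ) * j + d * j ^ 2 ≤ 2 * M * (M / X ^ 70) + X ^ 16 * (M / X ^ 70) ^ 2 := by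
            gcongr
            · exact hy'.2
            · exact hj'.2.trans hJM
            · exact hj'.2.trans hJM
        _ = 2 * M ^ 2 / X ^ 70 + (M ^ 2 / X ^ 70) * (1 / X ^ 54) := by field_simp
        _ ≤ 2 * M ^ 2 / X ^ 70 + (M ^ 2 / X ^ 70) * 1 := by
            gcongr
            rw [div_le_one (by positivity)]
            exact one_le_pow₀ hX1
        _ = _ := by ring
    rw [abs_mul]
    calc 7 * (|φ| * |2 * (y : ℝ) * j + d * j ^ 2|) ≤
          7 * (X ^ 59 / M ^ 2 * (3 * M ^ 2 / X ^ 70)) := by gcongr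
      _ = 21 / X ^ 11 := by field_simp; norm_num
      _ ≤ 1 / (4 * X) := by
        rw [div_le_div_iff₀ (by positivity) (by positivity)]
        have := two_pow_le_pow hX 10; norm_num at this
        calc 21 * (4 * X) ≤ 1024 * X := by linarith
          _ ≤ X ^ 10 * X := by gcongr
          _ = _ := by ring
  have h4 : 1 / (2 * X) ≤ ‖𝔼 j ∈ S, ee (d * β * j + 0)‖ := by
    have e : 1 / X = 1 / (2 * X) + 1 / (4 * X) + 1 / (4 * X) := by field_simp; norm_num
    have b1 := norm_sub_norm_le (𝔼 y ∈ Icc (1 : ℤ) M, a y)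
      (𝔼 j ∈ S, 𝔼 y ∈ Icc (1 : ℤ) M, a (y + d * j))
    have b2 := norm_sub_norm_le (𝔼 j ∈ S, 𝔼 y ∈ Icc (1 : ℤ) M, a (y + d * j))
      ((𝔼 y ∈ Icc (1 : ℤ) M, a y) * 𝔼 j ∈ S, ee (d * β * j + 0))
    have b3 : ‖(𝔼 y ∈ Icc (1 : ℤ) M, a y) * 𝔼 j ∈ S, ee (d * β * j + 0)‖ ≤
        ‖𝔼 j ∈ S, ee (d * β * j + 0)‖ := by
      rw [norm_mul]
      exact mul_le_of_le_one_left (norm_nonneg _)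
        (norm_expect_le_of_le zero_le_one fun y _ => ha1 y)
    linarith
  refine (nd_le_of_linear (by positivity) hJ h4).trans ?_
  rw [div_le_div_iff₀ (by positivity) hM0]
  have hXX : 2 * X * X ^ 71 ≤ X ^ 75 := by
    calc 2 * X * X ^ 71 ≤ X * X * X ^ 71 := by gcongr
      _ = X ^ 73 := by ring
      _ ≤ _ := pow_le_pow_right₀ hX1 (by norm_num)
  have e : X ^ 75 * (1 / (2 * X) * (J : ℝ)) = X ^ 75 * J / (2 * X) := by ring
  rw [e, one_mul, le_div_iff₀ (by positivity)]
  calc (M : ℝ) * (2 * X) ≤ J * X ^ 71 * (2 * X) := by gcongr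
    _ = (2 * X * X ^ 71) * J := by ring
    _ ≤ _ := by gcongr

/-- `θ` lies on a major arc at scale `M` with parameter `D`. -/
def Major (D : ℝ) (M : ℕ) (θ : ℝ) : Prop :=
  ∃ d : ℕ, 0 < d ∧ (d : ℝ) ≤ D ∧ nd (d * θ) ≤ D / M ^ 2

lemma Major.mono {D D' : ℝ} {M : ℕ} {θ : ℝ} (h : Major D M θ) (hD : D ≤ D') : Major D' M θ := by
  obtain ⟨d, h1, h2, h3⟩ := h
  exact ⟨d, h1, h2.trans hD, h3.trans (by gcongr)⟩

lemma dens_eq_card_filter_div (s : Finset ι) (p : ι → Prop) [DecidablePred p] :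
    dens s p = 𝔼 i ∈ s, if p i then (1 : ℝ) else 0 := by
  rw [dens]; refine Finset.expect_congr rfl fun i _ => ?_
  congr

variable {G : Type*} [AddCommGroup G] [Fintype G]

set_option maxHeartbeats 1000000 in
/-- If quadratic phases with varying frequencies correlate with translates along `e`, then the
frequencies are often on major arcs. -/
lemma dens_major_of_correlation (e : G) {M : ℕ} {X : ℝ} (hX : 2 ≤ X) (hM : X ^ 1100 ≤ M)
    {g f : G → ℂ} (hg : ∀ x, ‖g x‖ ≤ 1) (hf : ∀ x, ‖f x‖ ≤ 1) (θ : G → ℝ)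
    (h : 1 / X ≤ ‖𝔼 x, 𝔼 y ∈ Icc (1 : ℤ) M, g x * f (x + y • e) * ee (θ x * y ^ 2)‖) :
    1 / X ^ 6 ≤ dens univ (fun x => g x ≠ 0 ∧ Major (X ^ 1240) M (θ x)) := by
  classical
  have hX0 : 0 < X := by linarith
  have hX1 : 1 ≤ X := by linarith
  have hM0 : (0 : ℝ) < M := lt_of_lt_of_le (by positivity) hM
  have hM0' : 0 < M := by exact_mod_cast hM0
  have hpow : ∀ n, n ≤ 1100 → X ^ n ≤ M := fun n hn => (pow_le_pow_right₀ hX1 hn).trans hM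
  obtain ⟨H, hH, hH1, hH2⟩ := exists_scale hX (k := 3) (hpow 4 (by norm_num))
  have hH0 : (0 : ℝ) < H := by exact_mod_cast hH
  have hHM : (M : ℝ) ≤ H * X ^ 4 := hH2
  have hHM' : (H : ℝ) ≤ M := by
    refine le_trans ?_ hH1
    exact le_mul_of_one_le_right hH0.le (one_le_pow₀ hX1)
  set S := Icc (1 : ℤ) H with hS
  have hSn : S.Nonempty := Icc_one_nonempty hH
  set Y := Icc (1 : ℤ) M with hY
  set a : G → ℤ → ℂ := fun x y => g x * f (x + y • e) * ee (θ x * y ^ 2) with ha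
  have ha1 : ∀ x y, ‖a x y‖ ≤ 1 := fun x y =>
    norm_mul_le_one (norm_mul_le_one (hg _) (hf _)) (norm_ee _).le
  set b : G × ℤ → ℤ → ℂ := fun p h => g (p.1 - h • e) * ee (θ (p.1 - h • e) * (p.2 + h) ^ 2) with hb
  have hb1 : ∀ p h, ‖b p h‖ ≤ 1 := fun p h => norm_mul_le_one (hg _) (norm_ee _).le
  set L' := 𝔼 x, 𝔼 i ∈ S, 𝔼 y ∈ Y, a x (y + i) with hL'
  have h1 : ‖(𝔼 x, 𝔼 y ∈ Y, a x y) - L'‖ ≤ 1 / (2 * X) := by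
    rw [hL', ← Finset.expect_sub_distrib]
    refine norm_expect_le_of_le (by positivity) fun x _ => ?_
    refine (norm_expect_sub_expect_shift_le M (a x) (ha1 x) S hSn (fun i => i) H
      (fun i hi => mem_Icc_cast hi)).trans ?_
    rw [div_le_div_iff₀ hM0 (by positivity)]
    have : 4 * X ≤ X ^ 3 := by nlinarith [mul_le_mul hX hX (by norm_num) hX0.le]
    nlinarith
  have h2 : 1 / (2 * X) ≤ ‖L'‖ := by
    have e : 1 / X = 1 / (2 * X) + 1 / (2 * X) := by field_simp; norm_num
    have := norm_sub_norm_le (𝔼 x, 𝔼 y ∈ Y, a x y) L'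
    linarith
  have h3 : L' = 𝔼 p ∈ (univ : Finset G) ×ˢ Y, f (p.1 + p.2 • e) * 𝔼 i ∈ S, b p i := by
    rw [Finset.expect_product, hL', Finset.expect_comm]
    simp_rw [Finset.mul_expect]
    symm
    rw [expect_rotate]
    refine Finset.expect_congr rfl fun i _ => ?_
    symm
    rw [← expect_add_right _ (-(i • e))]
    refine Finset.expect_congr rfl fun x _ => Finset.expect_congr rfl fun y _ => ?_
    simp only [ha, hb]
    have a1 : x + -(i • e) = x - i • e := by abel
    have a2 : x - i • e + (y + i) • e = x + y • e := by module
    rw [a1, a2]; push_cast; ring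
  have h4 : (1 / (2 * X)) ^ 2 ≤ 𝔼 i ∈ S, 𝔼 j ∈ S,
      ‖𝔼 p ∈ (univ : Finset G) ×ˢ Y, b p i * conj (b p j)‖ := by
    refine (pow_le_pow_left₀ (by positivity) h2 2).trans ?_
    rw [h3]
    exact (normSq_expect_mul_le _ _ _ fun p _ => hf _).trans
      (expect_normSq_expect_le ((univ : Finset G) ×ˢ Y) S b)
  -- the density of good triples
  set κ : ℝ := X ^ 376 / M with hκ
  set D := ⌊X ^ 80⌋₊ with hD
  set Q : ℤ → ℤ → G → Prop := fun i j x => g x ≠ 0 ∧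
    ∃ d ∈ Icc 1 D, nd ((d * 2 * θ x) * i + (-(d * 2 * θ x * j))) ≤ κ with hQ
  have hXY : (2 : ℝ) ≤ X ^ 5 := hX.trans (le_self_pow₀ hX1 (by norm_num))
  have h5 : 1 / X ^ 5 ≤ 𝔼 i ∈ S, 𝔼 j ∈ S, dens univ (Q i j) := by
    have c1 : (1 / (2 * X)) ^ 2 ≤ 𝔼 q ∈ S ×ˢ S ×ˢ (univ : Finset G),
        ‖𝔼 y ∈ Y, b (q.2.2, y) q.1 * conj (b (q.2.2, y) q.2.1)‖ := by
      refine h4.trans ?_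
      rw [expect_product_three S S univ (fun i j x => ‖𝔼 y ∈ Y, b (x, y) i * conj (b (x, y) j)‖)]
      refine Finset.expect_le_expect fun i _ => Finset.expect_le_expect fun j _ => ?_
      rw [Finset.expect_product]
      exact norm_expect_le _ _
    have c2 := le_dens_of_le_expect (by positivity) (fun q _ =>
      norm_expect_le_of_le zero_le_one fun y _ => norm_mul_conj_le_one (hb1 _ _) (hb1 _ _)) c1
    have e8 : (1 / (2 * X)) ^ 2 / 2 = 1 / (8 * X ^ 2) := by field_simp; norm_num
    rw [e8] at c2
    have h85 : 8 * X ^ 2 ≤ X ^ 5 := by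
      have := two_pow_le_pow hX 3; norm_num at this
      calc 8 * X ^ 2 ≤ X ^ 3 * X ^ 2 := by gcongr
        _ = _ := by ring
    have h85' := one_div_le_one_div_of_le (by positivity) h85
    have c3 : 1 / X ^ 5 ≤ dens (S ×ˢ S ×ˢ (univ : Finset G))
        (fun q => Q q.1 q.2.1 (q.2.2 - q.2.1 • e)) := by
      refine h85'.trans (c2.trans (dens_mono ?_))
      rintro ⟨i, j, x⟩ hq hi
      simp only [mem_product] at hq
      simp only at hi
      have hi' := h85'.trans hi
      set u := x - i • e
      set v := x - j • e with hv
      have e1 : ∀ y : ℤ, b (x, y) i * conj (b (x, y) j) =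
          (g u * conj (g v) * ee (θ u * i ^ 2 - θ v * j ^ 2)) *
            ee ((θ u - θ v) * y ^ 2 + (2 * (i * θ u - j * θ v)) * y) := by
        intro y
        simp only [hb, map_mul]
        rw [show ∀ p q r s : ℂ, p * q * (r * s) = p * r * (q * s) from fun p q r s => by ring,
          ee_mul_conj, mul_assoc (g u * conj (g v)), ← ee_add]
        congr 2
        simp only [u, v]
        ring
      simp only [e1] at hi'
      rw [← Finset.mul_expect, norm_mul] at hi'
      have n1 : ‖g u * conj (g v) * ee (θ u * i ^ 2 - θ v * j ^ 2)‖ ≤ 1 :=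
        norm_mul_le_one (norm_mul_conj_le_one (hg _) (hg _)) (norm_ee _).le
      have hgv : g v ≠ 0 := by
        intro h0
        rw [h0] at hi'
        simp only [map_zero, mul_zero, zero_mul, norm_zero] at hi'
        have : 0 < 1 / X ^ 5 := by positivity
        linarith
      have hw := hi'.trans (mul_le_of_le_one_left (norm_nonneg _) n1)
      have hM400 : (X ^ 5) ^ 80 ≤ M := by
        rw [show (X ^ 5) ^ 80 = X ^ 400 by ring]; exact hpow 400 (by norm_num)
      obtain ⟨d, hd0, hdX, hdα, hdβ⟩ := weyl_quadratic hXY hM400 hw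
      rw [← pow_mul] at hdX hdα hdβ
      refine ⟨hgv, d, mem_Icc.2 ⟨hd0, Nat.le_floor hdX⟩, ?_⟩
      have hi0 := mem_Icc_cast hq.1
      have hi0' : (0 : ℝ) ≤ i := by exact_mod_cast hi0.1
      have e2 : (d * 2 * θ v) * i + (-(d * 2 * θ v * j)) =
          d * (2 * (i * θ u - j * θ v)) - ((2 * i : ℤ) : ℝ) * (d * (θ u - θ v)) := by
        push_cast; ring
      simp only
      rw [e2]
      refine (nd_sub_le _ _).trans ((add_le_add hdβ (nd_intCast_mul_le _ _)).trans ?_)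
      push_cast
      rw [abs_of_nonneg (by positivity)]
      have e3 : 2 * (i : ℝ) * nd (d * (θ u - θ v)) ≤ 2 * M * (X ^ (5 * 59) / M ^ 2) := by
        have := nd_nonneg (d * (θ u - θ v))
        have := hi0.2.trans hHM'
        gcongr
      have e4 : 2 * M * (X ^ (5 * 59) / M ^ 2) = 2 * X ^ 295 / M := by field_simp
      rw [e4] at e3
      refine (add_le_add le_rfl e3).trans ?_
      rw [hκ, ← add_div]
      gcongr
      have e5 : 2 * X ^ 295 ≤ X ^ 375 := by
        calc 2 * X ^ 295 ≤ X * X ^ 295 := by gcongr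
          _ = X ^ 296 := by ring
          _ ≤ _ := pow_le_pow_right₀ hX1 (by norm_num)
      calc X ^ (5 * 75) + 2 * X ^ 295 ≤ X ^ 375 + X ^ 375 := by
            norm_num; exact e5
        _ = 2 * X ^ 375 := by ring
        _ ≤ X * X ^ 375 := by gcongr
        _ = _ := by ring
    refine c3.trans (le_of_eq ?_)
    rw [dens_eq_card_filter_div, expect_product_three S S univ
      (fun i j x => if Q i j (x - j • e) then (1 : ℝ) else 0)]
    refine Finset.expect_congr rfl fun i _ => Finset.expect_congr rfl fun j _ => ?_
    rw [dens_eq_card_filter_div,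
      ← expect_add_right (fun x => if Q i j x then (1 : ℝ) else 0) (-(j • e))]
    simp only [sub_eq_add_neg]
  have h6 : 1 / X ^ 5 ≤ 𝔼 x, 𝔼 i ∈ S, 𝔼 j ∈ S, if Q i j x then (1 : ℝ) else 0 := by
    refine h5.trans (le_of_eq ?_)
    simp_rw [dens_eq_card_filter_div]
    rw [expect_rotate]
  have h7 := le_dens_of_le_expect (by positivity) (fun x _ => expect_le_of_le zero_le_one
    fun i _ => expect_le_of_le zero_le_one fun j _ => by split_ifs <;> norm_num) h6
  have h56 : 1 / X ^ 6 ≤ 1 / X ^ 5 / 2 := by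
    rw [div_div]
    refine one_div_le_one_div_of_le (by positivity) ?_
    calc X ^ 5 * 2 ≤ X ^ 5 * X := by gcongr
      _ = _ := by ring
  refine h56.trans (h7.trans (dens_mono fun x _ hx => ?_))
  have hx := h56.trans hx
  rw [Finset.expect_comm] at hx
  obtain ⟨j, hj, hx⟩ := Finset.exists_le_of_le_expect hSn hx
  rw [← dens_eq_card_filter_div] at hx
  have hgx : g x ≠ 0 := by
    by_contra hg0
    have : dens S (fun i => Q i j x) = 0 := by
      rw [dens_eq_card_filter_div]
      simp [hQ, hg0]
    rw [this] at hx
    have : 0 < 1 / X ^ 6 := by positivity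
    linarith
  refine ⟨hgx, ?_⟩
  have hx' : 1 / X ^ 6 ≤ dens S (fun i => ∃ d ∈ Icc 1 D, nd ((d * 2 * θ x) * i +
      (-(d * 2 * θ x * j))) ≤ κ) := hx.trans (dens_mono fun i _ hi => hi.2)
  have hX6 : 0 < 1 / X ^ 6 := by positivity
  obtain ⟨d, hd, hdd⟩ := exists_le_dens_of_exists (P := fun (d : ℕ) (i : ℤ) =>
    nd ((d * 2 * θ x) * i + (-(d * 2 * θ x * j))) ≤ κ) hX6 hx'
  have hDX : (D : ℝ) ≤ X ^ 80 := Nat.floor_le (by positivity)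
  obtain ⟨hd0, hdD⟩ := mem_Icc.1 hd
  have hdX : (d : ℝ) ≤ X ^ 80 := le_trans (by exact_mod_cast hdD) hDX
  have hDpos : (0 : ℝ) < D := by exact_mod_cast (by omega : 0 < D)
  have h8 : 1 / X ^ 86 ≤ dens S (fun i : ℤ => nd ((d * 2 * θ x) * i + (-(d * 2 * θ x * j))) ≤ κ) := by
    refine le_trans ?_ hdd
    rw [Nat.card_Icc, Nat.add_sub_cancel, div_div]
    refine one_div_le_one_div_of_le (by positivity) ?_
    calc X ^ 6 * D ≤ X ^ 6 * X ^ 80 := by gcongr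
      _ = _ := by ring
  have hH688 : (X ^ 86) ^ 8 ≤ H := by
    have h44 := hpow 692 (by norm_num)
    have e1 : (X ^ 86) ^ 8 * X ^ 4 = X ^ 692 := by ring
    refine le_of_mul_le_mul_right ?_ (show 0 < X ^ 4 by positivity)
    rw [e1]; exact h44.trans hHM
  have hκ688 : κ ≤ 1 / (X ^ 86) ^ 8 := by
    have e1 : X ^ 376 * (X ^ 86) ^ 8 = X ^ 1064 := by ring
    rw [hκ, div_le_div_iff₀ hM0 (by positivity), e1, one_mul]
    exact hpow 1064 (by norm_num)
  have hκ0 : 0 ≤ κ := by positivity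
  have hX86 : 2 ≤ X ^ 86 := hX.trans (le_self_pow₀ hX1 (by norm_num))
  obtain ⟨d₂, hd₂, hd₂X, hd₂n⟩ := exists_small_denominator_of_dens hX86 hH688 hκ0 hκ688 h8
  refine ⟨d₂ * (d * 2), by positivity, ?_, ?_⟩
  · push_cast
    calc (d₂ : ℝ) * (d * 2) ≤ (X ^ 86) ^ 3 * (X ^ 80 * X) := by gcongr
      _ = X ^ 339 := by ring
      _ ≤ _ := pow_le_pow_right₀ hX1 (by norm_num)
  · push_cast
    rw [show (d₂ : ℝ) * (d * 2) * θ x = d₂ * (d * 2 * θ x) by ring]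
    refine hd₂n.trans ?_
    rw [hκ, div_mul_eq_mul_div, div_div, div_le_div_iff₀ (by positivity) (by positivity)]
    calc X ^ 376 * (X ^ 86) ^ 10 * (M : ℝ) ^ 2 = X ^ 1236 * M * M := by ring
      _ ≤ X ^ 1236 * M * (H * X ^ 4) := by gcongr
      _ = _ := by ring

end Weyl

section Dual
variable {H : Type*} [AddCommGroup H] [Fintype H]

lemma norm_addChar (χ : AddChar H ℂ) (s : H) : ‖χ s‖ = 1 := AddChar.norm_apply χ s

lemma conj_addChar (χ : AddChar H ℂ) (s : H) : conj (χ s) = χ (-s) :=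
  (AddChar.map_neg_eq_conj χ s).symm

/-- Parseval's identity on a finite abelian group. -/
lemma sum_normSq_expect_mul (φ : H → ℂ) :
    ∑ χ : AddChar H ℂ, ‖𝔼 s, φ s * χ s‖ ^ 2 = 𝔼 s, ‖φ s‖ ^ 2 := by
  classical
  have h : ((∑ χ : AddChar H ℂ, ‖𝔼 s, φ s * χ s‖ ^ 2 : ℝ) : ℂ) =
      ((𝔼 s, ‖φ s‖ ^ 2 : ℝ) : ℂ) := by
    rw [Complex.ofReal_sum, ofReal_expect]
    simp_rw [normSq_expect]
    rw [← Finset.expect_sum_comm]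
    refine Finset.expect_congr rfl fun s _ => ?_
    rw [← Finset.expect_sum_comm]
    have e : ∀ t, ∑ χ : AddChar H ℂ, φ s * χ s * conj (φ t * χ t) =
        if t = s then φ s * conj (φ t) * Fintype.card H else 0 := by
      intro t
      have : ∀ χ : AddChar H ℂ, φ s * χ s * conj (φ t * χ t) =
          φ s * conj (φ t) * χ (s - t) := by
        intro χ
        rw [map_mul, conj_addChar, sub_eq_add_neg, AddChar.map_add_eq_mul]; ring
      simp_rw [this]
      rw [← Finset.mul_sum, AddChar.sum_apply_eq_ite]
      by_cases hts : t = s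
      · simp [hts]
      · simp [hts, sub_eq_zero, Ne.symm hts]
    simp_rw [e]
    rw [Fintype.expect_eq_sum_div_card, Finset.sum_ite_eq' univ s]
    simp only [mem_univ, if_true]
    rw [mul_div_assoc, div_self (by exact_mod_cast Fintype.card_ne_zero), mul_one,
      Complex.mul_conj, Complex.normSq_eq_norm_sq]
  exact_mod_cast h

lemma expect_autocorrelation_mul (W : H → ℂ) (χ : AddChar H ℂ) :
    𝔼 t, (𝔼 s, W s * conj (W (s + t))) * χ t =
      conj (𝔼 s, W s * (χ⁻¹) s) * 𝔼 s, W s * (χ⁻¹) s := by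
  have h1 : 𝔼 t, (𝔼 s, W s * conj (W (s + t))) * χ t =
      𝔼 s, 𝔼 u, W s * (χ⁻¹) s * conj (W u * (χ⁻¹) u) := by
    simp_rw [Finset.expect_mul]
    rw [Finset.expect_comm]
    refine Finset.expect_congr rfl fun s _ => ?_
    refine Fintype.expect_equiv (Equiv.addLeft s) _ _ fun t => ?_
    simp only [Equiv.coe_addLeft, map_mul, AddChar.inv_apply]
    rw [conj_addChar, neg_neg, AddChar.map_add_eq_mul]
    have : χ (-s) * χ s = 1 := by rw [← AddChar.map_add_eq_mul]; simp
    linear_combination (-(W s * conj (W (s + t)) * χ t)) * this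
  rw [h1, ← Finset.expect_mul_expect, conj_expect, mul_comm]

/-- The `U²` functional of a bounded function is at most its largest Fourier coefficient. -/
lemma expect_normSq_autocorrelation_le {W : H → ℂ} (hW : ∀ s, ‖W s‖ ≤ 1) {B : ℝ}
    (hB : ∀ χ : AddChar H ℂ, ‖𝔼 s, W s * χ s‖ ^ 2 ≤ B) :
    𝔼 t, ‖𝔼 s, W s * conj (W (s + t))‖ ^ 2 ≤ B := by
  have hB0 : 0 ≤ B := le_trans (by positivity) (hB 1)
  rw [← sum_normSq_expect_mul]
  simp_rw [expect_autocorrelation_mul, norm_mul, RCLike.norm_conj]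
  calc ∑ χ : AddChar H ℂ, (‖𝔼 s, W s * (χ⁻¹) s‖ * ‖𝔼 s, W s * (χ⁻¹) s‖) ^ 2
      ≤ ∑ χ : AddChar H ℂ, B * ‖𝔼 s, W s * (χ⁻¹) s‖ ^ 2 := by
        refine sum_le_sum fun χ _ => ?_
        rw [mul_pow]
        exact mul_le_mul_of_nonneg_right (hB _) (by positivity)
    _ = B * ∑ χ : AddChar H ℂ, ‖𝔼 s, W s * χ s‖ ^ 2 := by
        rw [← Finset.mul_sum]
        congr 1
        exact Fintype.sum_equiv (Equiv.inv _) _ _ fun χ => rfl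
    _ = B * 𝔼 s, ‖W s‖ ^ 2 := by rw [sum_normSq_expect_mul]
    _ ≤ B * 1 := by
        refine mul_le_mul_of_nonneg_left ?_ hB0
        exact expect_le_of_le zero_le_one fun s _ => pow_le_one₀ (norm_nonneg _) (hW s)
    _ = B := mul_one B

end Dual

section Inverse
variable {G : Type*} [AddCommGroup G] [Fintype G] (Γ : AddSubgroup G) [Fintype Γ]

lemma gowersTwo_eq_expect (w : G → ℂ) :
    gowersTwo Γ w = 𝔼 x, 𝔼 t : Γ, ‖𝔼 s : Γ, w (x + s) * conj (w (x + s + t))‖ ^ 2 := by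
  simp only [gowersTwo, gowersOne, sqAvg]
  rw [Finset.expect_comm]
  rfl

lemma expect_coset (f : G → ℂ) : 𝔼 x, 𝔼 s : Γ, f (x + s) = 𝔼 x, f x := by
  rw [Finset.expect_comm]
  simp_rw [expect_add_right]
  exact Fintype.expect_const _

lemma expect_mul_addChar_add (w : G → ℂ) (χ : AddChar Γ ℂ) (x : G) (u : Γ) :
    𝔼 s : Γ, w (x + u + s) * χ s = χ (-u) * 𝔼 s : Γ, w (x + s) * χ s := by
  rw [Finset.mul_expect]
  refine Fintype.expect_equiv (Equiv.addLeft u) _ _ fun s => ?_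
  simp only [Equiv.coe_addLeft, AddSubgroup.coe_add, AddChar.map_add_eq_mul]
  have : χ (-u) * χ u = 1 := by rw [← AddChar.map_add_eq_mul]; simp
  rw [← add_assoc]
  linear_combination (-(w (x + u + s) * χ s)) * this

/-- The inverse theorem for the `U²` functional along `Γ`. -/
theorem gowersTwo_inverse {w : G → ℂ} (hw : ∀ x, ‖w x‖ ≤ 1) {ε : ℝ} (hε : 0 ≤ ε) :
    ∃ (χ : G → AddChar Γ ℂ) (P : G → ℂ),
      (∀ x (s : Γ), χ (x + s) = χ x) ∧ (∀ x, ‖P x‖ ≤ 1) ∧ (∀ x (s : Γ), P (x + s) = P x * χ x s) ∧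
      (gowersTwo Γ w - ε ≤ (𝔼 x, w x * P x).re) ∧
      (∀ x, P x ≠ 0 → ε ≤ ‖𝔼 s : Γ, w (x + s) * χ x s‖ ^ 2) := by
  classical
  set c : G → AddChar Γ ℂ → ℂ := fun x χ => 𝔼 s : Γ, w (x + s) * χ s with hc
  have hcs : ∀ x (u : Γ) χ, c (x + u) χ = χ (-u) * c x χ := fun x u χ =>
    expect_mul_addChar_add Γ w χ x u
  have hex : ∀ q : G ⧸ Γ, ∃ χ : AddChar Γ ℂ, ∀ χ', ‖c q.out χ'‖ ≤ ‖c q.out χ‖ := fun q =>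
    Finite.exists_max fun χ => ‖c q.out χ‖
  choose χ₀ hχ₀ using hex
  set χ : G → AddChar Γ ℂ := fun x => χ₀ (QuotientAddGroup.mk x) with hχ
  have hχinv : ∀ x (s : Γ), χ (x + s) = χ x := by
    intro x s
    simp only [hχ]
    congr 1
    rw [QuotientAddGroup.eq]
    simp
  have hmax : ∀ x χ', ‖c x χ'‖ ≤ ‖c x (χ x)‖ := by
    intro x χ'
    obtain ⟨u, hu⟩ := QuotientAddGroup.mk_out_eq_add Γ x
    have h1 := hχ₀ (QuotientAddGroup.mk x) χ'
    rw [hu, hcs, hcs, norm_mul, norm_mul, norm_addChar, norm_addChar, one_mul, one_mul] at h1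
    exact h1
  have hc1 : ∀ x χ', ‖c x χ'‖ ≤ 1 := fun x χ' => norm_expect_le_of_le zero_le_one fun s _ =>
    norm_mul_le_one (hw _) (norm_addChar _ _).le
  set P : G → ℂ := fun x => if ε ≤ ‖c x (χ x)‖ ^ 2 then conj (c x (χ x)) else 0 with hP
  have hPs : ∀ x (s : Γ), P (x + s) = P x * χ x s := by
    intro x s
    simp only [hP, hχinv, hcs, norm_mul, norm_addChar, one_mul, map_mul, conj_addChar, neg_neg]
    split_ifs
    · ring
    · simp
  refine ⟨χ, P, hχinv, ?_, hPs, ?_, ?_⟩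
  · intro x
    simp only [hP]
    split_ifs
    · rw [RCLike.norm_conj]; exact hc1 _ _
    · simp
  · have e1 : 𝔼 x, w x * P x = 𝔼 x, P x * c x (χ x) := by
      rw [← expect_coset Γ]
      refine Finset.expect_congr rfl fun x _ => ?_
      simp only [hPs, hc, Finset.mul_expect]
      exact Finset.expect_congr rfl fun s _ => by ring
    rw [e1, re_expect, sub_le_iff_le_add, gowersTwo_eq_expect]
    have e2 : ∀ x, ‖c x (χ x)‖ ^ 2 ≤ (P x * c x (χ x)).re + ε := by
      intro x
      simp only [hP]
      split_ifs with hx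
      · rw [mul_comm, Complex.mul_conj, Complex.ofReal_re, Complex.normSq_eq_norm_sq]; linarith
      · simp; linarith
    calc 𝔼 x, 𝔼 t : Γ, ‖𝔼 s : Γ, w (x + s) * conj (w (x + s + t))‖ ^ 2
        ≤ 𝔼 x, ‖c x (χ x)‖ ^ 2 := by
          refine Finset.expect_le_expect fun x _ => ?_
          have := expect_normSq_autocorrelation_le (W := fun s : Γ => w (x + s)) (fun s => hw _)
            (B := ‖c x (χ x)‖ ^ 2) (fun χ' => pow_le_pow_left₀ (norm_nonneg _) (hmax x χ') 2)
          simpa [add_assoc] using this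
      _ ≤ 𝔼 x, ((P x * c x (χ x)).re + ε) := Finset.expect_le_expect fun x _ => e2 x
      _ = _ := by rw [Finset.expect_add_distrib, Fintype.expect_const]
  · intro x hx
    by_contra hcon
    exact hx (by simp only [hP]; rw [if_neg]; exact hcon)

/-- Correlation of all derivatives with a single character along each coset. -/
lemma expect_normSq_mulDeriv_mul_le (F : G → ℂ) (ψ : G → AddChar Γ ℂ) :
    𝔼 x, 𝔼 t : Γ, ‖𝔼 s : Γ, mulDeriv (t : G) F (x + s) * ψ x s‖ ^ 2 ≤ gowersTwo Γ F := by
  rw [gowersTwo_eq_expect]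
  refine Finset.expect_le_expect fun x _ => ?_
  have h : ((𝔼 t : Γ, ‖𝔼 s : Γ, mulDeriv (t : G) F (x + s) * ψ x s‖ ^ 2 : ℝ) : ℂ) =
      𝔼 k : Γ, ψ x (-k) * ((‖𝔼 s : Γ, F (x + s) * conj (F (x + s + k))‖ ^ 2 : ℝ) : ℂ) := by
    rw [ofReal_expect]
    simp_rw [normSq_expect, Finset.mul_expect]
    rw [Finset.expect_comm, Finset.expect_comm (s := (univ : Finset Γ)) (t := (univ : Finset Γ))
      (f := fun k a => 𝔼 b : Γ, ψ x (-k) * (F (x + a) * conj (F (x + a + k)) *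
        conj (F (x + b) * conj (F (x + b + k)))))]
    refine Finset.expect_congr rfl fun a _ => ?_
    rw [Finset.expect_comm]
    -- substitute `b = a + k` and `c = a + t`
    have e1 : ∀ b : Γ, 𝔼 t : Γ, mulDeriv (t : G) F (x + a) * ψ x a *
        conj (mulDeriv (t : G) F (x + b) * ψ x b) =
        𝔼 c : Γ, F (x + a) * conj (F (x + b)) * ψ x (a - b) *
          (conj (F (x + c)) * F (x + c + (b - a : Γ))) := by
      intro b
      refine Fintype.expect_equiv (Equiv.addLeft a) _ _ fun t => ?_
      simp only [Equiv.coe_addLeft, mulDeriv, map_mul, RingHomCompTriple.comp_apply,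
        RingHom.id_apply, conj_addChar, AddSubgroup.coe_add, AddSubgroup.coe_sub]
      have a1 : x + ((a : G) + t) = x + a + t := by abel
      have a2 : x + (a : G) + t + (b - a) = x + b + t := by abel
      rw [a1, a2, sub_eq_add_neg a b, AddChar.map_add_eq_mul]
      ring
    have e2 : 𝔼 b : Γ, 𝔼 t : Γ, mulDeriv (t : G) F (x + a) * ψ x a *
        conj (mulDeriv (t : G) F (x + b) * ψ x b) =
        𝔼 k : Γ, 𝔼 c : Γ, F (x + a) * conj (F (x + a + k)) * ψ x (-k) *
          (conj (F (x + c)) * F (x + c + k)) := by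
      simp_rw [e1]
      refine Fintype.expect_equiv (Equiv.subRight a) _ _ fun b => ?_
      refine Finset.expect_congr rfl fun c _ => ?_
      simp only [Equiv.subRight_apply, neg_sub, AddSubgroup.coe_sub]
      have a1 : x + (a : G) + (b - a) = x + b := by abel
      rw [a1]
    rw [e2]
    refine Finset.expect_congr rfl fun k _ => Finset.expect_congr rfl fun c _ => ?_
    simp only [map_mul, RingHomCompTriple.comp_apply, RingHom.id_apply]
    ring
  have h2 := congrArg norm h
  rw [Complex.norm_real, Real.norm_eq_abs, abs_of_nonneg (Finset.expect_nonneg fun _ _ => by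
    positivity)] at h2
  rw [h2]
  refine (norm_expect_le _ _).trans (Finset.expect_le_expect fun k _ => ?_)
  rw [norm_mul, norm_addChar, one_mul, Complex.norm_real, Real.norm_eq_abs,
    abs_of_nonneg (by positivity)]

lemma gowersTwo_eq_expect_shift (V : G → ℂ) (u : Γ) :
    𝔼 x, 𝔼 t : Γ, 𝔼 t' : Γ, ‖𝔼 s : Γ, V (x + u + t + s) * conj (V (x + u + t' + s))‖ ^ 2 =
      gowersTwo Γ V := by
  have h : ∀ t : Γ, 𝔼 t' : Γ, 𝔼 x, ‖𝔼 s : Γ, V (x + u + t + s) * conj (V (x + u + t' + s))‖ ^ 2 =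
      gowersTwo Γ V := by
    intro t
    rw [gowersTwo]
    refine Fintype.expect_equiv (Equiv.subRight t) _ _ fun t' => ?_
    simp only [Equiv.subRight_apply, gowersOne, sqAvg, AddSubgroup.coe_sub]
    rw [← expect_add_right (fun x => ‖𝔼 s : Γ, mulDeriv ((t' : G) - t) V (x + s)‖ ^ 2)
      ((u : G) + t)]
    refine Finset.expect_congr rfl fun x _ => ?_
    congr 2
    refine Finset.expect_congr rfl fun s _ => ?_
    rw [mulDeriv]
    congr 2
    · abel
    · congr 1; abel
  rw [← expect_rotate]
  simp_rw [h]
  exact Fintype.expect_const _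

/-- Correlation of all second derivatives with a product of characters, each depending on one of
the directions. -/
lemma expect_normSq_mulDeriv_two_mul_pow_le {F : G → ℂ} (hF : ∀ x, ‖F x‖ ≤ 1)
    (ψ₁ ψ₂ : G → Γ → AddChar Γ ℂ) :
    (𝔼 x, 𝔼 t₁ : Γ, 𝔼 t₂ : Γ, ‖𝔼 s : Γ, mulDeriv (t₁ : G) (mulDeriv (t₂ : G) F) (x + s) *
      (ψ₁ x t₂ s * ψ₂ x t₁ s)‖ ^ 2) ^ 4 ≤ gowersThree Γ F := by
  set E := 𝔼 x, 𝔼 t₁ : Γ, 𝔼 t₂ : Γ, ‖𝔼 s : Γ, mulDeriv (t₁ : G) (mulDeriv (t₂ : G) F) (x + s) *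
      (ψ₁ x t₂ s * ψ₂ x t₁ s)‖ ^ 2 with hE
  have hE0 : 0 ≤ E := Finset.expect_nonneg fun _ _ => Finset.expect_nonneg fun _ _ =>
    Finset.expect_nonneg fun _ _ => by positivity
  set V : Γ → G → ℂ := fun k => mulDeriv (k : G) F with hV
  have hV1 : ∀ k x, ‖V k x‖ ≤ 1 := fun k x => norm_mulDeriv_le hF _ _
  set b₁ : G → Γ → Γ → Γ → ℂ := fun x s k t =>
    ψ₁ x t (-k) * V k (x + s) * conj (V k (x + s + t)) with hb₁
  set b₂ : G → Γ → Γ → Γ → ℂ := fun x s k t => ψ₂ x t (-k) * conj (V k (x + s + t)) with hb₂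
  have e1 : (E : ℂ) = 𝔼 x, 𝔼 s : Γ, 𝔼 k : Γ, 𝔼 t₁ : Γ, 𝔼 t₂ : Γ,
      b₁ x s k t₂ * b₂ x s k t₁ * V k (x + s + t₁ + t₂) := by
    rw [hE, ofReal_expect]
    refine Finset.expect_congr rfl fun x _ => ?_
    simp_rw [ofReal_expect, normSq_expect]
    rw [expect_rotate]
    refine Finset.expect_congr rfl fun s _ => ?_
    rw [← expect_rotate (s := (univ : Finset Γ)) (t := (univ : Finset Γ))
      (u := (univ : Finset Γ)) (f := fun t₁ t₂ k => b₁ x s k t₂ * b₂ x s k t₁ *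
        V k (x + s + t₁ + t₂))]
    refine Finset.expect_congr rfl fun t₁ _ => Finset.expect_congr rfl fun t₂ _ => ?_
    refine Fintype.expect_equiv (Equiv.subRight s) _ _ fun s' => ?_
    simp only [Equiv.subRight_apply, hb₁, hb₂, hV, mulDeriv, map_mul, RingHomCompTriple.comp_apply,
      RingHom.id_apply, conj_addChar, neg_sub, AddSubgroup.coe_sub]
    have a0 : x + (s : G) + (s' - s) = x + s' := by abel
    have a1 : x + (s : G) + t₁ + (s' - s) = x + s' + t₁ := by abel
    have a2 : x + (s : G) + t₂ + (s' - s) = x + s' + t₂ := by abel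
    have a3 : x + (s : G) + t₁ + t₂ + (s' - s) = x + s' + t₁ + t₂ := by abel
    rw [a0, a1, a2, a3, sub_eq_add_neg s s', AddChar.map_add_eq_mul, AddChar.map_add_eq_mul]
    ring
  have e2 : E ^ 4 = ‖(E : ℂ)‖ ^ 4 := by rw [Complex.norm_real, Real.norm_eq_abs, abs_of_nonneg hE0]
  rw [e2, e1]
  have e3 : ‖𝔼 x, 𝔼 s : Γ, 𝔼 k : Γ, 𝔼 t₁ : Γ, 𝔼 t₂ : Γ,
      b₁ x s k t₂ * b₂ x s k t₁ * V k (x + s + t₁ + t₂)‖ ^ 4 ≤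
      𝔼 x, 𝔼 s : Γ, 𝔼 k : Γ, 𝔼 t : Γ, 𝔼 t' : Γ,
        ‖𝔼 t₂ : Γ, V k (x + s + t + t₂) * conj (V k (x + s + t' + t₂))‖ ^ 2 := by
    refine (pow_le_pow_left₀ (norm_nonneg _) (norm_expect_le _ _) 4).trans
      ((pow_four_expect_le _ _).trans (Finset.expect_le_expect fun x _ => ?_))
    refine (pow_le_pow_left₀ (norm_nonneg _) (norm_expect_le _ _) 4).trans
      ((pow_four_expect_le _ _).trans (Finset.expect_le_expect fun s _ => ?_))
    refine (pow_le_pow_left₀ (norm_nonneg _) (norm_expect_le _ _) 4).trans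
      ((pow_four_expect_le _ _).trans (Finset.expect_le_expect fun k _ => ?_))
    refine box_two univ univ (b₁ x s k) (b₂ x s k) (fun t₁ t₂ => V k (x + s + t₁ + t₂))
      (fun t _ => ?_) (fun t _ => ?_)
    · exact norm_mul_conj_le_one (norm_mul_le_one (norm_addChar _ _).le (hV1 _ _)) (hV1 _ _)
    · exact norm_mul_conj_le_one (norm_addChar _ _).le (hV1 _ _)
  refine e3.trans (le_of_eq ?_)
  rw [Finset.expect_comm]
  have e4 : ∀ s : Γ, 𝔼 x, 𝔼 k : Γ, 𝔼 t : Γ, 𝔼 t' : Γ,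
        ‖𝔼 t₂ : Γ, V k (x + s + t + t₂) * conj (V k (x + s + t' + t₂))‖ ^ 2 =
        gowersThree Γ F := by
    intro s
    rw [Finset.expect_comm, gowersThree]
    exact Finset.expect_congr rfl fun k _ => gowersTwo_eq_expect_shift Γ (V k) s
  simp_rw [e4]
  exact Fintype.expect_const _

end Inverse

section Angle
variable {G : Type*} [AddCommGroup G] [Fintype G] (γ : G) [Fintype (AddSubgroup.zmultiples γ)]
local notation "Γ" => AddSubgroup.zmultiples γ

/-- The generator of the cyclic subgroup. -/
def gen : Γ := ⟨γ, AddSubgroup.mem_zmultiples γ⟩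

variable {γ}

lemma coe_zsmul_gen (n : ℤ) : ((n • gen γ : Γ) : G) = n • γ := rfl

lemma exists_eq_zsmul_gen (s : Γ) : ∃ n : ℤ, s = n • gen γ := by
  obtain ⟨n, hn⟩ := AddSubgroup.mem_zmultiples_iff.1 s.2
  exact ⟨n, Subtype.ext hn.symm⟩

/-- The frequency of a character of the cyclic group generated by `γ`. -/
noncomputable def angle (χ : AddChar Γ ℂ) : ℝ := Complex.arg (χ (gen γ)) / (2 * Real.pi)

lemma ee_angle (χ : AddChar Γ ℂ) : ee (angle χ) = χ (gen γ) := by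
  have h := Complex.norm_mul_exp_arg_mul_I (χ (gen γ))
  rw [norm_addChar, Complex.ofReal_one, one_mul] at h
  rw [ee, angle, ← h]
  congr 1
  rw [mul_div_cancel₀ _ (by positivity), h, mul_comm]

lemma ee_mul_int (θ : ℝ) (n : ℤ) : ee (θ * n) = ee θ ^ n := by
  rw [ee, ee, ← Complex.exp_int_mul]; congr 1; push_cast; ring

lemma addChar_zsmul_gen (χ : AddChar Γ ℂ) (n : ℤ) : χ (n • gen γ) = ee (angle χ * n) := by
  rw [ee_mul_int, ee_angle, AddChar.map_zsmul_eq_zpow]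

lemma abs_angle_le (χ : AddChar Γ ℂ) : |angle χ| ≤ 1 / 2 := by
  rw [angle, abs_div, abs_of_pos (by positivity : (0 : ℝ) < 2 * Real.pi),
    div_le_iff₀ (by positivity)]
  linarith [Complex.abs_arg_le_pi (χ (gen γ))]

lemma angle_injective : Function.Injective (angle (γ := γ)) := by
  intro χ χ' h
  ext s
  obtain ⟨n, rfl⟩ := exists_eq_zsmul_gen s
  rw [addChar_zsmul_gen, addChar_zsmul_gen, h]

lemma ee_eq_one_iff {θ : ℝ} : ee θ = 1 ↔ ∃ k : ℤ, θ = k := by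
  constructor
  · intro h
    have h1 := four_mul_nd_le θ
    rw [h, sub_self, norm_zero] at h1
    have h2 : nd θ = 0 := le_antisymm (by linarith) (nd_nonneg _)
    exact ⟨round θ, by rw [nd, abs_eq_zero] at h2; linarith⟩
  · rintro ⟨k, rfl⟩; exact ee_intCast k

lemma exists_order_mul_angle (χ : AddChar Γ ℂ) : ∃ k : ℤ, addOrderOf γ * angle χ = k := by
  rw [← ee_eq_one_iff]
  have h := addChar_zsmul_gen χ (addOrderOf γ)
  have h0 : ((addOrderOf γ : ℤ) • gen γ : Γ) = 0 := by
    apply Subtype.ext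
    rw [coe_zsmul_gen]; simp
  rw [h0, AddChar.map_zero_eq_one] at h
  rw [mul_comm]; exact_mod_cast h.symm

open Classical in
lemma card_major_le {M : ℕ} (hM : 0 < M) (hR : addOrderOf γ ≤ 16 * M ^ 2) {D : ℝ} (hD : 1 ≤ D) :
    (#{χ : AddChar Γ ℂ | Major D M (angle χ)} : ℝ) ≤ 99 * D ^ 3 := by
  have hR0 : 0 < addOrderOf γ := addOrderOf_pos γ
  have hR0' : (0 : ℝ) < addOrderOf γ := by exact_mod_cast hR0
  have hM0 : (0 : ℝ) < M := by exact_mod_cast hM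
  have hR' : (addOrderOf γ : ℝ) ≤ 16 * M ^ 2 := by exact_mod_cast hR
  choose k hk using fun χ : AddChar Γ ℂ => exists_order_mul_angle χ
  set d : AddChar Γ ℂ → ℕ := fun χ => if h : Major D M (angle χ) then h.choose else 0 with hd
  have hd' : ∀ χ, Major D M (angle χ) →
      0 < d χ ∧ (d χ : ℝ) ≤ D ∧ nd (d χ * angle χ) ≤ D / M ^ 2 := by
    intro χ h
    simp only [hd, dif_pos h]
    exact h.choose_spec
  set n : AddChar Γ ℂ → ℤ := fun χ => round (d χ * angle χ) with hn
  set T := Icc (1 : ℤ) ⌊D⌋ ×ˢ Icc (-⌊16 * D⌋) ⌊16 * D⌋ ×ˢ Icc (-⌊D⌋) ⌊D⌋ with hT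
  have hcard : #{χ : AddChar Γ ℂ | Major D M (angle χ)} ≤ #T := by
    refine Finset.card_le_card_of_injOn (fun χ => ((d χ : ℤ), d χ * k χ - n χ * addOrderOf γ, n χ))
      ?_ ?_
    · intro χ hχ
      obtain ⟨h1, h2, h3⟩ := hd' χ (by simpa using hχ)
      have hn1 : |(n χ : ℝ)| ≤ D := by
        have a1 := abs_sub_round (d χ * angle χ)
        have a2 : |(d χ : ℝ) * angle χ| ≤ D * (1 / 2) := by
          rw [abs_mul, Nat.abs_cast]
          exact mul_le_mul h2 (abs_angle_le χ) (abs_nonneg _) (by linarith)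
        have a3 := abs_le.1 a1
        have a4 := abs_le.1 a2
        rw [abs_le]
        constructor <;> simp only [hn] <;> linarith
      have hl : |((d χ * k χ - n χ * addOrderOf γ : ℤ) : ℝ)| ≤ 16 * D := by
        have e : ((d χ * k χ - n χ * addOrderOf γ : ℤ) : ℝ) =
            addOrderOf γ * (d χ * angle χ - n χ) := by
          push_cast; rw [← hk χ]; ring
        rw [e, abs_mul, Nat.abs_cast]
        calc (addOrderOf γ : ℝ) * |d χ * angle χ - n χ| ≤ 16 * M ^ 2 * (D / M ^ 2) := by
              gcongr; exact h3
          _ = 16 * D := by field_simp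
      have hn2 := abs_le.1 hn1
      have hl2 := abs_le.1 hl
      simp only [hT, coe_product, Set.mem_prod, mem_coe, mem_Icc, Int.le_floor]
      refine ⟨⟨by omega, by exact_mod_cast h2⟩, ⟨?_, hl2.2⟩, ?_, hn2.2⟩
      · rw [neg_le, Int.le_floor]; push_cast at hl2 ⊢; linarith
      · rw [neg_le, Int.le_floor]; push_cast; linarith
    · intro χ hχ χ' hχ' h
      obtain ⟨h1, -, -⟩ := hd' χ (by simpa using hχ)
      simp only [Prod.mk.injEq] at h
      obtain ⟨e1, e2, e3⟩ := h
      rw [e3, e1] at e2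
      have e4 : (d χ' : ℤ) * k χ = d χ' * k χ' := by linarith
      have e5 : k χ = k χ' := mul_left_cancel₀ (by omega) e4
      apply angle_injective
      have := hk χ
      rw [e5, ← hk χ'] at this
      exact mul_left_cancel₀ hR0'.ne' this
  have hTc : (#T : ℝ) ≤ D * (33 * D) * (3 * D) := by
    have hD0 : 0 ≤ ⌊D⌋ := Int.floor_nonneg.2 (by linarith)
    have hD16 : 0 ≤ ⌊16 * D⌋ := Int.floor_nonneg.2 (by linarith)
    rw [hT, card_product, card_product, Int.card_Icc, Int.card_Icc, Int.card_Icc]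
    push_cast
    have c1 : ((⌊D⌋ + 1 - 1).toNat : ℝ) ≤ D := by
      have : ((⌊D⌋ + 1 - 1).toNat : ℤ) = ⌊D⌋ := by omega
      have : ((⌊D⌋ + 1 - 1).toNat : ℝ) = ⌊D⌋ := by exact_mod_cast this
      rw [this]; exact Int.floor_le D
    have c2 : ((⌊16 * D⌋ + 1 - -⌊16 * D⌋).toNat : ℝ) ≤ 33 * D := by
      have : ((⌊16 * D⌋ + 1 - -⌊16 * D⌋).toNat : ℤ) = 2 * ⌊16 * D⌋ + 1 := by omega
      have : ((⌊16 * D⌋ + 1 - -⌊16 * D⌋).toNat : ℝ) = 2 * ⌊16 * D⌋ + 1 := by exact_mod_cast this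
      rw [this]; linarith [Int.floor_le (16 * D)]
    have c3 : ((⌊D⌋ + 1 - -⌊D⌋).toNat : ℝ) ≤ 3 * D := by
      have : ((⌊D⌋ + 1 - -⌊D⌋).toNat : ℤ) = 2 * ⌊D⌋ + 1 := by omega
      have : ((⌊D⌋ + 1 - -⌊D⌋).toNat : ℝ) = 2 * ⌊D⌋ + 1 := by exact_mod_cast this
      rw [this]; linarith [Int.floor_le D]
    rw [mul_assoc]
    gcongr
  calc (#{χ : AddChar Γ ℂ | Major D M (angle χ)} : ℝ) ≤ #T := by exact_mod_cast hcard
    _ ≤ _ := hTc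
    _ = _ := by ring

lemma norm_Lam_le_one (e γ : G) (M : ℕ) {f₀ f₁ f₂ : G → ℂ} (h₀ : ∀ x, ‖f₀ x‖ ≤ 1)
    (h₁ : ∀ x, ‖f₁ x‖ ≤ 1) (h₂ : ∀ x, ‖f₂ x‖ ≤ 1) : ‖Lam e γ M f₀ f₁ f₂‖ ≤ 1 :=
  norm_expect_le_of_le zero_le_one fun _ _ => norm_expect_le_of_le zero_le_one
    fun _ _ => norm_mul_le_one (norm_mul_le_one (h₀ _) (h₁ _)) (h₂ _)

/-- A function that transforms along `Γ` by characters turns the count into a quadratic phase. -/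
lemma Lam_eq_phase (e : G) (M : ℕ) (f₀ f₁ P : G → ℂ) (χ : G → AddChar Γ ℂ)
    (hP : ∀ x (s : Γ), P (x + s) = P x * χ x s) :
    Lam e γ M f₀ f₁ P = 𝔼 x, 𝔼 y ∈ Icc (1 : ℤ) M,
      (f₀ x * P x) * f₁ (x + y • e) * ee (angle (χ x) * y ^ 2) := by
  refine Finset.expect_congr rfl fun x _ => Finset.expect_congr rfl fun y _ => ?_
  have h := hP x ((y ^ 2) • gen γ)
  rw [coe_zsmul_gen, addChar_zsmul_gen] at h
  rw [h]; push_cast; ring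

variable {Ω : Type*} [Fintype Ω] [Nonempty Ω]

lemma exists_common_character (e : G) {M : ℕ} {X : ℝ} (hX : 2 ≤ X) (hM : X ^ 2200 ≤ M)
    (hR : addOrderOf γ ≤ 16 * M ^ 2) (f₀ f₁ P : Ω → Ω → G → ℂ)
    (h₀ : ∀ ω ω' x, ‖f₀ ω ω' x‖ ≤ 1) (h₁ : ∀ ω ω' x, ‖f₁ ω ω' x‖ ≤ 1)
    (hP1 : ∀ ω ω' x, ‖P ω ω' x‖ ≤ 1) (χ : Ω → Ω → G → AddChar Γ ℂ)
    (hP : ∀ ω ω' x (s : Γ), P ω ω' (x + s) = P ω ω' x * χ ω ω' x s)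
    (h : 1 / X ≤ 𝔼 ω, 𝔼 ω', ‖Lam e γ M (f₀ ω ω') (f₁ ω ω') (P ω ω')‖) :
    ∃ (ω' : G → Ω) (m : G → AddChar Γ ℂ), 1 / X ^ 7461 ≤
      𝔼 x, dens univ (fun ω => P ω (ω' x) x ≠ 0 ∧ χ ω (ω' x) x = m x) := by
  classical
  have hX0 : 0 < X := by linarith
  have hX1 : 1 ≤ X := by linarith
  have hM0 : (0 : ℝ) < M := lt_of_lt_of_le (by positivity) hM
  have hM0' : 0 < M := by exact_mod_cast hM0
  obtain ⟨D, hD⟩ : ∃ D : ℝ, D = (X ^ 2) ^ 1240 := ⟨_, rfl⟩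
  have hD1 : 1 ≤ D := by rw [hD]; exact one_le_pow₀ (one_le_pow₀ hX1)
  set Maj : Finset (AddChar Γ ℂ) := {c | Major D M (angle c)} with hMaj
  have hMajc : (#Maj : ℝ) ≤ X ^ 7447 := by
    refine (card_major_le hM0' hR hD1).trans ?_
    have h7 := two_pow_le_pow hX 7
    norm_num at h7
    calc 99 * D ^ 3 ≤ X ^ 7 * D ^ 3 := by gcongr; linarith
      _ = X ^ 7447 := by rw [hD, ← pow_mul, ← pow_mul, ← pow_add]
  have h1 : 1 / X ≤ 𝔼 p : Ω × Ω, ‖Lam e γ M (f₀ p.1 p.2) (f₁ p.1 p.2) (P p.1 p.2)‖ := by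
    refine h.trans (le_of_eq ?_)
    rw [← Finset.univ_product_univ, Finset.expect_product]
  have hhalf : 1 / X ^ 2 ≤ 1 / X / 2 := by
    rw [div_div]
    refine one_div_le_one_div_of_le (by positivity) ?_
    rw [sq]; gcongr
  have h2 := le_expect_of_imp (η := 1 / (X ^ 2) ^ 6) (A := fun p : Ω × Ω =>
      dens univ (fun x => P p.1 p.2 x ≠ 0 ∧ χ p.1 p.2 x ∈ Maj)) (by positivity) (by positivity)
      (fun p _ => norm_Lam_le_one e γ M (h₀ _ _) (h₁ _ _) (hP1 _ _))
      (fun p _ => dens_nonneg _ _) h1 (fun p _ hp => by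
        have hp : 1 / X / 2 ≤ ‖Lam e γ M (f₀ p.1 p.2) (f₁ p.1 p.2) (P p.1 p.2)‖ := hp
        rw [Lam_eq_phase e M _ _ _ (χ p.1 p.2) (hP p.1 p.2)] at hp
        have hM' : (X ^ 2) ^ 1100 ≤ M := by rw [← pow_mul]; exact hM
        refine (dens_major_of_correlation e (hX.trans (le_self_pow₀ hX1 (by norm_num))) hM'
          (fun x => norm_mul_le_one (h₀ _ _ _) (hP1 _ _ _)) (h₁ p.1 p.2) _
          (hhalf.trans hp)).trans (dens_mono fun x _ hx => ⟨right_ne_zero_of_mul hx.1, ?_⟩)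
        rw [hMaj, mem_filter]
        exact ⟨mem_univ _, hD ▸ hx.2⟩)
  have h3 : 1 / X ^ 14 ≤ 𝔼 x, 𝔼 ω', dens univ (fun ω => P ω ω' x ≠ 0 ∧ χ ω ω' x ∈ Maj) := by
    calc 1 / X ^ 14 = 1 / X ^ 2 * (1 / (X ^ 2) ^ 6) := by
          rw [← pow_mul, div_mul_div_comm, one_mul, ← pow_add]
      _ ≤ 1 / X / 2 * (1 / (X ^ 2) ^ 6) := by gcongr
      _ ≤ _ := h2
      _ = _ := by
        rw [← Finset.univ_product_univ, Finset.expect_product]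
        simp_rw [dens_eq_card_filter_div]
        rw [expect_rotate]
        refine Finset.expect_congr rfl fun x _ => ?_
        rw [Finset.expect_comm]
  have h4 : ∀ x, ∃ ω' m, (𝔼 ω', dens univ (fun ω => P ω ω' x ≠ 0 ∧ χ ω ω' x ∈ Maj)) / X ^ 7447 ≤
      dens univ (fun ω => P ω ω' x ≠ 0 ∧ χ ω ω' x = m) := by
    intro x
    obtain ⟨ω', -, hω'⟩ := Finset.exists_le_of_le_expect
      (s := (univ : Finset Ω)) (f := fun ω' => dens univ (fun ω => P ω ω' x ≠ 0 ∧ χ ω ω' x ∈ Maj))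
      univ_nonempty le_rfl
    set q := dens univ (fun ω => P ω ω' x ≠ 0 ∧ χ ω ω' x ∈ Maj) with hq
    rcases (dens_nonneg univ (fun ω => P ω ω' x ≠ 0 ∧ χ ω ω' x ∈ Maj)).eq_or_lt with h0 | h0
    · refine ⟨ω', 1, ?_⟩
      rw [← hq] at h0
      rw [← h0] at hω'
      refine le_trans (div_nonpos_of_nonpos_of_nonneg hω' (by positivity)) (dens_nonneg _ _)
    · obtain ⟨m, hm, hm'⟩ := exists_le_dens_of_exists (s := univ) (t := Maj)
        (P := fun m ω => P ω ω' x ≠ 0 ∧ χ ω ω' x = m) h0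
        (dens_mono fun ω _ hω => ⟨_, hω.2, hω.1, rfl⟩)
      refine ⟨ω', m, le_trans ?_ hm'⟩
      have hc : (0 : ℝ) < #Maj := by exact_mod_cast Finset.card_pos.2 ⟨m, hm⟩
      calc _ ≤ q / X ^ 7447 := by gcongr
        _ ≤ q / #Maj := by
          have := h0.le
          gcongr
  choose ω' m hωm using h4
  refine ⟨ω', m, ?_⟩
  calc 1 / X ^ 7461 = 1 / X ^ 14 / X ^ 7447 := by rw [div_div, ← pow_add]
    _ ≤ (𝔼 x, 𝔼 ω', dens univ (fun ω => P ω ω' x ≠ 0 ∧ χ ω ω' x ∈ Maj)) / X ^ 7447 := by gcongr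
    _ = 𝔼 x, (𝔼 ω', dens univ (fun ω => P ω ω' x ≠ 0 ∧ χ ω ω' x ∈ Maj)) / X ^ 7447 := by
      rw [Finset.expect_div]
    _ ≤ _ := Finset.expect_le_expect fun x _ => hωm x

end Angle

section Lowering
variable {G : Type*} [AddCommGroup G] [Fintype G]

/-- The dual function in the third variable. -/
noncomputable def dualFn (e γ : G) (M : ℕ) (f₀ f₁ : G → ℂ) (x : G) : ℂ :=
  𝔼 y ∈ Icc (1 : ℤ) M, f₀ (x - (y ^ 2) • γ) * f₁ (x - (y ^ 2) • γ + y • e)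

lemma norm_dualFn_le (e γ : G) (M : ℕ) {f₀ f₁ : G → ℂ} (h₀ : ∀ x, ‖f₀ x‖ ≤ 1)
    (h₁ : ∀ x, ‖f₁ x‖ ≤ 1) (x : G) : ‖dualFn e γ M f₀ f₁ x‖ ≤ 1 :=
  norm_expect_le_of_le zero_le_one fun _ _ => norm_mul_le_one (h₀ _) (h₁ _)

lemma Lam_eq_expect_dualFn (e γ : G) (M : ℕ) (f₀ f₁ f₂ : G → ℂ) :
    Lam e γ M f₀ f₁ f₂ = 𝔼 x, dualFn e γ M f₀ f₁ x * f₂ x := by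
  simp_rw [Lam, dualFn, Finset.expect_mul]
  rw [Finset.expect_comm, Finset.expect_comm (s := univ)]
  refine Finset.expect_congr rfl fun y _ => ?_
  symm
  rw [← expect_add_right _ ((y ^ 2) • γ)]
  simp

variable (γ : G) [Fintype (AddSubgroup.zmultiples γ)]
local notation "Γ" => AddSubgroup.zmultiples γ

lemma dual_interchange (e : G) (M : ℕ) {f₀ f₁ : G → ℂ} (h₀ : ∀ x, ‖f₀ x‖ ≤ 1)
    (h₁ : ∀ x, ‖f₁ x‖ ≤ 1) (P : Γ → G → ℂ) :
    ‖𝔼 t : Γ, 𝔼 x, mulDeriv (t : G) (dualFn e γ M f₀ f₁) x * P t x‖ ^ 2 ≤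
      𝔼 t : Γ, 𝔼 t' : Γ, ‖Lam e γ M (fun x => conj (f₀ (x + t)) * f₀ (x + t'))
        (fun x => conj (f₁ (x + t)) * f₁ (x + t')) (fun x => P t x * conj (P t' x))‖ := by
  set F := dualFn e γ M f₀ f₁ with hF
  set Y := Icc (1 : ℤ) M
  set Fy : ℤ → G → ℂ := fun y x => f₀ (x - (y ^ 2) • γ) * f₁ (x - (y ^ 2) • γ + y • e) with hFy
  have hF1 : ∀ x, ‖F x‖ ≤ 1 := norm_dualFn_le e γ M h₀ h₁
  have e1 : 𝔼 t : Γ, 𝔼 x, mulDeriv (t : G) F x * P t x =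
      𝔼 p ∈ (univ : Finset G) ×ˢ Y, F p.1 * 𝔼 t : Γ, conj (Fy p.2 (p.1 + t)) * P t p.1 := by
    rw [Finset.expect_product, Finset.expect_comm]
    refine Finset.expect_congr rfl fun x _ => ?_
    simp_rw [Finset.mul_expect]
    rw [Finset.expect_comm (s := Y)]
    refine Finset.expect_congr rfl fun t _ => ?_
    rw [mulDeriv, hF, dualFn, dualFn, conj_expect, Finset.mul_expect, Finset.expect_mul]
    refine Finset.expect_congr rfl fun y _ => ?_
    simp only [hFy]
    ring
  rw [e1]
  refine (normSq_expect_mul_le _ _ _ fun p _ => hF1 _).trans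
    ((expect_normSq_expect_le _ _ _).trans (le_of_eq ?_))
  refine Finset.expect_congr rfl fun t _ => Finset.expect_congr rfl fun t' _ => ?_
  congr 1
  rw [Finset.expect_product, Lam, Finset.expect_comm, Finset.expect_comm (s := univ)]
  refine Finset.expect_congr rfl fun y _ => ?_
  rw [← expect_add_right _ ((y ^ 2) • γ)]
  refine Finset.expect_congr rfl fun x _ => ?_
  simp only [hFy, map_mul, RingHomCompTriple.comp_apply, RingHom.id_apply]
  have a1 : ∀ t : Γ, x + y ^ 2 • γ + (t : G) - y ^ 2 • γ = x + t := fun t => by abel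
  have a2 : ∀ t : Γ, x + (t : G) + y • e = x + y • e + t := fun t => by abel
  simp only [a1, a2]
  ring

lemma dual_interchange_two (e : G) (M : ℕ) {f₀ f₁ : G → ℂ} (h₀ : ∀ x, ‖f₀ x‖ ≤ 1)
    (h₁ : ∀ x, ‖f₁ x‖ ≤ 1) (P : Γ × Γ → G → ℂ) :
    ‖𝔼 t₁ : Γ, 𝔼 t₂ : Γ, 𝔼 x,
      mulDeriv (t₁ : G) (mulDeriv (t₂ : G) (dualFn e γ M f₀ f₁)) x * P (t₁, t₂) x‖ ^ 4 ≤
      𝔼 t : Γ × Γ, 𝔼 t' : Γ × Γ, ‖Lam e γ M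
        (fun x => f₀ (x + t.1 + t.2) * conj (f₀ (x + t'.1 + t.2)) *
          conj (f₀ (x + t.1 + t'.2)) * f₀ (x + t'.1 + t'.2))
        (fun x => f₁ (x + t.1 + t.2) * conj (f₁ (x + t'.1 + t.2)) *
          conj (f₁ (x + t.1 + t'.2)) * f₁ (x + t'.1 + t'.2))
        (fun x => P (t.1, t.2) x * conj (P (t'.1, t.2) x) * conj (P (t.1, t'.2) x) *
          P (t'.1, t'.2) x)‖ := by
  set F := dualFn e γ M f₀ f₁ with hF
  set Y := Icc (1 : ℤ) M
  set Fy : ℤ → G → ℂ := fun y x => f₀ (x - (y ^ 2) • γ) * f₁ (x - (y ^ 2) • γ + y • e) with hFy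
  have hF1 : ∀ x, ‖F x‖ ≤ 1 := norm_dualFn_le e γ M h₀ h₁
  set T : G × ℤ → Γ → Γ → ℂ := fun p t₁ t₂ => Fy p.2 (p.1 + t₁ + t₂) * P (t₁, t₂) p.1 with hT
  have e1 : 𝔼 t₁ : Γ, 𝔼 t₂ : Γ, 𝔼 x, mulDeriv (t₁ : G) (mulDeriv (t₂ : G) F) x * P (t₁, t₂) x =
      𝔼 p ∈ (univ : Finset G) ×ˢ Y, 𝔼 t₁ : Γ, 𝔼 t₂ : Γ,
        (F p.1 * conj (F (p.1 + t₂))) * conj (F (p.1 + t₁)) * T p t₁ t₂ := by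
    rw [Finset.expect_product, expect_rotate]
    refine Finset.expect_congr rfl fun x _ => ?_
    rw [← expect_rotate]
    refine Finset.expect_congr rfl fun t₁ _ => Finset.expect_congr rfl fun t₂ _ => ?_
    have : F (x + t₁ + t₂) = 𝔼 y ∈ Y, Fy y (x + t₁ + t₂) := rfl
    simp only [mulDeriv, map_mul, RingHomCompTriple.comp_apply, RingHom.id_apply, this]
    rw [Finset.mul_expect, Finset.mul_expect, Finset.expect_mul]
    refine Finset.expect_congr rfl fun y _ => ?_
    simp only [hT]
    ring
  have e3 : ‖𝔼 p ∈ (univ : Finset G) ×ˢ Y, 𝔼 t₁ : Γ, 𝔼 t₂ : Γ,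
        (F p.1 * conj (F (p.1 + t₂))) * conj (F (p.1 + t₁)) * T p t₁ t₂‖ ^ 4 ≤
      𝔼 t₁ : Γ, 𝔼 t₁' : Γ, 𝔼 t₂ : Γ, 𝔼 t₂' : Γ,
      ‖𝔼 p ∈ (univ : Finset G) ×ˢ Y,
        (T p t₁ t₂ * conj (T p t₁' t₂)) * conj (T p t₁ t₂' * conj (T p t₁' t₂'))‖ := by
    have b1 : ‖𝔼 p ∈ (univ : Finset G) ×ˢ Y, 𝔼 t₁ : Γ, 𝔼 t₂ : Γ,
        (F p.1 * conj (F (p.1 + t₂))) * conj (F (p.1 + t₁)) * T p t₁ t₂‖ ^ 4 ≤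
        𝔼 p ∈ (univ : Finset G) ×ˢ Y, 𝔼 t₁ : Γ, 𝔼 t₁' : Γ,
        ‖𝔼 t₂ : Γ, T p t₁ t₂ * conj (T p t₁' t₂)‖ ^ 2 := by
      refine le_trans (pow_le_pow_left₀ (norm_nonneg _) (norm_expect_le _ _) 4)
        ((pow_four_expect_le _ _).trans (Finset.expect_le_expect fun p _ => ?_))
      refine box_two univ univ (fun t₂ : Γ => F p.1 * conj (F (p.1 + t₂)))
        (fun t₁ : Γ => conj (F (p.1 + t₁))) (T p)
        (fun _ _ => norm_mul_conj_le_one (hF1 _) (hF1 _)) (fun _ _ => ?_)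
      rw [RCLike.norm_conj]; exact hF1 _
    refine b1.trans ?_
    rw [Finset.expect_comm]
    refine Finset.expect_le_expect fun t₁ _ => ?_
    rw [Finset.expect_comm]
    refine Finset.expect_le_expect fun t₁' _ => ?_
    exact expect_normSq_expect_le _ _ _
  rw [e1]
  refine e3.trans (le_of_eq ?_)
  simp_rw [← Finset.univ_product_univ, Finset.expect_product]
  refine Finset.expect_congr rfl fun t₁ _ => ?_
  rw [Finset.expect_comm]
  refine Finset.expect_congr rfl fun t₂ _ => Finset.expect_congr rfl fun t₁' _ =>
    Finset.expect_congr rfl fun t₂' _ => ?_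
  congr 1
  rw [Lam, Finset.expect_comm, Finset.expect_comm (s := univ)]
  refine Finset.expect_congr rfl fun y _ => ?_
  rw [← expect_add_right _ ((y ^ 2) • γ)]
  refine Finset.expect_congr rfl fun x _ => ?_
  simp only [hFy, hT, map_mul, RingHomCompTriple.comp_apply, RingHom.id_apply]
  have a1 : ∀ t t' : Γ, x + y ^ 2 • γ + (t : G) + t' - y ^ 2 • γ = x + t + t' :=
    fun t t' => by abel
  have a2 : ∀ t t' : Γ, x + (t : G) + t' + y • e = x + y • e + t + t' := fun t t' => by abel
  simp only [a1, a2]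
  ring

lemma norm_four_mul_le {a b c d : ℂ} (ha : ‖a‖ ≤ 1) (hb : ‖b‖ ≤ 1) (hc : ‖c‖ ≤ 1) (hd : ‖d‖ ≤ 1) :
    ‖a * conj b * conj c * d‖ ≤ 1 :=
  norm_mul_le_one (norm_mul_conj_le_one (norm_mul_conj_le_one ha hb) hc) hd

lemma half_le_norm_of_inverse {ι : Type*} (s : Finset ι) (hs : s.Nonempty) {X : ℝ} (hX : 2 ≤ X)
    (U : ι → ℝ) (z : ι → ℂ) (h : 1 / X ≤ 𝔼 i ∈ s, U i)
    (hz : ∀ i ∈ s, U i - 1 / (2 * X) ≤ (z i).re) : 1 / X ^ 2 ≤ ‖𝔼 i ∈ s, z i‖ := by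
  have hX0 : 0 < X := by linarith
  have h1 : 1 / X - 1 / (2 * X) ≤ (𝔼 i ∈ s, z i).re := by
    rw [re_expect]
    refine le_trans ?_ (Finset.expect_le_expect hz)
    rw [Finset.expect_sub_distrib, Finset.expect_const hs]
    linarith
  have h2 : 1 / X ^ 2 ≤ 1 / X - 1 / (2 * X) := by
    have : 1 / X - 1 / (2 * X) = 1 / (2 * X) := by field_simp; norm_num
    rw [this]
    refine one_div_le_one_div_of_le (by positivity) ?_
    rw [sq]; gcongr
  exact h2.trans (h1.trans (Complex.re_le_norm _))

lemma mul_dens_le_expect {ι : Type*} {s : Finset ι} {p : ι → Prop} {a : ℝ}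
    {A : ι → ℝ} (hA : ∀ i ∈ s, 0 ≤ A i) (h : ∀ i ∈ s, p i → a ≤ A i) :
    a * dens s p ≤ 𝔼 i ∈ s, A i := by
  classical
  rw [dens_eq_card_filter_div, Finset.mul_expect]
  refine Finset.expect_le_expect fun i hi => ?_
  split_ifs with hp
  · simpa using h i hi hp
  · simpa using hA i hi

variable {γ}

/-- Degree lowering for the dual function: from `U³` to `U²`. -/
theorem gowersTwo_dualFn_of_gowersThree (e : G) {M : ℕ} {X : ℝ} (hX : 2 ≤ X)
    (hM : X ^ 8800 ≤ M) (hR : OrderScale γ M) {f₀ f₁ : G → ℂ} (h₀ : ∀ x, ‖f₀ x‖ ≤ 1)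
    (h₁ : ∀ x, ‖f₁ x‖ ≤ 1) (h : 1 / X ≤ gowersThree Γ (dualFn e γ M f₀ f₁)) :
    1 / X ^ 29846 ≤ gowersTwo Γ (dualFn e γ M f₀ f₁) := by
  classical
  have hX0 : 0 < X := by linarith
  have hX1 : 1 ≤ X := by linarith
  set F := dualFn e γ M f₀ f₁ with hF
  have hF1 : ∀ x, ‖F x‖ ≤ 1 := norm_dualFn_le e γ M h₀ h₁
  choose χ P hχ hP1 hP hcor hlarge using fun t : Γ =>
    gowersTwo_inverse Γ (w := mulDeriv (t : G) F) (norm_mulDeriv_le hF1 _)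
      (ε := 1 / (2 * X)) (by positivity)
  have c1 := half_le_norm_of_inverse univ univ_nonempty hX
    (fun t : Γ => gowersTwo Γ (mulDeriv (t : G) F)) _ h (fun t _ => hcor t)
  have c2 := (pow_le_pow_left₀ (by positivity) c1 2).trans (dual_interchange γ e M h₀ h₁ P)
  have c3 : 1 / X ^ 4 ≤ _ := le_trans (le_of_eq (by rw [div_pow, one_pow, ← pow_mul])) c2
  have hM' : (X ^ 4) ^ 2200 ≤ (M : ℝ) := by rw [← pow_mul]; exact hM
  obtain ⟨ω', m, hm⟩ := exists_common_character (X := X ^ 4) e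
    (hX.trans (le_self_pow₀ hX1 (by norm_num))) hM' hR.2
    (fun (t t' : Γ) x => conj (f₀ (x + t)) * f₀ (x + t'))
    (fun (t t' : Γ) x => conj (f₁ (x + t)) * f₁ (x + t'))
    (fun (t t' : Γ) x => P t x * conj (P t' x))
    (fun _ _ _ => norm_mul_le_one (by rw [RCLike.norm_conj]; exact h₀ _) (h₀ _))
    (fun _ _ _ => norm_mul_le_one (by rw [RCLike.norm_conj]; exact h₁ _) (h₁ _))
    (fun _ _ _ => norm_mul_conj_le_one (hP1 _ _) (hP1 _ _))
    (fun (t t' : Γ) x => χ t x * (χ t' x)⁻¹)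
    (fun t t' x s => by
      simp only [hP, map_mul, AddChar.mul_apply, AddChar.inv_apply, conj_addChar]; ring) c3
  have c4 := expect_normSq_mulDeriv_mul_le Γ F (fun x => m x * χ (ω' x) x)
  refine le_trans ?_ c4
  have c5 : 1 / (2 * X) * 𝔼 x, dens univ (fun t : Γ => P t x * conj (P (ω' x) x) ≠ 0 ∧
      χ t x * (χ (ω' x) x)⁻¹ = m x) ≤
      𝔼 x, 𝔼 t : Γ, ‖𝔼 s : Γ, mulDeriv (t : G) F (x + s) * (m x * χ (ω' x) x) s‖ ^ 2 := by
    rw [Finset.mul_expect]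
    refine Finset.expect_le_expect fun x _ => ?_
    refine mul_dens_le_expect (fun t _ => by positivity) fun t _ ht => ?_
    have e1 : m x * χ (ω' x) x = χ t x := by rw [← ht.2, inv_mul_cancel_right]
    rw [e1]
    exact hlarge t x (left_ne_zero_of_mul ht.1)
  refine le_trans ?_ c5
  calc 1 / X ^ 29846 = 1 / X ^ 2 * (1 / (X ^ 4) ^ 7461) := by
        rw [← pow_mul, div_mul_div_comm, one_mul, ← pow_add]
    _ ≤ 1 / (2 * X) * (1 / (X ^ 4) ^ 7461) := by
        gcongr
        rw [sq]; gcongr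
    _ ≤ _ := by gcongr

/-- Degree lowering for the dual function: from `U⁴` to `U³`. -/
theorem gowersThree_dualFn_of_gowersFour (e : G) {M : ℕ} {X : ℝ} (hX : 2 ≤ X)
    (hM : X ^ 17600 ≤ M) (hR : OrderScale γ M) {f₀ f₁ : G → ℂ} (h₀ : ∀ x, ‖f₀ x‖ ≤ 1)
    (h₁ : ∀ x, ‖f₁ x‖ ≤ 1) (h : 1 / X ≤ gowersFour Γ (dualFn e γ M f₀ f₁)) :
    1 / X ^ 238760 ≤ gowersThree Γ (dualFn e γ M f₀ f₁) := by
  classical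
  have hX0 : 0 < X := by linarith
  have hX1 : 1 ≤ X := by linarith
  set F := dualFn e γ M f₀ f₁ with hF
  have hF1 : ∀ x, ‖F x‖ ≤ 1 := norm_dualFn_le e γ M h₀ h₁
  choose χ P hχ hP1 hP hcor hlarge using fun t : Γ × Γ =>
    gowersTwo_inverse Γ (w := mulDeriv (t.1 : G) (mulDeriv (t.2 : G) F))
      (norm_mulDeriv_le (norm_mulDeriv_le hF1 _) _) (ε := 1 / (2 * X)) (by positivity)
  have h' : 1 / X ≤ 𝔼 t : Γ × Γ, gowersTwo Γ (mulDeriv (t.1 : G) (mulDeriv (t.2 : G) F)) := by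
    refine h.trans (le_of_eq ?_)
    rw [← Finset.univ_product_univ, Finset.expect_product, Finset.expect_comm]
    rfl
  have c1 := half_le_norm_of_inverse univ univ_nonempty hX _ _ h' (fun t _ => hcor t)
  rw [← Finset.univ_product_univ, Finset.expect_product] at c1
  have c2 := (pow_le_pow_left₀ (by positivity) c1 4).trans (dual_interchange_two γ e M h₀ h₁ P)
  have c3 : 1 / X ^ 8 ≤ _ := le_trans (le_of_eq (by rw [div_pow, one_pow, ← pow_mul])) c2
  obtain ⟨ω', m, hm⟩ := exists_common_character (X := X ^ 8) e
    (hX.trans (le_self_pow₀ hX1 (by norm_num))) (by rw [← pow_mul]; exact hM) hR.2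
    _ _ (fun (t t' : Γ × Γ) x => P (t.1, t.2) x * conj (P (t'.1, t.2) x) *
      conj (P (t.1, t'.2) x) * P (t'.1, t'.2) x)
    (fun _ _ _ => norm_four_mul_le (h₀ _) (h₀ _) (h₀ _) (h₀ _))
    (fun _ _ _ => norm_four_mul_le (h₁ _) (h₁ _) (h₁ _) (h₁ _))
    (fun _ _ _ => norm_four_mul_le (hP1 _ _) (hP1 _ _) (hP1 _ _) (hP1 _ _))
    (fun t t' x => χ (t.1, t.2) x * (χ (t'.1, t.2) x)⁻¹ * (χ (t.1, t'.2) x)⁻¹ * χ (t'.1, t'.2) x)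
    (fun t t' x s => by
      simp only [hP, map_mul, AddChar.mul_apply, AddChar.inv_apply, conj_addChar]; ring) c3
  have c4 := expect_normSq_mulDeriv_two_mul_pow_le Γ hF1
    (fun x t₂ => m x * χ ((ω' x).1, t₂) x)
    (fun x t₁ => χ (t₁, (ω' x).2) x * (χ ((ω' x).1, (ω' x).2) x)⁻¹)
  refine le_trans ?_ c4
  set E := 𝔼 x, 𝔼 t₁ : Γ, 𝔼 t₂ : Γ, ‖𝔼 s : Γ, mulDeriv (t₁ : G) (mulDeriv (t₂ : G) F) (x + s) *
      ((m x * χ ((ω' x).1, t₂) x) s * (χ (t₁, (ω' x).2) x * (χ ((ω' x).1, (ω' x).2) x)⁻¹) s)‖ ^ 2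
    with hE
  have c5 : 1 / (2 * X) * 𝔼 x, dens univ (fun t : Γ × Γ =>
      P (t.1, t.2) x * conj (P ((ω' x).1, t.2) x) *
      conj (P (t.1, (ω' x).2) x) * P ((ω' x).1, (ω' x).2) x ≠ 0 ∧
      χ (t.1, t.2) x * (χ ((ω' x).1, t.2) x)⁻¹ * (χ (t.1, (ω' x).2) x)⁻¹ *
        χ ((ω' x).1, (ω' x).2) x = m x) ≤ E := by
    rw [hE, Finset.mul_expect]
    refine Finset.expect_le_expect fun x _ => ?_
    rw [← Finset.expect_product (s := (univ : Finset Γ)) (t := (univ : Finset Γ))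
      (f := fun t : Γ × Γ => ‖𝔼 s : Γ, mulDeriv (t.1 : G) (mulDeriv (t.2 : G) F) (x + s) *
      ((m x * χ ((ω' x).1, t.2) x) s *
        (χ (t.1, (ω' x).2) x * (χ ((ω' x).1, (ω' x).2) x)⁻¹) s)‖ ^ 2), Finset.univ_product_univ]
    refine mul_dens_le_expect (fun t _ => by positivity) fun t _ ht => ?_
    have e1 : (m x * χ ((ω' x).1, t.2) x) *
        (χ (t.1, (ω' x).2) x * (χ ((ω' x).1, (ω' x).2) x)⁻¹) = χ t x := by
      rw [← ht.2]
      have : ∀ a b c d : AddChar Γ ℂ, (a * b⁻¹ * c⁻¹ * d) * b * (c * d⁻¹) = a := by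
        intro a b c d
        calc (a * b⁻¹ * c⁻¹ * d) * b * (c * d⁻¹) = a * (b⁻¹ * b) * (c⁻¹ * c) * (d * d⁻¹) := by
              ac_rfl
          _ = a := by simp
      exact this _ _ _ _
    have e2 := hlarge t x (left_ne_zero_of_mul (left_ne_zero_of_mul (left_ne_zero_of_mul ht.1)))
    rw [← e1] at e2
    exact e2
  have c6 : 1 / X ^ 59690 ≤ E := by
    refine le_trans ?_ c5
    calc 1 / X ^ 59690 = 1 / X ^ 2 * (1 / (X ^ 8) ^ 7461) := by
          rw [← pow_mul, div_mul_div_comm, one_mul, ← pow_add]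
      _ ≤ 1 / (2 * X) * (1 / (X ^ 8) ^ 7461) := by
          gcongr
          rw [sq]; gcongr
      _ ≤ _ := by gcongr
  calc 1 / X ^ 238760 = (1 / X ^ 59690) ^ 4 := by rw [div_pow, one_pow, ← pow_mul]
    _ ≤ E ^ 4 := by gcongr

end Lowering

section Conj
variable {G : Type*} [AddCommGroup G] [Fintype G]

lemma mulDeriv_conj (t : G) (f : G → ℂ) :
    mulDeriv t (fun x => conj (f x)) = fun x => conj (mulDeriv t f x) := by
  funext x
  simp only [mulDeriv, map_mul]

lemma sqAvg_conj {ι : Type*} (S : Finset ι) (v : ι → G) (f : G → ℂ) :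
    sqAvg S v (fun x => conj (f x)) = sqAvg S v f := by
  simp only [sqAvg, ← conj_expect, RCLike.norm_conj]

lemma gowersFour_conj (Γ : AddSubgroup G) [Fintype Γ] (f : G → ℂ) :
    gowersFour Γ (fun x => conj (f x)) = gowersFour Γ f := by
  simp only [gowersFour, gowersThree, gowersTwo, gowersOne, mulDeriv_conj, sqAvg_conj]

lemma normSq_Lam_le (e γ : G) (M : ℕ) (f₀ f₁ : G → ℂ) {f₂ : G → ℂ} (h₂ : ∀ x, ‖f₂ x‖ ≤ 1) :
    ‖Lam e γ M f₀ f₁ f₂‖ ^ 2 ≤ ‖Lam e γ M f₀ f₁ (fun x => conj (dualFn e γ M f₀ f₁ x))‖ := by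
  rw [Lam_eq_expect_dualFn, Lam_eq_expect_dualFn]
  simp_rw [mul_comm _ (f₂ _)]
  refine (normSq_expect_mul_le _ _ _ fun x _ => h₂ x).trans (le_of_eq ?_)
  simp_rw [Complex.mul_conj, Complex.normSq_eq_norm_sq]
  rw [← ofReal_expect, Complex.norm_real, Real.norm_of_nonneg]
  exact Finset.expect_nonneg fun _ _ => by positivity

end Conj

section Phase

/-- A large count forces a correlation of the dual function with functions that transform along
the cosets by characters. -/
theorem exists_phase_of_Lam : ∃ K : ℕ, ∀ (G : Type) [AddCommGroup G] [Fintype G] (e γ : G)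
    [Fintype (AddSubgroup.zmultiples γ)] (M : ℕ) (X : ℝ) (f₀ f₁ f₂ : G → ℂ), 2 ≤ X → X ^ K ≤ M →
    OrderScale γ M → (∀ x, ‖f₀ x‖ ≤ 1) → (∀ x, ‖f₁ x‖ ≤ 1) → (∀ x, ‖f₂ x‖ ≤ 1) →
    1 / X ≤ ‖Lam e γ M f₀ f₁ f₂‖ →
    ∃ (χ : G → AddChar (AddSubgroup.zmultiples γ) ℂ) (P : G → ℂ),
      (∀ x (s : AddSubgroup.zmultiples γ), χ (x + s) = χ x) ∧ (∀ x, ‖P x‖ ≤ 1) ∧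
      (∀ x (s : AddSubgroup.zmultiples γ), P (x + s) = P x * χ x s) ∧
      1 / X ^ K ≤ ‖Lam e γ M f₀ f₁ P‖ := by
  obtain ⟨K, hK⟩ := gowersFour_of_Lam
  obtain ⟨a, ha⟩ : ∃ a : ℕ, a = 238760 := ⟨_, rfl⟩
  obtain ⟨b, hb⟩ : ∃ b : ℕ, b = 29846 := ⟨_, rfl⟩
  refine ⟨(2 * K + 1) * a * b * 2, fun G _ _ e γ _ M X f₀ f₁ f₂ hX hM hR h₀ h₁ h₂ hL => ?_⟩
  have hX0 : 0 < X := by linarith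
  have hX1 : 1 ≤ X := by linarith
  have ha1 : 17600 ≤ a := by omega
  have hb1 : 8800 ≤ b := by omega
  have hpow : ∀ n, n ≤ (2 * K + 1) * a * b * 2 → X ^ n ≤ M := fun n hn =>
    (pow_le_pow_right₀ hX1 hn).trans hM
  have hab : 17600 ≤ a * b := by nlinarith
  have h1 : 1 / X ^ 2 ≤ ‖Lam e γ M f₀ f₁ (fun x => conj (dualFn e γ M f₀ f₁ x))‖ := by
    refine le_trans ?_ (normSq_Lam_le e γ M f₀ f₁ h₂)
    calc 1 / X ^ 2 = (1 / X) ^ 2 := by rw [div_pow, one_pow]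
      _ ≤ _ := by gcongr
  have h2 := hK G e γ M (X ^ 2) f₀ f₁ _ (hX.trans (le_self_pow₀ hX1 (by norm_num)))
    (by rw [← pow_mul]; exact hpow _ (by nlinarith)) hR h₀ h₁
    (fun x => by rw [RCLike.norm_conj]; exact norm_dualFn_le e γ M h₀ h₁ x) h1
  rw [gowersFour_conj] at h2
  have h3 : 1 / X ^ (2 * K + 1) ≤
      gowersFour (AddSubgroup.zmultiples γ) (dualFn e γ M f₀ f₁) := by
    refine le_trans ?_ h2
    rw [← pow_mul]
    exact one_div_le_one_div_of_le (by positivity) (pow_le_pow_right₀ hX1 (by omega))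
  have h4 := gowersThree_dualFn_of_gowersFour e
    (hX.trans (le_self_pow₀ hX1 (by omega))) (by rw [← pow_mul]; exact hpow _ (by nlinarith))
    hR h₀ h₁ h3
  rw [← ha, ← pow_mul] at h4
  have hne : (2 * K + 1) * a ≠ 0 := by positivity
  have h5 := gowersTwo_dualFn_of_gowersThree e
    (hX.trans (le_self_pow₀ hX1 hne)) (by
      rw [← pow_mul]
      exact hpow _ ((Nat.mul_le_mul_left _ hb1).trans (Nat.le_mul_of_pos_right _ (by norm_num))))
    hR h₀ h₁ h4
  rw [← hb, ← pow_mul] at h5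
  set Y := X ^ ((2 * K + 1) * a * b) with hY
  have hne' : (2 * K + 1) * a * b ≠ 0 := by positivity
  have hY2 : 2 ≤ Y := hX.trans (le_self_pow₀ hX1 hne')
  obtain ⟨χ, P, hχ, hP1, hP, hcor, -⟩ := gowersTwo_inverse (AddSubgroup.zmultiples γ)
    (norm_dualFn_le e γ M h₀ h₁) (ε := 1 / (2 * Y)) (by positivity)
  refine ⟨χ, P, hχ, hP1, hP, ?_⟩
  rw [Lam_eq_expect_dualFn, pow_mul, ← hY]
  have := half_le_norm_of_inverse (univ : Finset Unit) univ_nonempty hY2 (fun _ => _) (fun _ => _)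
    (by simpa using h5) (fun _ _ => hcor)
  simpa using this

variable {G : Type*} [AddCommGroup G] [Fintype G] {γ : G} [Fintype (AddSubgroup.zmultiples γ)]
local notation "Γ" => AddSubgroup.zmultiples γ

lemma Lam_sum (e γ : G) (M : ℕ) (f₀ f₁ : G → ℂ) {ι : Type*} (s : Finset ι) (P : ι → G → ℂ) :
    Lam e γ M f₀ f₁ (fun x => ∑ i ∈ s, P i x) = ∑ i ∈ s, Lam e γ M f₀ f₁ (P i) := by
  simp_rw [Lam, Finset.mul_sum, Finset.expect_sum_comm]

lemma Lam_add (e γ : G) (M : ℕ) (f₀ f₁ P Q : G → ℂ) :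
    Lam e γ M f₀ f₁ (fun x => P x + Q x) = Lam e γ M f₀ f₁ P + Lam e γ M f₀ f₁ Q := by
  simp_rw [Lam, mul_add, Finset.expect_add_distrib]

/-- The frequencies of a correlating phase function may be taken to be near rationals with a
common small denominator. -/
lemma exists_phase_restrict (e : G) {M : ℕ} {X : ℝ} (hX : 2 ≤ X) (hM : X ^ 2200 ≤ M)
    {f₀ f₁ P : G → ℂ} (h₀ : ∀ x, ‖f₀ x‖ ≤ 1) (h₁ : ∀ x, ‖f₁ x‖ ≤ 1) (hP1 : ∀ x, ‖P x‖ ≤ 1)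
    (χ : G → AddChar Γ ℂ) (hχ : ∀ x (s : Γ), χ (x + s) = χ x)
    (hP : ∀ x (s : Γ), P (x + s) = P x * χ x s) (h : 1 / X ≤ ‖Lam e γ M f₀ f₁ P‖) :
    ∃ (d : ℕ) (Q : G → ℂ), 0 < d ∧ (d : ℝ) ≤ X ^ 2480 ∧ (∀ x, ‖Q x‖ ≤ 1) ∧
      (∀ x (s : Γ), Q (x + s) = Q x * χ x s) ∧
      (∀ x, Q x ≠ 0 → nd (d * angle (χ x)) ≤ X ^ 2480 / M ^ 2) ∧
      1 / X ^ 2482 ≤ ‖Lam e γ M f₀ f₁ Q‖ := by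
  classical
  have hX0 : 0 < X := by linarith
  have hX1 : 1 ≤ X := by linarith
  obtain ⟨D, hD⟩ : ∃ D : ℝ, D = X ^ 2480 := ⟨_, rfl⟩
  have hD0 : 0 < D := by rw [hD]; positivity
  rw [show X ^ 2482 = X ^ 2 * D by rw [hD, ← pow_add], ← hD]
  have hex : ∀ c : AddChar Γ ℂ, ∃ d : ℕ, Major D M (angle c) →
      0 < d ∧ (d : ℝ) ≤ D ∧ nd (d * angle c) ≤ D / M ^ 2 := fun c => by
    by_cases hc : Major D M (angle c)
    · obtain ⟨d, hd⟩ := hc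
      exact ⟨d, fun _ => hd⟩
    · exact ⟨0, fun h => absurd h hc⟩
  choose den hden using hex
  set Pmin : G → ℂ := fun x => if Major D M (angle (χ x)) then 0 else P x with hPmin
  set Q : ℕ → G → ℂ := fun d x =>
    if Major D M (angle (χ x)) ∧ den (χ x) = d then P x else 0 with hQ
  set T : Finset ℕ := Icc 1 ⌊D⌋₊ with hT
  have hmin : ‖Lam e γ M f₀ f₁ Pmin‖ < 1 / X ^ 2 := by
    by_contra! hcon
    have hPm : ∀ x (s : Γ), Pmin (x + s) = Pmin x * χ x s := fun x s => by
      simp only [hPmin, hχ, hP]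
      split_ifs <;> simp
    have hPm1 : ∀ x, ‖Pmin x‖ ≤ 1 := fun x => by
      simp only [hPmin]
      split_ifs
      · simp
      · exact hP1 x
    rw [Lam_eq_phase e M _ _ _ χ hPm] at hcon
    have hM' : (X ^ 2) ^ 1100 ≤ (M : ℝ) := by rw [← pow_mul]; exact hM
    have := dens_major_of_correlation e (hX.trans (le_self_pow₀ hX1 (by norm_num))) hM'
      (fun x => norm_mul_le_one (h₀ x) (hPm1 x)) h₁ _ hcon
    have hz : dens univ (fun x => f₀ x * Pmin x ≠ 0 ∧ Major ((X ^ 2) ^ 1240) M (angle (χ x))) = 0 := by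
      rw [dens_eq_card_filter_div]
      refine Finset.expect_eq_zero fun x _ => if_neg ?_
      rintro ⟨a1, a2⟩
      rw [← pow_mul, ← hD] at a2
      exact a1 (by simp [hPmin, a2])
    rw [hz] at this
    have : (0 : ℝ) < 1 / (X ^ 2) ^ 6 := by positivity
    linarith
  have hsplit : P = fun x => Pmin x + ∑ d ∈ T, Q d x := by
    funext x
    simp only [hPmin, hQ]
    by_cases hx : Major D M (angle (χ x))
    · obtain ⟨a1, a2, -⟩ := hden _ hx
      have : den (χ x) ∈ T := by
        rw [hT, mem_Icc]
        exact ⟨a1, Nat.le_floor a2⟩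
      simp [hx, this]
    · simp [hx]
  have h2X : 1 / X ^ 2 ≤ 1 / X - 1 / X ^ 2 := by
    have : 1 / X - 1 / X ^ 2 - 1 / X ^ 2 = (X - 2) / X ^ 2 := by field_simp; ring
    have h3 : 0 ≤ (X - 2) / X ^ 2 := div_nonneg (by linarith) (by positivity)
    linarith
  have hsum : 1 / X ^ 2 < ∑ d ∈ T, ‖Lam e γ M f₀ f₁ (Q d)‖ := by
    have e1 := h
    rw [hsplit, Lam_add, Lam_sum] at e1
    have e2 := norm_add_le (Lam e γ M f₀ f₁ Pmin) (∑ d ∈ T, Lam e γ M f₀ f₁ (Q d))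
    have e3 := norm_sum_le T (fun d => Lam e γ M f₀ f₁ (Q d))
    linarith
  obtain ⟨d, hdT, hd⟩ : ∃ d ∈ T, 1 / (X ^ 2 * D) ≤ ‖Lam e γ M f₀ f₁ (Q d)‖ := by
    by_contra! hcon
    have e1 := Finset.sum_le_sum fun d hd => (hcon d hd).le
    rw [Finset.sum_const, nsmul_eq_mul] at e1
    have e2 : (#T : ℝ) ≤ D := by
      rw [hT, Nat.card_Icc]
      simpa using Nat.floor_le hD0.le
    have e3 : (#T : ℝ) * (1 / (X ^ 2 * D)) ≤ D * (1 / (X ^ 2 * D)) := by gcongr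
    have e4 : D * (1 / (X ^ 2 * D)) = 1 / X ^ 2 := by field_simp
    linarith
  rw [hT, mem_Icc] at hdT
  refine ⟨d, Q d, hdT.1, (Nat.cast_le.2 hdT.2).trans (Nat.floor_le hD0.le), fun x => ?_,
    fun x s => ?_, fun x hx => ?_, hd⟩
  · simp only [hQ]
    split_ifs
    · exact hP1 x
    · simp
  · simp only [hQ, hχ, hP]
    split_ifs <;> simp
  · simp only [hQ] at hx
    have hx' : Major D M (angle (χ x)) ∧ den (χ x) = d := by
      by_contra hc
      exact hx (if_neg hc)
    rw [← hx'.2]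
    exact (hden _ hx'.1).2.2

end Phase

section LocalAverages
variable {G : Type*} [AddCommGroup G] [Fintype G]

lemma norm_ee_add_mul_sub_le (θ : ℝ) (d : ℕ) (n m : ℤ) :
    ‖ee (θ * (n + d * m)) - ee (θ * n)‖ ≤ 7 * (nd (d * θ) * |(m : ℝ)|) := by
  have h1 : ee (θ * (n + d * m)) = ee (θ * n) * ee ((d * θ - round (d * θ)) * m) := by
    rw [← ee_add, ← ee_add_intCast (θ * n + _) (round (d * θ) * m)]
    congr 1; push_cast; ring
  rw [h1, ← mul_sub_one, norm_mul, norm_ee, one_mul]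
  refine (norm_ee_sub_one_le _).trans (le_of_eq ?_)
  rw [abs_mul]; rfl

lemma norm_expect_sub_le {ι : Type*} {s : Finset ι} {f g : ι → ℂ} {a : ℝ} (ha : 0 ≤ a)
    (h : ∀ i ∈ s, ‖f i - g i‖ ≤ a) : ‖(𝔼 i ∈ s, f i) - 𝔼 i ∈ s, g i‖ ≤ a := by
  rw [← Finset.expect_sub_distrib]
  exact norm_expect_le_of_le ha h

lemma norm_le_of_norm_sub_le {a b : ℂ} {r : ℝ} (h : ‖a - b‖ ≤ r) : ‖a‖ ≤ ‖b‖ + r := by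
  have := norm_sub_norm_le a b
  linarith

/-- A correlation with a quadratic phase whose frequencies are near rationals of denominator `d`
is bounded by the averages of the linear function along progressions of difference `d • e`. -/
lemma norm_expect_phase_le_linear (e : G) {M J d : ℕ} (hM : 0 < M) (hJ : 0 < J) {D : ℝ}
    (hd : (d : ℝ) ≤ D) (hDJ : D * J ≤ M) {g f : G → ℂ} (hg : ∀ x, ‖g x‖ ≤ 1) (hf : ∀ x, ‖f x‖ ≤ 1)
    (θ : G → ℝ) (hθ : ∀ x, g x ≠ 0 → nd (d * θ x) ≤ D / M ^ 2) :
    ‖𝔼 x, 𝔼 y ∈ Icc (1 : ℤ) M, g x * f (x + y • e) * ee (θ x * y ^ 2)‖ ≤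
      (𝔼 x, ‖𝔼 j ∈ Icc (1 : ℤ) J, f (x + (d * j : ℤ) • e)‖) + 23 * D * J / M := by
  have hM0 : (0 : ℝ) < M := by exact_mod_cast hM
  have hD0 : 0 ≤ D := (Nat.cast_nonneg d).trans hd
  set Y := Icc (1 : ℤ) M
  set S := Icc (1 : ℤ) J
  have hS : S.Nonempty := Icc_one_nonempty hJ
  have key : ∀ x, ‖𝔼 y ∈ Y, g x * f (x + y • e) * ee (θ x * y ^ 2)‖ ≤
      (𝔼 y ∈ Y, ‖𝔼 j ∈ S, f (x + y • e + (d * j : ℤ) • e)‖) + 23 * D * J / M := by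
    intro x
    set a : ℤ → ℂ := fun y => g x * f (x + y • e) * ee (θ x * y ^ 2) with ha
    have h1 := norm_expect_sub_expect_shift_le M a
      (fun y => norm_mul_le_one (norm_mul_le_one (hg _) (hf _)) (norm_ee _).le) S hS
      (fun j => d * j) (D * J) (fun j hj => by
        have := mem_Icc_cast hj
        have h0 : (0 : ℝ) ≤ j := by exact_mod_cast this.1
        exact ⟨mul_nonneg (by omega) this.1, by
          push_cast; exact mul_le_mul hd this.2 h0 hD0⟩)
    have h2 : ‖(𝔼 j ∈ S, 𝔼 y ∈ Y, a (y + d * j)) - 𝔼 j ∈ S, 𝔼 y ∈ Y,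
        g x * ee (θ x * y ^ 2) * f (x + y • e + (d * j : ℤ) • e)‖ ≤ 21 * D * J / M := by
      refine norm_expect_sub_le (by positivity) fun j hj => norm_expect_sub_le (by positivity)
        fun y hy => ?_
      have e1 : a (y + d * j) - g x * ee (θ x * y ^ 2) * f (x + y • e + (d * j : ℤ) • e) =
          g x * f (x + y • e + (d * j : ℤ) • e) *
            (ee (θ x * ((y ^ 2 : ℤ) + d * (2 * y * j + d * j ^ 2 : ℤ))) -
              ee (θ x * (y ^ 2 : ℤ))) := by
        have b1 : x + (y + d * j : ℤ) • e = x + y • e + (d * j : ℤ) • e := by module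
        have b2 : θ x * ((y + d * j : ℤ) : ℝ) ^ 2 =
            θ x * ((y ^ 2 : ℤ) + d * (2 * y * j + d * j ^ 2 : ℤ)) := by push_cast; ring
        simp only [ha, b1, b2]
        push_cast; ring
      rw [e1]
      by_cases hgx : g x = 0
      · rw [hgx]; simp; positivity
      rw [norm_mul]
      refine (mul_le_of_le_one_left (norm_nonneg _) (norm_mul_le_one (hg _) (hf _))).trans ?_
      refine (norm_ee_add_mul_sub_le _ _ _ _).trans ?_
      have hy' := mem_Icc_cast hy
      have hj' := mem_Icc_cast hj
      have hy0 : (0 : ℝ) ≤ y := by exact_mod_cast hy'.1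
      have hj0 : (0 : ℝ) ≤ j := by exact_mod_cast hj'.1
      have b3 : |((2 * y * j + d * j ^ 2 : ℤ) : ℝ)| ≤ 3 * M * J := by
        push_cast
        rw [abs_of_nonneg (by positivity)]
        have b4 : (y : ℝ) * j ≤ M * J := mul_le_mul hy'.2 hj'.2 hj0 hM0.le
        have b5 : (d : ℝ) * j ≤ M := (mul_le_mul hd hj'.2 hj0 hD0).trans hDJ
        have b6 : (d : ℝ) * j * j ≤ M * J := mul_le_mul b5 hj'.2 hj0 hM0.le
        nlinarith
      calc 7 * (nd (d * θ x) * |((2 * y * j + d * j ^ 2 : ℤ) : ℝ)|) ≤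
          7 * (D / M ^ 2 * (3 * M * J)) := by
            have := hθ x hgx
            gcongr
        _ = 21 * D * J / M := by field_simp; ring
    have h3 : ‖𝔼 j ∈ S, 𝔼 y ∈ Y, g x * ee (θ x * y ^ 2) * f (x + y • e + (d * j : ℤ) • e)‖ ≤
        𝔼 y ∈ Y, ‖𝔼 j ∈ S, f (x + y • e + (d * j : ℤ) • e)‖ := by
      rw [Finset.expect_comm]
      refine (norm_expect_le _ _).trans (Finset.expect_le_expect fun y _ => ?_)
      rw [← Finset.mul_expect, norm_mul]
      exact mul_le_of_le_one_left (norm_nonneg _) (norm_mul_le_one (hg _) (norm_ee _).le)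
    have h4 := norm_le_of_norm_sub_le h1
    have h5 := norm_le_of_norm_sub_le h2
    have h6 : 23 * D * J / M = 2 * (D * J) / M + 21 * D * J / M := by ring
    linarith
  refine (norm_expect_le _ _).trans ((Finset.expect_le_expect fun x _ => key x).trans ?_)
  rw [Finset.expect_add_distrib, Fintype.expect_const, Finset.expect_comm]
  refine add_le_add (le_of_eq ?_) le_rfl
  have : ∀ y ∈ Y, 𝔼 x, ‖𝔼 j ∈ S, f (x + y • e + (d * j : ℤ) • e)‖ =
      𝔼 x, ‖𝔼 j ∈ S, f (x + (d * j : ℤ) • e)‖ := fun y _ =>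
    expect_add_right (fun x => ‖𝔼 j ∈ S, f (x + (d * j : ℤ) • e)‖) (y • e)
  rw [Finset.expect_congr rfl this, Finset.expect_const (Icc_one_nonempty hM)]

/-- The analogue of `norm_expect_phase_le_linear` for the constant function of the count. -/
lemma norm_expect_phase_le_const (e γ : G) {q : ℕ} (hq : 0 < q) (hγ : γ = q • e) {M I d : ℕ}
    (hM : 0 < M) (hI : 0 < I) {D : ℝ} (hd : (d : ℝ) ≤ D) (hDI : D * (q * I) ≤ M)
    {f₀ f₁ P : G → ℂ} (h₀ : ∀ x, ‖f₀ x‖ ≤ 1) (h₁ : ∀ x, ‖f₁ x‖ ≤ 1) (hP1 : ∀ x, ‖P x‖ ≤ 1)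
    (θ : G → ℝ) (hθγ : ∀ x (n : ℤ), θ (x + n • γ) = θ x)
    (hP : ∀ x (n : ℤ), P (x + n • γ) = P x * ee (θ x * n))
    (hθ : ∀ x, P x ≠ 0 → nd (d * θ x) ≤ D / M ^ 2) :
    ‖𝔼 x, 𝔼 y ∈ Icc (1 : ℤ) M, (f₀ x * P x) * f₁ (x + y • e) * ee (θ x * y ^ 2)‖ ≤
      (𝔼 x, ‖𝔼 i ∈ Icc (1 : ℤ) I, f₀ (x + (d * i : ℤ) • γ)‖) + 30 * D * (q * I) / M := by
  have hM0 : (0 : ℝ) < M := by exact_mod_cast hM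
  have hM1 : (1 : ℝ) ≤ M := by exact_mod_cast hM
  have hq1 : (1 : ℝ) ≤ q := by exact_mod_cast hq
  have hD0 : 0 ≤ D := (Nat.cast_nonneg d).trans hd
  set Y := Icc (1 : ℤ) M
  set S := Icc (1 : ℤ) I
  have hS : S.Nonempty := Icc_one_nonempty hI
  set F : G → ℂ := fun x => 𝔼 y ∈ Y, (f₀ x * P x) * f₁ (x + y • e) * ee (θ x * y ^ 2) with hF
  have h1 : ‖(𝔼 i ∈ S, 𝔼 x, F (x + (d * i : ℤ) • γ)) - 𝔼 i ∈ S, 𝔼 x, 𝔼 y ∈ Y,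
      (P x * f₁ (x + y • e) * ee (θ x * y ^ 2)) * f₀ (x + (d * i : ℤ) • γ)‖ ≤
        30 * D * (q * I) / M := by
    refine norm_expect_sub_le (by positivity) fun i hi => norm_expect_sub_le (by positivity)
      fun x _ => ?_
    have hi' := mem_Icc_cast hi
    have hi0 : (0 : ℝ) ≤ i := by exact_mod_cast hi'.1
    set u : ℤ → ℂ := fun y => (f₀ (x + (d * i : ℤ) • γ) * P (x + (d * i : ℤ) • γ)) *
      f₁ (x + y • e) * ee (θ x * (y - d * i * q) ^ 2) with hu
    have e1 : F (x + (d * i : ℤ) • γ) = 𝔼 y ∈ Y, u (y + d * i * q) := by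
      simp only [hF, hu]
      refine Finset.expect_congr rfl fun y _ => ?_
      have b1 : x + (d * i : ℤ) • γ + y • e = x + (y + d * i * q : ℤ) • e := by
        rw [hγ]; module
      rw [b1, hθγ]
      congr 2
      push_cast; ring
    have hdi : (d : ℝ) * i ≤ D * I := mul_le_mul hd hi'.2 hi0 hD0
    have e2 := expect_Icc_shift_le M u
      (fun y => norm_mul_le_one (norm_mul_le_one (norm_mul_le_one (h₀ _) (hP1 _)) (h₁ _))
        (norm_ee _).le) (d * i * q) (mul_nonneg (mul_nonneg (by omega) hi'.1) (by omega))
    have e2' : 2 * ((d * i * q : ℤ) : ℝ) / M ≤ 2 * D * (q * I) / M := by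
      push_cast
      gcongr ?_ / _
      nlinarith
    have e3 : ‖(𝔼 y ∈ Y, u y) - 𝔼 y ∈ Y, (P x * f₁ (x + y • e) * ee (θ x * y ^ 2)) *
        f₀ (x + (d * i : ℤ) • γ)‖ ≤ 28 * D * (q * I) / M := by
      refine norm_expect_sub_le (by positivity) fun y hy => ?_
      have e4 : u y - (P x * f₁ (x + y • e) * ee (θ x * y ^ 2)) * f₀ (x + (d * i : ℤ) • γ) =
          (f₀ (x + (d * i : ℤ) • γ) * f₁ (x + y • e) * P x) *
          (ee (θ x * ((y ^ 2 : ℤ) + d * (i - 2 * y * i * q + d * (i * q) ^ 2 : ℤ))) -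
            ee (θ x * (y ^ 2 : ℤ))) := by
        have b1 : θ x * ((y ^ 2 : ℤ) + d * (i - 2 * y * i * q + d * (i * q) ^ 2 : ℤ)) =
            θ x * (d * i : ℤ) + θ x * (y - d * i * q) ^ 2 := by push_cast; ring
        rw [b1, ee_add]
        simp only [hu, hP]
        push_cast; ring
      rw [e4]
      by_cases hPx : P x = 0
      · rw [hPx]; simp; positivity
      rw [norm_mul]
      refine (mul_le_of_le_one_left (norm_nonneg _)
        (norm_mul_le_one (norm_mul_le_one (h₀ _) (h₁ _)) (hP1 _))).trans ?_
      refine (norm_ee_add_mul_sub_le _ _ _ _).trans ?_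
      have hy' := mem_Icc_cast hy
      have hy0 : (0 : ℝ) ≤ y := by exact_mod_cast hy'.1
      have hiq0 : (0 : ℝ) ≤ i * q := by positivity
      have hiq : (i : ℝ) * q ≤ q * I := by rw [mul_comm]; gcongr; exact hi'.2
      have b3 : |((i - 2 * y * i * q + d * (i * q) ^ 2 : ℤ) : ℝ)| ≤ 4 * M * (q * I) := by
        push_cast
        have b4 : (y : ℝ) * (i * q) ≤ M * (q * I) := mul_le_mul hy'.2 hiq hiq0 hM0.le
        have b5 : (d : ℝ) * (i * q) ≤ M := (mul_le_mul hd hiq hiq0 hD0).trans hDI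
        have b6 : (d : ℝ) * (i * q) * (i * q) ≤ M * (q * I) := mul_le_mul b5 hiq hiq0 hM0.le
        have b7 : (i : ℝ) ≤ M * (q * I) := by
          calc (i : ℝ) ≤ i * q := le_mul_of_one_le_right hi0 hq1
            _ ≤ q * I := hiq
            _ ≤ _ := le_mul_of_one_le_left (by positivity) hM1
        have b8 : 0 ≤ (y : ℝ) * (i * q) := by positivity
        have b9 : 0 ≤ (d : ℝ) * (i * q) * (i * q) := by positivity
        rw [abs_le]
        constructor <;> nlinarith
      calc 7 * (nd (d * θ x) * |((i - 2 * y * i * q + d * (i * q) ^ 2 : ℤ) : ℝ)|) ≤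
          7 * (D / M ^ 2 * (4 * M * (q * I))) := by
            have := hθ x hPx
            gcongr
        _ = 28 * D * (q * I) / M := by field_simp; ring
    rw [e1]
    refine (norm_sub_le_norm_sub_add_norm_sub _ (𝔼 y ∈ Y, u y) _).trans ?_
    have : 30 * D * (q * I) / M = 2 * D * (q * I) / M + 28 * D * (q * I) / M := by ring
    linarith
  have h2 : 𝔼 i ∈ S, 𝔼 x, F (x + (d * i : ℤ) • γ) = 𝔼 x, F x := by
    simp_rw [expect_add_right]
    exact Finset.expect_const hS _
  have h3 : ‖𝔼 i ∈ S, 𝔼 x, 𝔼 y ∈ Y,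
      (P x * f₁ (x + y • e) * ee (θ x * y ^ 2)) * f₀ (x + (d * i : ℤ) • γ)‖ ≤
      𝔼 x, ‖𝔼 i ∈ S, f₀ (x + (d * i : ℤ) • γ)‖ := by
    rw [Finset.expect_comm]
    refine (norm_expect_le _ _).trans (Finset.expect_le_expect fun x _ => ?_)
    rw [Finset.expect_comm]
    simp_rw [← Finset.mul_expect]
    refine norm_expect_le_of_le (norm_nonneg _) fun y _ => ?_
    rw [norm_mul]
    exact mul_le_of_le_one_left (norm_nonneg _)
      (norm_mul_le_one (norm_mul_le_one (hP1 _) (h₁ _)) (norm_ee _).le)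
  rw [h2] at h1
  have h4 := norm_le_of_norm_sub_le h1
  linarith

/-- A count with an almost periodic linear function is bounded by averages of the quadratic
function along short quadratic progressions. -/
lemma norm_Lam_le_of_almost_periodic (e γ : G) {M I d : ℕ} (hI : 0 < I) {η : ℝ}
    {f₀ φ f₂ : G → ℂ} (h₀ : ∀ x, ‖f₀ x‖ ≤ 1) (hφ : ∀ x, ‖φ x‖ ≤ 1) (h₂ : ∀ x, ‖f₂ x‖ ≤ 1)
    (hper : ∀ x, ∀ i ∈ Icc (1 : ℤ) I, ‖φ (x + (d * i : ℤ) • e) - φ x‖ ≤ η) :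
    ‖Lam e γ M f₀ φ f₂‖ ≤ (𝔼 y ∈ Icc (1 : ℤ) M, 𝔼 x, ‖𝔼 i ∈ Icc (1 : ℤ) I,
      f₂ (x + (d ^ 2 * i ^ 2 + 2 * d * y * i : ℤ) • γ)‖) + (2 * (d * I) / M + η) := by
  have hS : (Icc (1 : ℤ) I).Nonempty := Icc_one_nonempty hI
  have hη : 0 ≤ η := (norm_nonneg _).trans (hper 0 1 (by rw [mem_Icc]; omega))
  set Y := Icc (1 : ℤ) M
  set S := Icc (1 : ℤ) I
  have key : ∀ x, ‖𝔼 y ∈ Y, f₀ x * φ (x + y • e) * f₂ (x + (y ^ 2) • γ)‖ ≤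
      (𝔼 y ∈ Y, ‖𝔼 i ∈ S, f₂ (x + (y ^ 2) • γ + (d ^ 2 * i ^ 2 + 2 * d * y * i : ℤ) • γ)‖) +
        (2 * (d * I) / M + η) := by
    intro x
    have h1 := norm_expect_sub_expect_shift_le M
      (fun y => f₀ x * φ (x + y • e) * f₂ (x + (y ^ 2) • γ))
      (fun y => norm_mul_le_one (norm_mul_le_one (h₀ _) (hφ _)) (h₂ _)) S hS
      (fun i => d * i) (d * I) (fun i hi => by
        have := mem_Icc_cast hi
        exact ⟨mul_nonneg (by omega) this.1, by push_cast; gcongr; exact this.2⟩)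
    have h2 : ‖(𝔼 i ∈ S, 𝔼 y ∈ Y, f₀ x * φ (x + (y + d * i) • e) * f₂ (x + ((y + d * i) ^ 2) • γ)) -
        𝔼 i ∈ S, 𝔼 y ∈ Y, f₀ x * φ (x + y • e) *
          f₂ (x + (y ^ 2) • γ + (d ^ 2 * i ^ 2 + 2 * d * y * i : ℤ) • γ)‖ ≤ η := by
      refine norm_expect_sub_le hη fun i hi => norm_expect_sub_le hη fun y _ => ?_
      have b1 : x + (y + d * i) • e = x + y • e + (d * i : ℤ) • e := by module
      have b2 : x + ((y + d * i) ^ 2) • γ =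
          x + (y ^ 2) • γ + (d ^ 2 * i ^ 2 + 2 * d * y * i : ℤ) • γ := by module
      rw [b1, b2, ← sub_mul, ← mul_sub, norm_mul, norm_mul]
      calc _ ≤ 1 * η * 1 := by
            gcongr
            · exact h₀ x
            · exact hper _ i hi
            · exact h₂ _
        _ = η := by ring
    have h3 : ‖𝔼 i ∈ S, 𝔼 y ∈ Y, f₀ x * φ (x + y • e) *
          f₂ (x + (y ^ 2) • γ + (d ^ 2 * i ^ 2 + 2 * d * y * i : ℤ) • γ)‖ ≤
        𝔼 y ∈ Y, ‖𝔼 i ∈ S, f₂ (x + (y ^ 2) • γ + (d ^ 2 * i ^ 2 + 2 * d * y * i : ℤ) • γ)‖ := by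
      rw [Finset.expect_comm]
      refine (norm_expect_le _ _).trans (Finset.expect_le_expect fun y _ => ?_)
      rw [← Finset.mul_expect, norm_mul]
      exact mul_le_of_le_one_left (norm_nonneg _) (norm_mul_le_one (h₀ _) (hφ _))
    have h4 := norm_le_of_norm_sub_le h1
    have h5 := norm_le_of_norm_sub_le h2
    linarith
  refine (norm_expect_le _ _).trans ((Finset.expect_le_expect fun x _ => key x).trans ?_)
  rw [Finset.expect_add_distrib, Fintype.expect_const, Finset.expect_comm]
  refine add_le_add (le_of_eq (Finset.expect_congr rfl fun y _ => ?_)) le_rfl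
  exact expect_add_right (fun x => ‖𝔼 i ∈ S, f₂ (x + (d ^ 2 * i ^ 2 + 2 * d * y * i : ℤ) • γ)‖)
    ((y ^ 2) • γ)

end LocalAverages

section Spectrum
variable {G : Type*} [AddCommGroup G] [Fintype G] {γ : G} [Fintype (AddSubgroup.zmultiples γ)]
local notation "Γ" => AddSubgroup.zmultiples γ

/-- The mass of `f` at the frequency `χ` along the cosets of `Γ`. -/
noncomputable def spectralMass (f : G → ℂ) (χ : AddChar Γ ℂ) : ℝ :=
  𝔼 x, ‖𝔼 s : Γ, f (x + s) * χ s‖ ^ 2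

lemma spectralMass_nonneg (f : G → ℂ) (χ : AddChar Γ ℂ) : 0 ≤ spectralMass f χ :=
  Finset.expect_nonneg fun _ _ => by positivity

/-- Parseval's identity along the cosets of `Γ`. -/
lemma expect_normSq_expect_zsmul {ι : Type*} (S : Finset ι) (v : ι → ℤ) (f : G → ℂ) :
    𝔼 x, ‖𝔼 i ∈ S, f (x + v i • γ)‖ ^ 2 =
      ∑ χ : AddChar Γ ℂ, spectralMass f χ * ‖𝔼 i ∈ S, ee (angle χ * v i)‖ ^ 2 := by
  set h : G → ℂ := fun x => 𝔼 i ∈ S, f (x + v i • γ) with hh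
  have h1 : 𝔼 x, ‖h x‖ ^ 2 = 𝔼 x, 𝔼 s : Γ, ‖h (x + s)‖ ^ 2 := by
    rw [Finset.expect_comm]
    simp_rw [expect_add_right (fun x => ‖h x‖ ^ 2)]
    exact (Fintype.expect_const _).symm
  rw [h1]
  simp_rw [spectralMass, Finset.expect_mul]
  rw [← Finset.expect_sum_comm]
  refine Finset.expect_congr rfl fun x _ => ?_
  rw [← sum_normSq_expect_mul]
  refine Finset.sum_congr rfl fun χ _ => ?_
  rw [← mul_pow, ← norm_mul]
  have h2 : 𝔼 s : Γ, h (x + s) * χ s =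
      conj (𝔼 i ∈ S, ee (angle χ * v i)) * 𝔼 s : Γ, f (x + s) * χ s := by
    rw [conj_expect, Finset.expect_mul]
    simp_rw [hh, Finset.expect_mul]
    rw [Finset.expect_comm]
    refine Finset.expect_congr rfl fun i _ => ?_
    have := expect_mul_addChar_add Γ f χ x (v i • gen γ)
    rw [← addChar_zsmul_gen, conj_addChar, ← this]
    refine Finset.expect_congr rfl fun s _ => ?_
    rw [coe_zsmul_gen, add_right_comm]
  rw [h2, norm_mul, norm_mul, RCLike.norm_conj, mul_comm]

lemma sum_spectralMass_le_one {f : G → ℂ} (hf : ∀ x, ‖f x‖ ≤ 1) :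
    ∑ χ : AddChar Γ ℂ, spectralMass f χ ≤ 1 := by
  have h := expect_normSq_expect_zsmul (γ := γ) (univ : Finset Unit) (fun _ => 0) f
  simp only [zero_smul, add_zero, Int.cast_zero, mul_zero, ee_zero, Fintype.expect_const,
    norm_one, one_pow, mul_one] at h
  rw [← h]
  exact expect_le_of_le zero_le_one fun x _ => pow_le_one₀ (norm_nonneg _) (hf x)

/-- Large averages along short quadratic progressions yield large averages along progressions of
a bounded difference. -/
lemma exists_linear_of_quadratic {M I d : ℕ} {X D : ℝ} (hX : 2 ≤ X) (hI : X ^ 160 ≤ I)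
    (hd0 : 0 < d) (hd : (d : ℝ) ≤ D) {f : G → ℂ} (hf : ∀ x, ‖f x‖ ≤ 1)
    (h : 1 / X ≤ 𝔼 y ∈ Icc (1 : ℤ) M, 𝔼 x, ‖𝔼 i ∈ Icc (1 : ℤ) I,
      f (x + (d ^ 2 * i ^ 2 + 2 * d * y * i : ℤ) • γ)‖) :
    ∃ d' : ℕ, 0 < d' ∧ (d' : ℝ) ≤ X ^ 118 * D ^ 2 ∧ ∀ J : ℕ, 0 < J →
      14 * (X ^ 118 * D ^ 2) * J ≤ I ^ 2 →
      1 / (X ^ 124 * D ^ 2) ≤ 𝔼 x, ‖𝔼 i ∈ Icc (1 : ℤ) J, f (x + (d' * i : ℤ) • γ)‖ := by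
  classical
  have hX0 : 0 < X := by linarith
  have hX1 : 1 ≤ X := by linarith
  have hD1 : 1 ≤ D := le_trans (by exact_mod_cast hd0) hd
  have hI0 : (0 : ℝ) < I := lt_of_lt_of_le (by positivity) hI
  set E := X ^ 118 * D ^ 2 with hE
  have hE0 : 0 < E := by positivity
  set W : AddChar Γ ℂ → ℝ := spectralMass f with hW
  have hW0 : ∀ χ, 0 ≤ W χ := spectralMass_nonneg f
  set B : AddChar Γ ℂ → ℤ → ℝ := fun χ y => ‖𝔼 i ∈ Icc (1 : ℤ) I,
    ee (angle χ * (d ^ 2 * i ^ 2 + 2 * d * y * i : ℤ))‖ ^ 2 with hB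
  have hB1 : ∀ χ y, B χ y ≤ 1 := fun χ y => pow_le_one₀ (norm_nonneg _)
    (norm_expect_le_of_le zero_le_one fun i _ => (norm_ee _).le)
  have h1 : 1 / X ^ 2 ≤ ∑ χ : AddChar Γ ℂ, W χ * 𝔼 y ∈ Icc (1 : ℤ) M, B χ y := by
    calc 1 / X ^ 2 = (1 / X) ^ 2 := by rw [div_pow, one_pow]
      _ ≤ (𝔼 y ∈ Icc (1 : ℤ) M, 𝔼 x, ‖𝔼 i ∈ Icc (1 : ℤ) I,
          f (x + (d ^ 2 * i ^ 2 + 2 * d * y * i : ℤ) • γ)‖) ^ 2 := by gcongr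
      _ ≤ 𝔼 y ∈ Icc (1 : ℤ) M, (𝔼 x, ‖𝔼 i ∈ Icc (1 : ℤ) I,
          f (x + (d ^ 2 * i ^ 2 + 2 * d * y * i : ℤ) • γ)‖) ^ 2 := sq_expect_le _ _
      _ ≤ 𝔼 y ∈ Icc (1 : ℤ) M, 𝔼 x, ‖𝔼 i ∈ Icc (1 : ℤ) I,
          f (x + (d ^ 2 * i ^ 2 + 2 * d * y * i : ℤ) • γ)‖ ^ 2 :=
        Finset.expect_le_expect fun y _ => sq_expect_le _ _
      _ = 𝔼 y ∈ Icc (1 : ℤ) M, ∑ χ : AddChar Γ ℂ, W χ * B χ y :=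
        Finset.expect_congr rfl fun y _ => expect_normSq_expect_zsmul _ _ f
      _ = _ := by
        rw [Finset.expect_sum_comm]
        simp_rw [Finset.mul_expect]
  have hmaj : ∀ χ : AddChar Γ ℂ, 1 / X ^ 4 ≤ 𝔼 y ∈ Icc (1 : ℤ) M, B χ y →
      ∃ d' ∈ Icc 1 ⌊E⌋₊, nd (d' * angle χ) ≤ E / I ^ 2 := by
    intro χ hχ
    have hne : (Icc (1 : ℤ) M).Nonempty := by
      by_contra hc
      rw [not_nonempty_iff_eq_empty.1 hc, Finset.expect_empty] at hχ
      have : 0 < 1 / X ^ 4 := by positivity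
      linarith
    obtain ⟨y, -, hy⟩ := Finset.exists_le_of_le_expect hne hχ
    have hy' : 1 / X ^ 2 ≤ ‖𝔼 i ∈ Icc (1 : ℤ) I,
        ee ((angle χ * d ^ 2) * i ^ 2 + (angle χ * (2 * d * y)) * i)‖ := by
      refine le_of_sq_le_sq ?_ (norm_nonneg _)
      calc (1 / X ^ 2) ^ 2 = 1 / X ^ 4 := by rw [div_pow, one_pow, ← pow_mul]
        _ ≤ B χ y := hy
        _ = _ := by
          simp only [hB]
          congr 3
          funext i
          congr 1
          push_cast; ring
    have hI' : (X ^ 2) ^ 80 ≤ (I : ℝ) := by rw [← pow_mul]; exact hI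
    obtain ⟨c, hc0, hc1, hc2, -⟩ :=
      weyl_quadratic (hX.trans (le_self_pow₀ hX1 (by norm_num))) hI' hy'
    rw [← pow_mul] at hc1 hc2
    refine ⟨c * d ^ 2, ?_, ?_⟩
    · rw [mem_Icc]
      refine ⟨Nat.succ_le_of_lt (by positivity), Nat.le_floor ?_⟩
      push_cast
      rw [hE]
      gcongr
      exact hc1.trans (pow_le_pow_right₀ hX1 (by norm_num))
    · have : ((c * d ^ 2 : ℕ) : ℝ) * angle χ = c * (angle χ * d ^ 2) := by push_cast; ring
      rw [this]
      refine hc2.trans ?_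
      rw [hE]
      gcongr
      exact le_mul_of_one_le_right (by positivity) (one_le_pow₀ hD1)
  have h2 : 1 / X ^ 4 ≤ ∑ d' ∈ Icc 1 ⌊E⌋₊,
      ∑ χ : AddChar Γ ℂ, if nd (d' * angle χ) ≤ E / I ^ 2 then W χ else 0 := by
    have e1 : ∀ χ : AddChar Γ ℂ, W χ * 𝔼 y ∈ Icc (1 : ℤ) M, B χ y ≤
        W χ * (1 / X ^ 4) + ∑ d' ∈ Icc 1 ⌊E⌋₊,
          if nd (d' * angle χ) ≤ E / I ^ 2 then W χ else 0 := by
      intro χ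
      have hs : ∀ d' ∈ Icc 1 ⌊E⌋₊, 0 ≤ if nd (d' * angle χ) ≤ E / I ^ 2 then W χ else 0 :=
        fun d' _ => by split_ifs; exacts [hW0 χ, le_rfl]
      by_cases hχ : 1 / X ^ 4 ≤ 𝔼 y ∈ Icc (1 : ℤ) M, B χ y
      · obtain ⟨d', hd', hnd⟩ := hmaj χ hχ
        have e2 := Finset.single_le_sum hs hd'
        rw [if_pos hnd] at e2
        have e3 : W χ * 𝔼 y ∈ Icc (1 : ℤ) M, B χ y ≤ W χ :=
          mul_le_of_le_one_right (hW0 χ) (expect_le_of_le zero_le_one fun y _ => hB1 χ y)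
        have e4 : 0 ≤ W χ * (1 / X ^ 4) := mul_nonneg (hW0 χ) (by positivity)
        linarith
      · have e2 := Finset.sum_nonneg hs
        have e3 : W χ * 𝔼 y ∈ Icc (1 : ℤ) M, B χ y ≤ W χ * (1 / X ^ 4) :=
          mul_le_mul_of_nonneg_left (not_le.1 hχ).le (hW0 χ)
        linarith
    have e2 := h1.trans (Finset.sum_le_sum fun χ _ => e1 χ)
    rw [Finset.sum_add_distrib, ← Finset.sum_mul, Finset.sum_comm] at e2
    have e3 : (∑ χ : AddChar Γ ℂ, W χ) * (1 / X ^ 4) ≤ 1 / X ^ 4 :=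
      mul_le_of_le_one_left (by positivity) (sum_spectralMass_le_one hf)
    have e4 : 1 / X ^ 4 + 1 / X ^ 4 ≤ 1 / X ^ 2 := by
      rw [← add_div, div_le_div_iff₀ (by positivity) (by positivity)]
      have : X ^ 4 = X ^ 2 * X ^ 2 := by ring
      rw [this]
      have : 2 ≤ X ^ 2 := by nlinarith
      nlinarith [sq_nonneg X]
    linarith
  obtain ⟨d', hd', h3⟩ : ∃ d' ∈ Icc 1 ⌊E⌋₊, 1 / (X ^ 4 * E) ≤
      ∑ χ : AddChar Γ ℂ, if nd (d' * angle χ) ≤ E / I ^ 2 then W χ else 0 := by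
    refine exists_le_of_sum_le ?_ (le_trans ?_ h2)
    · by_contra hc
      rw [not_nonempty_iff_eq_empty.1 hc, Finset.sum_empty] at h2
      have : 0 < 1 / X ^ 4 := by positivity
      linarith
    · rw [Finset.sum_const, nsmul_eq_mul, Nat.card_Icc, Nat.add_sub_cancel]
      calc (⌊E⌋₊ : ℝ) * (1 / (X ^ 4 * E)) ≤ E * (1 / (X ^ 4 * E)) := by
            gcongr; exact Nat.floor_le hE0.le
        _ = 1 / X ^ 4 := by field_simp
  rw [mem_Icc] at hd'
  refine ⟨d', hd'.1, (Nat.cast_le.2 hd'.2).trans (Nat.floor_le hE0.le), fun J hJ hJI => ?_⟩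
  have hJn : (Icc (1 : ℤ) J).Nonempty := Icc_one_nonempty hJ
  have h4 : 𝔼 x, ‖𝔼 i ∈ Icc (1 : ℤ) J, f (x + (d' * i : ℤ) • γ)‖ ^ 2 ≤
      𝔼 x, ‖𝔼 i ∈ Icc (1 : ℤ) J, f (x + (d' * i : ℤ) • γ)‖ :=
    Finset.expect_le_expect fun x _ => pow_le_of_le_one (norm_nonneg _)
      (norm_expect_le_of_le zero_le_one fun i _ => hf _) (by norm_num)
  refine le_trans ?_ h4
  rw [expect_normSq_expect_zsmul]
  have h5 : ∀ χ : AddChar Γ ℂ, (if nd (d' * angle χ) ≤ E / I ^ 2 then W χ else 0) * (1 / 4) ≤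
      W χ * ‖𝔼 i ∈ Icc (1 : ℤ) J, ee (angle χ * (d' * i : ℤ))‖ ^ 2 := by
    intro χ
    split_ifs with hχ
    swap
    · rw [zero_mul]; exact mul_nonneg (hW0 χ) (by positivity)
    refine mul_le_mul_of_nonneg_left ?_ (hW0 χ)
    have e1 : ‖(1 : ℂ) - 𝔼 i ∈ Icc (1 : ℤ) J, ee (angle χ * (d' * i : ℤ))‖ ≤ 1 / 2 := by
      rw [← Finset.expect_const hJn (1 : ℂ), norm_sub_rev]
      refine norm_expect_sub_le (by norm_num) fun i hi => ?_
      have e2 := norm_ee_add_mul_sub_le (angle χ) d' 0 i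
      simp only [Int.cast_zero, zero_add, mul_zero, ee_zero] at e2
      push_cast
      refine e2.trans ?_
      have hi' := mem_Icc_cast hi
      have hi0 : (0 : ℝ) ≤ i := by exact_mod_cast hi'.1
      rw [abs_of_nonneg hi0]
      calc 7 * (nd (d' * angle χ) * i) ≤ 7 * (E / I ^ 2 * J) := by
            gcongr
            exact hi'.2
        _ = 14 * E * J / I ^ 2 / 2 := by ring
        _ ≤ 1 / 2 := by
          gcongr
          rw [div_le_one (by positivity)]
          exact hJI
    have e3 := norm_le_of_norm_sub_le e1
    rw [norm_one] at e3
    have e4 : (1 : ℝ) / 2 ≤ ‖𝔼 i ∈ Icc (1 : ℤ) J, ee (angle χ * (d' * i : ℤ))‖ := by linarith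
    nlinarith
  refine le_trans ?_ (Finset.sum_le_sum fun χ _ => h5 χ)
  rw [← Finset.sum_mul]
  refine le_trans ?_ (mul_le_mul_of_nonneg_right h3 (by norm_num))
  rw [div_mul_div_comm, one_mul]
  refine one_div_le_one_div_of_le (by positivity) ?_
  calc X ^ 4 * E * 4 = 4 * (X ^ 122 * D ^ 2) := by rw [hE]; ring
    _ ≤ X ^ 2 * (X ^ 122 * D ^ 2) := by gcongr; nlinarith
    _ = X ^ 124 * D ^ 2 := by ring

end Spectrum

section Inverse

/-- A large count persists when the quadratic function is replaced by a function that transforms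
along cosets by characters with frequencies near rationals of a common small denominator. -/
theorem exists_major_phase_of_Lam : ∃ K : ℕ, ∀ (G : Type) [AddCommGroup G] [Fintype G] (e γ : G)
    [Fintype (AddSubgroup.zmultiples γ)] (M : ℕ) (X : ℝ) (f₀ f₁ f₂ : G → ℂ), 2 ≤ X → X ^ K ≤ M →
    OrderScale γ M → (∀ x, ‖f₀ x‖ ≤ 1) → (∀ x, ‖f₁ x‖ ≤ 1) → (∀ x, ‖f₂ x‖ ≤ 1) →
    1 / X ≤ ‖Lam e γ M f₀ f₁ f₂‖ →
    ∃ (d : ℕ) (χ : G → AddChar (AddSubgroup.zmultiples γ) ℂ) (Q : G → ℂ),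
      0 < d ∧ (d : ℝ) ≤ X ^ K ∧ (∀ x, ‖Q x‖ ≤ 1) ∧
      (∀ x (s : AddSubgroup.zmultiples γ), χ (x + s) = χ x) ∧
      (∀ x (s : AddSubgroup.zmultiples γ), Q (x + s) = Q x * χ x s) ∧
      (∀ x, Q x ≠ 0 → nd (d * angle (χ x)) ≤ X ^ K / M ^ 2) ∧
      1 / X ^ K ≤ ‖Lam e γ M f₀ f₁ Q‖ := by
  obtain ⟨K, hK⟩ := exists_phase_of_Lam
  obtain ⟨a, ha⟩ : ∃ a : ℕ, a = 2482 := ⟨_, rfl⟩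
  refine ⟨(K + 1) * a, fun G _ _ e γ _ M X f₀ f₁ f₂ hX hM hR h₀ h₁ h₂ hL => ?_⟩
  have hX0 : 0 < X := by linarith
  have hX1 : 1 ≤ X := by linarith
  have ha1 : 1 ≤ a := by omega
  have ha2 : 2200 ≤ a := by omega
  obtain ⟨χ, P, hχ, hP1, hP, h⟩ := hK G e γ M X f₀ f₁ f₂ hX
    ((pow_le_pow_right₀ hX1 (by nlinarith)).trans hM) hR h₀ h₁ h₂ hL
  obtain ⟨Y, hY⟩ : ∃ Y : ℝ, Y = X ^ (K + 1) := ⟨_, rfl⟩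
  have hY2 : 2 ≤ Y := by rw [hY]; exact hX.trans (le_self_pow₀ hX1 (by omega))
  have hY1 : 1 ≤ Y := by linarith
  have h' : 1 / Y ≤ ‖Lam e γ M f₀ f₁ P‖ := by
    refine le_trans (one_div_le_one_div_of_le (by positivity) ?_) h
    rw [hY]
    exact pow_le_pow_right₀ hX1 (by omega)
  rw [pow_mul, ← hY] at hM ⊢
  have hM' : Y ^ 2200 ≤ M := (pow_le_pow_right₀ hY1 ha2).trans hM
  obtain ⟨d, Q, h1, h2, h3, h4, h5, h6⟩ :=
    exists_phase_restrict e hY2 hM' h₀ h₁ hP1 χ hχ hP h'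
  have hle : Y ^ 2480 ≤ Y ^ a := pow_le_pow_right₀ hY1 (by omega)
  refine ⟨d, χ, Q, h1, h2.trans hle, h3, hχ, h4, fun x hx => (h5 x hx).trans (by gcongr), ?_⟩
  rw [ha]
  exact h6

lemma sub_half_le {X δ ε L : ℝ} (hX : 2 ≤ X) {k : ℕ} (h : 1 / X ^ k ≤ L + ε)
    (hε : ε ≤ 1 / (2 * X ^ k)) (hδ : δ = 1 / X ^ (k + 1)) : δ ≤ L := by
  have hX0 : 0 < X := by linarith
  have h1 : δ ≤ 1 / (2 * X ^ k) := by
    rw [hδ]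
    refine one_div_le_one_div_of_le (by positivity) ?_
    rw [pow_succ, mul_comm]
    gcongr
  have h2 : 1 / X ^ k = 1 / (2 * X ^ k) + 1 / (2 * X ^ k) := by field_simp; norm_num
  linarith

lemma exists_unimodular_mul (z : ℂ) : ∃ b : ℂ, ‖b‖ ≤ 1 ∧ b * z = ‖z‖ := by
  by_cases hz : z = 0
  · exact ⟨0, by simp, by simp [hz]⟩
  · have h : (‖z‖ : ℂ) ≠ 0 := by simpa using hz
    refine ⟨conj z / ‖z‖, ?_, ?_⟩
    · rw [norm_div, RCLike.norm_conj, Complex.norm_real, norm_norm, div_self (by simpa using hz)]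
    · rw [div_mul_eq_mul_div, mul_comm, Complex.mul_conj, Complex.normSq_eq_norm_sq]
      field_simp
      push_cast; ring

variable {G : Type*} [AddCommGroup G] [Fintype G]

/-- The dual function in the second variable. -/
noncomputable def dualMid (e γ : G) (M : ℕ) (f₀ f₂ : G → ℂ) (x : G) : ℂ :=
  𝔼 y ∈ Icc (1 : ℤ) M, f₀ (x - y • e) * f₂ (x - y • e + (y ^ 2) • γ)

lemma norm_dualMid_le (e γ : G) (M : ℕ) {f₀ f₂ : G → ℂ} (h₀ : ∀ x, ‖f₀ x‖ ≤ 1)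
    (h₂ : ∀ x, ‖f₂ x‖ ≤ 1) (x : G) : ‖dualMid e γ M f₀ f₂ x‖ ≤ 1 :=
  norm_expect_le_of_le zero_le_one fun _ _ => norm_mul_le_one (h₀ _) (h₂ _)

lemma Lam_eq_expect_dualMid (e γ : G) (M : ℕ) (f₀ f₁ f₂ : G → ℂ) :
    Lam e γ M f₀ f₁ f₂ = 𝔼 x, dualMid e γ M f₀ f₂ x * f₁ x := by
  simp_rw [Lam, dualMid, Finset.expect_mul]
  rw [Finset.expect_comm, Finset.expect_comm (s := univ)]
  refine Finset.expect_congr rfl fun y _ => ?_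
  symm
  rw [← expect_add_right _ (y • e)]
  refine Finset.expect_congr rfl fun x _ => ?_
  rw [add_sub_cancel_right]
  ring

lemma normSq_Lam_le_dualMid (e γ : G) (M : ℕ) (f₀ f₂ : G → ℂ) {f₁ : G → ℂ}
    (h₁ : ∀ x, ‖f₁ x‖ ≤ 1) :
    ‖Lam e γ M f₀ f₁ f₂‖ ^ 2 ≤ ‖Lam e γ M f₀ (fun x => conj (dualMid e γ M f₀ f₂ x)) f₂‖ := by
  rw [Lam_eq_expect_dualMid, Lam_eq_expect_dualMid]
  simp_rw [mul_comm _ (f₁ _)]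
  refine (normSq_expect_mul_le _ _ _ fun x _ => h₁ x).trans (le_of_eq ?_)
  simp_rw [Complex.mul_conj, Complex.normSq_eq_norm_sq]
  rw [← ofReal_expect, Complex.norm_real, Real.norm_of_nonneg]
  exact Finset.expect_nonneg fun _ _ => by positivity

/-- Averages of the dual function along progressions are counts with an almost periodic
function. -/
lemma exists_almost_periodic (e γ : G) {M J d : ℕ} (f₀ f₂ : G → ℂ) :
    ∃ φ : G → ℂ, (∀ x, ‖φ x‖ ≤ 1) ∧
      (∀ x (i : ℤ), 0 ≤ i → ‖φ (x + (d * i : ℤ) • e) - φ x‖ ≤ 2 * i / J) ∧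
      𝔼 x, ‖𝔼 j ∈ Icc (1 : ℤ) J, conj (dualMid e γ M f₀ f₂ (x + (d * j : ℤ) • e))‖ =
        ‖Lam e γ M f₀ φ f₂‖ := by
  set F := dualMid e γ M f₀ f₂ with hF
  choose b hb1 hb using fun x => exists_unimodular_mul (𝔼 j ∈ Icc (1 : ℤ) J, F (x + (d * j : ℤ) • e))
  refine ⟨fun x => 𝔼 j ∈ Icc (1 : ℤ) J, b (x - (d * j : ℤ) • e), fun x =>
    norm_expect_le_of_le zero_le_one fun j _ => hb1 _, fun x i hi => ?_, ?_⟩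
  · have h := expect_Icc_shift_le J (fun j => b (x + (d * i : ℤ) • e - (d * j : ℤ) • e))
      (fun j => hb1 _) i hi
    rw [norm_sub_rev] at h
    refine le_trans (le_of_eq ?_) h
    congr 2
    refine Finset.expect_congr rfl fun j _ => ?_
    congr 1
    module
  · have h1 : Lam e γ M f₀ (fun x => 𝔼 j ∈ Icc (1 : ℤ) J, b (x - (d * j : ℤ) • e)) f₂ =
        ((𝔼 x, ‖𝔼 j ∈ Icc (1 : ℤ) J, F (x + (d * j : ℤ) • e)‖ : ℝ) : ℂ) := by
      rw [Lam_eq_expect_dualMid, ofReal_expect]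
      simp_rw [← hb, Finset.mul_expect]
      rw [Finset.expect_comm, Finset.expect_comm (s := univ)]
      refine Finset.expect_congr rfl fun j _ => ?_
      rw [← expect_add_right _ ((d * j : ℤ) • e)]
      refine Finset.expect_congr rfl fun x _ => ?_
      rw [add_sub_cancel_right, mul_comm]
    rw [h1, Complex.norm_real, Real.norm_of_nonneg (Finset.expect_nonneg fun _ _ => norm_nonneg _)]
    simp_rw [← conj_expect, RCLike.norm_conj]

end Inverse

section InverseTheorem

/-- `f` has large averages along progressions of length `I` whose difference is a bounded multiple
of `γ`. -/
def HasLocalAverage {G : Type*} [AddCommGroup G] [Fintype G] (γ : G) (I : ℕ) (B : ℝ)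
    (f : G → ℂ) : Prop :=
  ∃ d : ℕ, 0 < d ∧ (d : ℝ) ≤ B ∧ 1 / B ≤ 𝔼 x, ‖𝔼 i ∈ Icc (1 : ℤ) I, f (x + (d * i : ℤ) • γ)‖

lemma HasLocalAverage.mono {G : Type*} [AddCommGroup G] [Fintype G] {γ : G} {I : ℕ} {B B' : ℝ}
    {f : G → ℂ} (h : HasLocalAverage γ I B f) (hB : B ≤ B') : HasLocalAverage γ I B' f := by
  obtain ⟨d, h1, h2, h3⟩ := h
  have : 0 < B := lt_of_lt_of_le (by exact_mod_cast h1) h2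
  exact ⟨d, h1, h2.trans hB, (one_div_le_one_div_of_le this hB).trans h3⟩

theorem hasLocalAverage_const_linear : ∃ K : ℕ, ∀ (G : Type) [AddCommGroup G] [Fintype G] (e γ : G)
    (q M I : ℕ) (X : ℝ) (f₀ f₁ f₂ : G → ℂ), γ = q • e → 0 < q → 2 ≤ X → 0 < I →
    X ^ K * (q * I) ≤ M → OrderScale γ M →
    (∀ x, ‖f₀ x‖ ≤ 1) → (∀ x, ‖f₁ x‖ ≤ 1) → (∀ x, ‖f₂ x‖ ≤ 1) →
    1 / X ≤ ‖Lam e γ M f₀ f₁ f₂‖ →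
    HasLocalAverage γ I (X ^ K) f₀ ∧ HasLocalAverage γ I (X ^ K) f₁ := by
  classical
  obtain ⟨K, hK⟩ := exists_major_phase_of_Lam
  refine ⟨2 * K + 6, fun G _ _ e γ q M I X f₀ f₁ f₂ hγ hq hX hI hM hR h₀ h₁ h₂ hL => ?_⟩
  have hX0 : 0 < X := by linarith
  have hX1 : 1 ≤ X := by linarith
  have hq1 : (1 : ℝ) ≤ q := by exact_mod_cast hq
  have hI1 : (1 : ℝ) ≤ I := by exact_mod_cast hI
  have hqI : (1 : ℝ) ≤ q * I := one_le_mul_of_one_le_of_one_le hq1 hI1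
  have hXM : X ^ (2 * K + 6) ≤ M := (le_mul_of_one_le_right (by positivity) hqI).trans hM
  have hM0 : (0 : ℝ) < M := lt_of_lt_of_le (by positivity) hXM
  have hM0' : 0 < M := by exact_mod_cast hM0
  obtain ⟨d, χ, Q, hd0, hd, hQ1, hχ, hQ, hnd, h⟩ := hK G e γ M X f₀ f₁ f₂ hX
    ((pow_le_pow_right₀ hX1 (by omega)).trans hXM) hR h₀ h₁ h₂ hL
  obtain ⟨D, hD⟩ : ∃ D : ℝ, D = X ^ K := ⟨_, rfl⟩
  have hD0 : 0 < D := by rw [hD]; positivity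
  have hD1 : 1 ≤ D := by rw [hD]; exact one_le_pow₀ hX1
  rw [← hD] at hd hnd
  rw [Lam_eq_phase e M _ _ _ χ hQ] at h
  have hDM : 64 * D ^ 2 * (q * I) ≤ M := by
    refine le_trans ?_ hM
    have h6 := two_pow_le_pow hX 6
    norm_num at h6
    calc 64 * D ^ 2 * (q * I) ≤ X ^ 6 * D ^ 2 * (q * I) := by gcongr
      _ = X ^ (2 * K + 6) * (q * I) := by rw [hD]; ring
  have hDI : D * (q * I) ≤ M := by
    refine le_trans ?_ hDM
    gcongr
    nlinarith
  have herr : ∀ c : ℝ, 0 ≤ c → c ≤ 30 → c * D * (q * I) / M ≤ 1 / (2 * X ^ K) := by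
    intro c hc0 hc
    rw [← hD, div_le_div_iff₀ hM0 (by positivity)]
    calc c * D * (q * I) * (2 * D) ≤ 30 * D * (q * I) * (2 * D) := by gcongr
      _ = 60 * D ^ 2 * (q * I) := by ring
      _ ≤ 64 * D ^ 2 * (q * I) := by gcongr; norm_num
      _ ≤ 1 * M := by rw [one_mul]; exact hDM
  have hB : X ^ (K + 1) ≤ X ^ (2 * K + 6) := pow_le_pow_right₀ hX1 (by omega)
  have hdB : (d : ℝ) ≤ X ^ (K + 1) := by
    rw [hD] at hd
    exact hd.trans (pow_le_pow_right₀ hX1 (by omega))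
  constructor
  · refine HasLocalAverage.mono ⟨d, hd0, hdB, ?_⟩ hB
    refine sub_half_le hX (h.trans (norm_expect_phase_le_const e γ hq hγ hM0' hI hd hDI h₀ h₁ hQ1 _
      (fun x n => ?_) (fun x n => ?_) hnd)) (herr 30 (by norm_num) le_rfl) rfl
    · rw [← coe_zsmul_gen, hχ]
    · rw [← coe_zsmul_gen, hQ, addChar_zsmul_gen]
  · refine HasLocalAverage.mono ⟨d, hd0, hdB, ?_⟩ hB
    have h1 := norm_expect_phase_le_linear e (J := I) (d := d * q) (D := D * q) hM0' hI
      (by push_cast; gcongr) (by rw [mul_assoc]; exact hDI)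
      (fun x => norm_mul_le_one (h₀ x) (hQ1 x)) h₁ (fun x => angle (χ x)) (fun x hx => by
        have e1 := hnd x (right_ne_zero_of_mul hx)
        have e2 : ((d * q : ℕ) : ℝ) * angle (χ x) = q * (d * angle (χ x)) := by push_cast; ring
        rw [e2]
        refine (nd_natCast_mul_le _ _).trans ?_
        calc (q : ℝ) * nd (d * angle (χ x)) ≤ q * (D / M ^ 2) := by gcongr
          _ = D * q / M ^ 2 := by ring)
    have h2 : ∀ (x : G) (i : ℤ), x + (((d * q : ℕ) : ℤ) * i) • e = x + (d * i : ℤ) • γ := by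
      intro x i
      rw [hγ]
      push_cast
      module
    simp only [h2] at h1
    refine sub_half_le hX (h.trans h1) (le_trans (le_of_eq ?_)
      (herr 23 (by norm_num) (by norm_num))) rfl
    ring

theorem hasLocalAverage_quadratic : ∃ K : ℕ, ∀ (G : Type) [AddCommGroup G] [Fintype G] (e γ : G)
    (M I : ℕ) (X : ℝ) (f₀ f₁ f₂ : G → ℂ), 2 ≤ X → 0 < I →
    X ^ K * I ≤ M → OrderScale γ M →
    (∀ x, ‖f₀ x‖ ≤ 1) → (∀ x, ‖f₁ x‖ ≤ 1) → (∀ x, ‖f₂ x‖ ≤ 1) →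
    1 / X ≤ ‖Lam e γ M f₀ f₁ f₂‖ → HasLocalAverage γ I (X ^ K) f₂ := by
  classical
  obtain ⟨K, hK⟩ := exists_major_phase_of_Lam
  obtain ⟨a, ha⟩ : ∃ a : ℕ, a = 400 * (K + 1) := ⟨_, rfl⟩
  refine ⟨a, fun G _ _ e γ M I X f₀ f₁ f₂ hX hI hM hR h₀ h₁ h₂ hL => ?_⟩
  have hX0 : 0 < X := by linarith
  have hX1 : 1 ≤ X := by linarith
  have hI1 : (1 : ℝ) ≤ I := by exact_mod_cast hI
  have hXM : X ^ a ≤ M := (le_mul_of_one_le_right (by positivity) hI1).trans hM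
  have hM0 : (0 : ℝ) < M := lt_of_lt_of_le (by positivity) hXM
  have hM0' : 0 < M := by exact_mod_cast hM0
  have hpow : ∀ n, n ≤ a → X ^ n ≤ M := fun n hn => (pow_le_pow_right₀ hX1 hn).trans hXM
  have hL' : 1 / X ^ 2 ≤ ‖Lam e γ M f₀ (fun x => conj (dualMid e γ M f₀ f₂ x)) f₂‖ := by
    refine le_trans ?_ (normSq_Lam_le_dualMid e γ M f₀ f₂ h₁)
    calc 1 / X ^ 2 = (1 / X) ^ 2 := by rw [div_pow, one_pow]
      _ ≤ _ := by gcongr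
  have hF1 : ∀ x, ‖conj (dualMid e γ M f₀ f₂ x)‖ ≤ 1 := fun x => by
    rw [RCLike.norm_conj]; exact norm_dualMid_le e γ M h₀ h₂ x
  obtain ⟨d, χ, Q, hd0, hd, hQ1, hχ, hQ, hnd, h⟩ := hK G e γ M (X ^ 2) f₀ _ f₂
    (hX.trans (le_self_pow₀ hX1 (by norm_num)))
    (by rw [← pow_mul]; exact hpow _ (by omega)) hR h₀ hF1 h₂ hL'
  rw [Lam_eq_phase e M _ _ _ χ hQ] at h
  rw [← pow_mul] at h hd hnd
  have h64 := two_pow_le_pow hX 6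
  have h16 := two_pow_le_pow hX 4
  norm_num at h64 h16
  -- averages of the dual function
  obtain ⟨J, hJ0, hJ1, hJ2⟩ := exists_scale hX (M := M) (k := 4 * K + 6) (hpow _ (by omega))
  have hJ0' : (0 : ℝ) < J := by exact_mod_cast hJ0
  have hDJ : X ^ (2 * K) * J ≤ M := by
    refine le_trans ?_ hJ1
    rw [mul_comm]
    gcongr
    omega
  have h1 := norm_expect_phase_le_linear e hM0' hJ0 hd hDJ
    (fun x => norm_mul_le_one (h₀ x) (hQ1 x)) hF1 _ (fun x hx => hnd x (right_ne_zero_of_mul hx))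
  have h2 := sub_half_le hX (h.trans h1) (by
    rw [div_le_div_iff₀ hM0 (by positivity)]
    calc 23 * X ^ (2 * K) * J * (2 * X ^ (2 * K)) = 46 * (J * X ^ (4 * K)) := by ring
      _ ≤ X ^ 6 * (J * X ^ (4 * K)) := by gcongr; linarith
      _ = J * X ^ (4 * K + 6) := by ring
      _ ≤ 1 * M := by rw [one_mul]; exact hJ1) rfl
  obtain ⟨φ, hφ1, hφ, hφL⟩ := exists_almost_periodic e γ (M := M) (J := J) (d := d) f₀ f₂
  rw [hφL] at h2
  -- short quadratic progressions
  have hJpow : X ^ (a - (4 * K + 7)) ≤ J := by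
    have : X ^ (a - (4 * K + 7)) * X ^ (4 * K + 7) ≤ J * X ^ (4 * K + 7) := by
      rw [← pow_add, Nat.sub_add_cancel (by omega)]
      exact hXM.trans hJ2
    exact le_of_mul_le_mul_right this (by positivity)
  obtain ⟨H, hH0, hH1, hH2⟩ := exists_scale hX (M := J) (k := 2 * K + 5)
    ((pow_le_pow_right₀ hX1 (by omega)).trans hJpow)
  have hH0' : (0 : ℝ) < H := by exact_mod_cast hH0
  have h3 := norm_Lam_le_of_almost_periodic e γ (M := M) (I := H) (d := d) hH0
    (η := 2 * H / J) h₀ hφ1 h₂ (fun x i hi => by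
      have := mem_Icc_cast hi
      refine (hφ x i this.1).trans ?_
      gcongr
      exact this.2)
  have h4 := sub_half_le hX (h2.trans h3) (by
    have e1 : 2 * (d * H) / M ≤ 2 * (H : ℝ) / J := by
      rw [div_le_div_iff₀ hM0 hJ0']
      have : (d : ℝ) * J ≤ M := (mul_le_mul_of_nonneg_right hd hJ0'.le).trans hDJ
      nlinarith
    have e2 : 2 * (H : ℝ) / J + 2 * H / J ≤ 1 / (2 * X ^ (2 * K + 1)) := by
      rw [← add_div, div_le_div_iff₀ hJ0' (by positivity)]
      calc (2 * (H : ℝ) + 2 * H) * (2 * X ^ (2 * K + 1)) = 8 * (H * X ^ (2 * K + 1)) := by ring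
        _ ≤ X ^ 4 * (H * X ^ (2 * K + 1)) := by gcongr; linarith
        _ = H * X ^ (2 * K + 5) := by ring
        _ ≤ 1 * J := by rw [one_mul]; exact hH1
    linarith) rfl
  have hHpow : M ≤ H * X ^ (6 * K + 13) := by
    calc (M : ℝ) ≤ J * X ^ (4 * K + 7) := hJ2
      _ ≤ (H * X ^ (2 * K + 5 + 1)) * X ^ (4 * K + 7) := by gcongr
      _ = H * X ^ (6 * K + 13) := by ring
  obtain ⟨Z, hZ⟩ : ∃ Z : ℝ, Z = X ^ (2 * K + 1 + 1) := ⟨_, rfl⟩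
  rw [← hZ] at h4
  have hZ2 : 2 ≤ Z := by rw [hZ]; exact hX.trans (le_self_pow₀ hX1 (by omega))
  have hZH : Z ^ 160 ≤ H := by
    have : Z ^ 160 * X ^ (6 * K + 13) ≤ H * X ^ (6 * K + 13) := by
      refine le_trans ?_ hHpow
      rw [hZ, ← pow_mul, ← pow_add]
      exact hpow _ (by omega)
    exact le_of_mul_le_mul_right this (by positivity)
  obtain ⟨d', hd'0, hd', h5⟩ := exists_linear_of_quadratic hZ2 hZH hd0 hd h₂ h4
  have hc : ∀ n : ℕ, n ≤ 124 → Z ^ n * (X ^ (2 * K)) ^ 2 ≤ X ^ a := by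
    intro n hn
    rw [hZ, ← pow_mul, ← pow_mul, ← pow_add]
    refine pow_le_pow_right₀ hX1 ?_
    nlinarith
  refine ⟨d', hd'0, hd'.trans (hc _ (by norm_num)), le_trans ?_ (h5 I hI ?_)⟩
  · have : 0 < Z := by linarith
    exact one_div_le_one_div_of_le (by positivity) (hc _ (by norm_num))
  · have hH1' : (1 : ℝ) ≤ H := by exact_mod_cast hH0
    have e1 : 14 * (Z ^ 118 * (X ^ (2 * K)) ^ 2) * I * X ^ (6 * K + 13) ≤ H * X ^ (6 * K + 13) := by
      refine le_trans ?_ hHpow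
      refine le_trans ?_ hM
      calc 14 * (Z ^ 118 * (X ^ (2 * K)) ^ 2) * I * X ^ (6 * K + 13) ≤
          X ^ 4 * (Z ^ 118 * (X ^ (2 * K)) ^ 2) * I * X ^ (6 * K + 13) := by
            have : 0 < Z := by linarith
            gcongr
            linarith
        _ = X ^ (4 + (2 * K + 1 + 1) * 118 + 2 * K * 2 + (6 * K + 13)) * I := by
            rw [hZ, ← pow_mul, ← pow_mul]
            simp only [pow_add]
            ring
        _ ≤ _ := by
            gcongr
            omega
    have e2 := le_of_mul_le_mul_right e1 (by positivity)
    nlinarith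

/-- The inverse theorem for the count: each of the three functions has large averages along
progressions of bounded multiples of `γ`. -/
theorem hasLocalAverage_of_Lam : ∃ K : ℕ, ∀ (G : Type) [AddCommGroup G] [Fintype G] (e γ : G)
    (q M I : ℕ) (X : ℝ) (f₀ f₁ f₂ : G → ℂ), γ = q • e → 0 < q → 2 ≤ X → 0 < I →
    X ^ K * (q * I) ≤ M → OrderScale γ M →
    (∀ x, ‖f₀ x‖ ≤ 1) → (∀ x, ‖f₁ x‖ ≤ 1) → (∀ x, ‖f₂ x‖ ≤ 1) →
    1 / X ≤ ‖Lam e γ M f₀ f₁ f₂‖ →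
    HasLocalAverage γ I (X ^ K) f₀ ∧ HasLocalAverage γ I (X ^ K) f₁ ∧
      HasLocalAverage γ I (X ^ K) f₂ := by
  obtain ⟨K, hK⟩ := hasLocalAverage_const_linear
  obtain ⟨L, hL⟩ := hasLocalAverage_quadratic
  refine ⟨K + L, fun G _ _ e γ q M I X f₀ f₁ f₂ hγ hq hX hI hM hR h₀ h₁ h₂ h => ?_⟩
  have hX1 : 1 ≤ X := by linarith
  have hq1 : (1 : ℝ) ≤ q := by exact_mod_cast hq
  have hKp : X ^ K ≤ X ^ (K + L) := pow_le_pow_right₀ hX1 (by omega)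
  have hLp : X ^ L ≤ X ^ (K + L) := pow_le_pow_right₀ hX1 (by omega)
  obtain ⟨a, b⟩ := hK G e γ q M I X f₀ f₁ f₂ hγ hq hX hI
    (le_trans (by gcongr) hM) hR h₀ h₁ h₂ h
  refine ⟨a.mono hKp, b.mono hKp, (hL G e γ M I X f₀ f₁ f₂ hX hI (le_trans ?_ hM) hR h₀ h₁ h₂
    h).mono hLp⟩
  have : (I : ℝ) ≤ q * I := le_mul_of_one_le_left (by positivity) hq1
  gcongr

end InverseTheorem

section Factors
variable {N : ℕ}

/-- The factor of `[N]` whose parts are the fibres of `k`. -/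
noncomputable def fiberFactor (N : ℕ) {α : Type*} (k : ℤ → α) :
    Finpartition (Icc (1 : ℤ) (N : ℤ)) :=
  open Classical in Finpartition.ofSetSetoid (Setoid.ker k) (Icc (1 : ℤ) (N : ℤ))

lemma samePart_fiberFactor {α : Type*} (k : ℤ → α) {x y : ℤ} (hx : x ∈ Icc (1 : ℤ) (N : ℤ))
    (hy : y ∈ Icc (1 : ℤ) (N : ℤ)) : SamePart (fiberFactor N k) x y ↔ k x = k y := by
  classical
  rw [SamePart, fiberFactor, ← Finpartition.mem_part_iff_exists,
    Finpartition.mem_part_ofSetSetoid_iff_rel]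
  rw [Setoid.ker_def]
  exact ⟨fun h => h.2.2.symm, fun h => ⟨hy, hx, h.symm⟩⟩

lemma samePart_iff_part_eq {𝓑 : Finpartition (Icc (1 : ℤ) (N : ℤ))} {x y : ℤ}
    (hx : x ∈ Icc (1 : ℤ) (N : ℤ)) (hy : y ∈ Icc (1 : ℤ) (N : ℤ)) :
    SamePart 𝓑 x y ↔ 𝓑.part x = 𝓑.part y := by
  rw [SamePart, ← Finpartition.mem_part_iff_exists, Finpartition.mem_part_iff_part_eq_part _ hx hy]

lemma exists_isSimpleLocalFactor (N : ℕ) {R : ℝ} (hR : 0 < R) {m : ℕ} (hm : 0 < m) (r : ℝ) :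
    ∃ 𝓢 : Finpartition (Icc (1 : ℤ) (N : ℤ)), IsSimpleLocalFactor 𝓢 R m ∧
      ∀ x ∈ Icc (1 : ℤ) (N : ℤ), ∀ y ∈ Icc (1 : ℤ) (N : ℤ), (SamePart 𝓢 x y ↔
        (⌊((x : ℝ) - r) / R⌋ = ⌊((y : ℝ) - r) / R⌋ ∧ x % (m : ℤ) = y % (m : ℤ))) := by
  have h : ∀ x ∈ Icc (1 : ℤ) (N : ℤ), ∀ y ∈ Icc (1 : ℤ) (N : ℤ),
      (SamePart (fiberFactor N fun x : ℤ => (⌊((x : ℝ) - r) / R⌋, x % (m : ℤ))) x y ↔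
        (⌊((x : ℝ) - r) / R⌋ = ⌊((y : ℝ) - r) / R⌋ ∧ x % (m : ℤ) = y % (m : ℤ))) := by
    intro x hx y hy
    rw [samePart_fiberFactor _ hx hy, Prod.mk.injEq]
  exact ⟨_, ⟨hR, hm, r, fun x y hx hy => h x hx y hy⟩, h⟩

lemma isLocalFactor_one {𝓢 : Finpartition (Icc (1 : ℤ) (N : ℤ))} {R : ℝ} {m : ℕ}
    (h : IsSimpleLocalFactor 𝓢 R m) : IsLocalFactor 𝓢 1 R m :=
  ⟨fun _ => R, fun _ => m, fun _ => 𝓢, fun _ => h, fun _ => le_rfl, by simp, fun x y _ _ => by simp⟩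

/-- The join of a local factor and a simple local factor. -/
lemma exists_join {𝓑 𝓢 : Finpartition (Icc (1 : ℤ) (N : ℤ))} {d m m' : ℕ} {R R' : ℝ}
    (hB : IsLocalFactor 𝓑 d R m) (hS : IsSimpleLocalFactor 𝓢 R' m') (hR : R ≤ R') :
    ∃ 𝓑' : Finpartition (Icc (1 : ℤ) (N : ℤ)), IsLocalFactor 𝓑' (d + 1) R (Nat.lcm m' m) ∧
      ∀ x ∈ Icc (1 : ℤ) (N : ℤ), ∀ y ∈ Icc (1 : ℤ) (N : ℤ), (SamePart 𝓑' x y ↔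
        SamePart 𝓢 x y ∧ SamePart 𝓑 x y) := by
  obtain ⟨Ms, qs, Bs, h1, h2, h3, h4⟩ := hB
  have key : ∀ x ∈ Icc (1 : ℤ) (N : ℤ), ∀ y ∈ Icc (1 : ℤ) (N : ℤ),
      (SamePart (fiberFactor N fun x => (𝓢.part x, 𝓑.part x)) x y ↔
        SamePart 𝓢 x y ∧ SamePart 𝓑 x y) := by
    intro x hx y hy
    rw [samePart_fiberFactor _ hx hy, Prod.mk.injEq, samePart_iff_part_eq hx hy,
      samePart_iff_part_eq hx hy]
  refine ⟨_, ⟨Fin.cons R' Ms, Fin.cons m' qs, Fin.cons 𝓢 Bs, ?_, ?_, ?_, ?_⟩, key⟩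
  · refine Fin.cases hS h1
  · refine Fin.cases hR h2
  · rw [h3]
    refine Nat.dvd_antisymm (Nat.lcm_dvd ?_ (Finset.lcm_dvd fun i _ => ?_))
      (Finset.lcm_dvd fun i _ => ?_)
    · exact Finset.dvd_lcm (f := (Fin.cons m' qs : Fin (d + 1) → ℕ)) (mem_univ 0)
    · exact Finset.dvd_lcm (f := (Fin.cons m' qs : Fin (d + 1) → ℕ)) (mem_univ i.succ)
    · revert i
      exact Fin.cases (fun _ => Nat.dvd_lcm_left _ _)
        fun i _ => (Finset.dvd_lcm (mem_univ i)).trans (Nat.dvd_lcm_right _ _)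
  · intro x y hx hy
    rw [key x hx y hy, h4 x y hx hy, Fin.forall_fin_succ]
    rfl

end Factors

section Energy
variable {N : ℕ} (𝓑 : Finpartition (Icc (1 : ℤ) (N : ℤ)))

lemma factorProj_eq {f : ℤ → ℂ} {B : Finset ℤ} (hB : B ∈ 𝓑.parts) {x : ℤ} (hx : x ∈ B) :
    factorProj 𝓑 f x = (∑ y ∈ B, f y) / (#B : ℂ) := by
  rw [factorProj, Finset.sum_eq_single_of_mem B hB, if_pos hx]
  intro B' hB' hne
  rw [if_neg]
  intro hx'
  exact hne (𝓑.eq_of_mem_parts hB' hB hx' hx)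

lemma factorProj_eq_zero {f : ℤ → ℂ} {x : ℤ} (hx : x ∉ Icc (1 : ℤ) (N : ℤ)) :
    factorProj 𝓑 f x = 0 := by
  rw [factorProj]
  refine Finset.sum_eq_zero fun B hB => if_neg fun h => hx (𝓑.le hB h)

lemma factorProj_eq_of_samePart {f : ℤ → ℂ} {x y : ℤ} (h : SamePart 𝓑 x y) :
    factorProj 𝓑 f x = factorProj 𝓑 f y := by
  obtain ⟨B, hB, hx, hy⟩ := h
  rw [factorProj_eq 𝓑 hB hx, factorProj_eq 𝓑 hB hy]

lemma exists_part {x : ℤ} (hx : x ∈ Icc (1 : ℤ) (N : ℤ)) : ∃ B ∈ 𝓑.parts, x ∈ B :=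
  ⟨_, 𝓑.part_mem.2 hx, 𝓑.mem_part_self.2 hx⟩

/-- The projection of a real function with values in `[0,1]` is such a function. -/
lemma exists_factorProj_eq_ofReal {f : ℤ → ℝ}
    (hf : ∀ x ∈ Icc (1 : ℤ) (N : ℤ), f x ∈ Set.Icc (0 : ℝ) 1) (x : ℤ) :
    ∃ a ∈ Set.Icc (0 : ℝ) 1, factorProj 𝓑 (fun y => (f y : ℂ)) x = a := by
  by_cases hx : x ∈ Icc (1 : ℤ) (N : ℤ)
  · obtain ⟨B, hB, hxB⟩ := exists_part 𝓑 hx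
    refine ⟨(∑ y ∈ B, f y) / #B, ⟨?_, ?_⟩, ?_⟩
    · exact div_nonneg (Finset.sum_nonneg fun y hy => (hf y (𝓑.le hB hy)).1) (by positivity)
    · refine div_le_one_of_le₀ ?_ (by positivity)
      simpa using Finset.sum_le_card_nsmul B f 1 fun y hy => (hf y (𝓑.le hB hy)).2
    · rw [factorProj_eq 𝓑 hB hxB]
      push_cast
      rfl
  · exact ⟨0, by simp, by simpa using factorProj_eq_zero 𝓑 hx⟩

/-- The projection is orthogonal. -/
lemma sum_sub_factorProj_mul_eq_zero (f : ℤ → ℂ) {ψ : ℤ → ℂ}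
    (hψ : ∀ x y, SamePart 𝓑 x y → ψ x = ψ y) :
    ∑ x ∈ Icc (1 : ℤ) (N : ℤ), (f x - factorProj 𝓑 f x) * ψ x = 0 := by
  rw [← 𝓑.biUnion_parts, Finset.sum_biUnion 𝓑.disjoint]
  refine Finset.sum_eq_zero fun B hB => ?_
  obtain ⟨x₀, hx₀⟩ := 𝓑.nonempty_of_mem_parts hB
  have h1 : ∑ x ∈ B, (f x - factorProj 𝓑 f x) * ψ x =
      ∑ x ∈ B, (f x - (∑ y ∈ B, f y) / (#B : ℂ)) * ψ x₀ :=
    Finset.sum_congr rfl fun x hx => by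
      rw [factorProj_eq 𝓑 hB hx, hψ x x₀ ⟨B, hB, hx, hx₀⟩]
  have h2 : (#B : ℂ) ≠ 0 := by exact_mod_cast (Finset.card_pos.2 ⟨x₀, hx₀⟩).ne'
  simp only [id]
  rw [h1, ← Finset.sum_mul, Finset.sum_sub_distrib, Finset.sum_const, nsmul_eq_mul,
    mul_div_cancel₀ _ h2, sub_self, zero_mul]

/-- The energy of `f` relative to a factor. -/
noncomputable def energy (f : ℤ → ℂ) : ℝ := ∑ x ∈ Icc (1 : ℤ) (N : ℤ), ‖factorProj 𝓑 f x‖ ^ 2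

lemma energy_nonneg (f : ℤ → ℂ) : 0 ≤ energy 𝓑 f := Finset.sum_nonneg fun _ _ => by positivity

lemma energy_le {f : ℤ → ℝ} (hf : ∀ x ∈ Icc (1 : ℤ) (N : ℤ), f x ∈ Set.Icc (0 : ℝ) 1) :
    energy 𝓑 (fun x => (f x : ℂ)) ≤ N := by
  refine (Finset.sum_le_card_nsmul _ _ 1 fun x _ => ?_).trans (by simp)
  obtain ⟨a, ha, h⟩ := exists_factorProj_eq_ofReal 𝓑 hf x
  rw [h, Complex.norm_real, Real.norm_of_nonneg ha.1]
  exact pow_le_one₀ ha.1 ha.2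

variable {𝓑}

lemma energy_eq_add (f : ℤ → ℂ) {𝓑' : Finpartition (Icc (1 : ℤ) (N : ℤ))}
    (h : ∀ x y, SamePart 𝓑' x y → SamePart 𝓑 x y) :
    energy 𝓑' f = energy 𝓑 f +
      ∑ x ∈ Icc (1 : ℤ) (N : ℤ), ‖factorProj 𝓑' f x - factorProj 𝓑 f x‖ ^ 2 := by
  have hψ : ∀ x y, SamePart 𝓑 x y → conj (factorProj 𝓑 f x) = conj (factorProj 𝓑 f y) :=
    fun x y hxy => by rw [factorProj_eq_of_samePart 𝓑 hxy]
  have h1 := sum_sub_factorProj_mul_eq_zero 𝓑 f hψ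
  have h2 := sum_sub_factorProj_mul_eq_zero 𝓑' f fun x y hxy => hψ x y (h x y hxy)
  have h3 : ∑ x ∈ Icc (1 : ℤ) (N : ℤ),
      (factorProj 𝓑' f x - factorProj 𝓑 f x) * conj (factorProj 𝓑 f x) = 0 := by
    have h12 := sub_eq_zero_of_eq (h1.trans h2.symm)
    rw [← Finset.sum_sub_distrib] at h12
    rw [← h12]
    exact Finset.sum_congr rfl fun x _ => by ring
  have h4 : ∑ x ∈ Icc (1 : ℤ) (N : ℤ),
      ((factorProj 𝓑' f x - factorProj 𝓑 f x) * conj (factorProj 𝓑 f x)).re = 0 := by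
    rw [← Complex.re_sum, h3, Complex.zero_re]
  have h5 : ∀ a b : ℂ, ‖a‖ ^ 2 = ‖b‖ ^ 2 + ‖a - b‖ ^ 2 + 2 * ((a - b) * conj b).re := by
    intro a b
    rw [Complex.sq_norm, Complex.sq_norm, Complex.sq_norm, Complex.normSq_apply,
      Complex.normSq_apply, Complex.normSq_apply]
    simp
    ring
  rw [energy, energy, ← Finset.sum_add_distrib,
    Finset.sum_congr rfl fun x _ => h5 (factorProj 𝓑' f x) (factorProj 𝓑 f x),
    Finset.sum_add_distrib, ← Finset.mul_sum, h4, mul_zero, add_zero]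

/-- Refining a factor so as to capture a correlation of `f - Π f` increases the energy. -/
lemma energy_add_le (f : ℤ → ℂ) {𝓑' : Finpartition (Icc (1 : ℤ) (N : ℤ))} (hN : 0 < N)
    (h : ∀ x y, SamePart 𝓑' x y → SamePart 𝓑 x y) {ψ : ℤ → ℂ} (hψ1 : ∀ x, ‖ψ x‖ ≤ 1)
    (hψ : ∀ x y, SamePart 𝓑' x y → ψ x = ψ y) {η : ℝ} (hη : 0 ≤ η)
    (hcor : η * N ≤ ‖∑ x ∈ Icc (1 : ℤ) (N : ℤ), (f x - factorProj 𝓑 f x) * ψ x‖) :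
    energy 𝓑 f + η ^ 2 * N ≤ energy 𝓑' f := by
  have hN0 : (0 : ℝ) < N := by exact_mod_cast hN
  rw [energy_eq_add f h]
  have h1 : ∑ x ∈ Icc (1 : ℤ) (N : ℤ), (f x - factorProj 𝓑 f x) * ψ x =
      ∑ x ∈ Icc (1 : ℤ) (N : ℤ), (factorProj 𝓑' f x - factorProj 𝓑 f x) * ψ x := by
    have h2 := sum_sub_factorProj_mul_eq_zero 𝓑' f hψ
    rw [← sub_zero (∑ x ∈ Icc (1 : ℤ) (N : ℤ), (f x - _) * _), ← h2, ← Finset.sum_sub_distrib]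
    exact Finset.sum_congr rfl fun x _ => by ring
  rw [h1] at hcor
  have h2 : η * N ≤ ∑ x ∈ Icc (1 : ℤ) (N : ℤ), ‖factorProj 𝓑' f x - factorProj 𝓑 f x‖ := by
    refine hcor.trans ((norm_sum_le _ _).trans (Finset.sum_le_sum fun x _ => ?_))
    rw [norm_mul]
    exact mul_le_of_le_one_right (norm_nonneg _) (hψ1 x)
  have h3 := sq_sum_le_card_mul_sum_sq (s := Icc (1 : ℤ) (N : ℤ))
    (f := fun x => ‖factorProj 𝓑' f x - factorProj 𝓑 f x‖)
  rw [card_Icc_one] at h3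
  have h4 : (η * N) ^ 2 ≤ N * ∑ x ∈ Icc (1 : ℤ) (N : ℤ),
      ‖factorProj 𝓑' f x - factorProj 𝓑 f x‖ ^ 2 := by
    refine le_trans ?_ h3
    gcongr
  have h5 : N * (η ^ 2 * N) ≤ N * ∑ x ∈ Icc (1 : ℤ) (N : ℤ),
      ‖factorProj 𝓑' f x - factorProj 𝓑 f x‖ ^ 2 := by
    refine le_trans (le_of_eq ?_) h4
    ring
  have h6 := le_of_mul_le_mul_left h5 hN0
  linarith

end Energy

section Transfer

lemma sum_zmod_eq_sum_Ico (P : ℕ) [NeZero P] {β : Type*} [AddCommMonoid β] (h : ZMod P → β)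
    (a : ℤ) : ∑ x, h x = ∑ n ∈ Ico a (a + P), h (n : ZMod P) := by
  have hP : (0 : ℤ) < P := by exact_mod_cast Nat.pos_of_ne_zero (NeZero.ne P)
  refine Finset.sum_nbij' (fun x => a + ((x - a : ZMod P).val : ℤ)) (fun n => (n : ZMod P))
    (fun x _ => ?_) (fun n _ => mem_univ _) (fun x _ => ?_) (fun n hn => ?_) (fun x _ => ?_)
  · rw [mem_Ico]
    have := ZMod.val_lt (x - a : ZMod P)
    omega
  · push_cast
    rw [ZMod.natCast_zmod_val]
    ring
  · rw [mem_Ico] at hn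
    rw [← Int.cast_sub, ZMod.val_intCast, Int.emod_eq_of_lt (by omega) (by omega)]
    ring
  · congr 1
    push_cast
    rw [ZMod.natCast_zmod_val]
    ring

/-- A function on `ℤ`, restricted to `[0, P)` and regarded as a function on `ℤ/P`. -/
def lift (P : ℕ) (f : ℤ → ℂ) (x : ZMod P) : ℂ := f (x.val : ℤ)

variable {P N : ℕ} [NeZero P]

lemma lift_intCast {f : ℤ → ℂ} (hf : ∀ x, x ∉ Icc (1 : ℤ) (N : ℤ) → f x = 0) {m : ℤ}
    (h1 : (N : ℤ) - P < m) (h2 : m < P) : lift P f (m : ZMod P) = f m := by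
  rw [lift, ZMod.val_intCast]
  rcases le_or_gt 0 m with h | h
  · rw [Int.emod_eq_of_lt h h2]
  · have : m % P = m + P := by
      rw [← Int.add_emod_right, Int.emod_eq_of_lt (by omega) (by omega)]
    rw [this, hf _ (by rw [mem_Icc]; omega), hf _ (by rw [mem_Icc]; omega)]

lemma Lam_lift {q : ℕ} (hN : 0 < N) (hM : 0 < yRange q N) (hMP : N + yRange q N < P)
    (hqP : N + q * yRange q N ^ 2 < P) {f₀ f₁ f₂ : ℤ → ℂ}
    (h₀ : ∀ x, x ∉ Icc (1 : ℤ) (N : ℤ) → f₀ x = 0) (h₁ : ∀ x, x ∉ Icc (1 : ℤ) (N : ℤ) → f₁ x = 0)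
    (h₂ : ∀ x, x ∉ Icc (1 : ℤ) (N : ℤ) → f₂ x = 0) :
    Lam (1 : ZMod P) (q : ZMod P) (yRange q N) (lift P f₀) (lift P f₁) (lift P f₂) =
      N / P * cntOp q N f₀ f₁ f₂ := by
  set M := yRange q N with hMdef
  have hP0 : (P : ℂ) ≠ 0 := by exact_mod_cast NeZero.ne P
  have hN0 : (N : ℂ) ≠ 0 := by exact_mod_cast hN.ne'
  have hM0 : (M : ℂ) ≠ 0 := by exact_mod_cast hM.ne'
  rw [Lam, cntOp, Finset.expect_eq_sum_div_card, Finset.card_univ, ZMod.card,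
    sum_zmod_eq_sum_Ico P _ 0, ← hMdef]
  have hsub : Icc (1 : ℤ) N ⊆ Ico (0 : ℤ) (0 + P) := by
    intro x hx
    rw [mem_Icc] at hx
    rw [mem_Ico]
    omega
  rw [← Finset.sum_subset hsub]
  · have : ∀ x ∈ Icc (1 : ℤ) N, 𝔼 y ∈ Icc (1 : ℤ) M, lift P f₀ (x : ZMod P) *
        lift P f₁ ((x : ZMod P) + y • (1 : ZMod P)) * lift P f₂ ((x : ZMod P) + y ^ 2 • (q : ZMod P)) =
        (∑ y ∈ Icc (1 : ℤ) M, f₀ x * f₁ (x + y) * f₂ (x + q * y ^ 2)) / M := by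
      intro x hx
      rw [mem_Icc] at hx
      rw [Finset.expect_eq_sum_div_card, card_Icc_one]
      congr 1
      refine Finset.sum_congr rfl fun y hy => ?_
      rw [mem_Icc] at hy
      have hMP' : (N : ℤ) + M < P := by exact_mod_cast hMP
      have hqP' : (N : ℤ) + q * (M : ℤ) ^ 2 < P := by exact_mod_cast hqP
      have e1 : (x : ZMod P) + y • (1 : ZMod P) = ((x + y : ℤ) : ZMod P) := by
        rw [zsmul_eq_mul]; push_cast; ring
      have e2 : (x : ZMod P) + y ^ 2 • (q : ZMod P) = ((x + q * y ^ 2 : ℤ) : ZMod P) := by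
        rw [zsmul_eq_mul]; push_cast; ring
      have e3 : (q : ℤ) * y ^ 2 ≤ q * (M : ℤ) ^ 2 := by
        have : (0 : ℤ) ≤ y := by omega
        have := hy.2
        gcongr
      have e4 : (0 : ℤ) ≤ (q : ℤ) * y ^ 2 := by positivity
      rw [e1, e2, lift_intCast h₀ (by omega) (by omega), lift_intCast h₁ (by omega) (by omega),
        lift_intCast h₂ (by omega) (by omega)]
    rw [Finset.sum_congr rfl this, ← Finset.sum_div]
    field_simp
  · intro x hx hx'
    rw [mem_Ico] at hx
    refine Finset.expect_eq_zero fun y _ => ?_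
    rw [lift_intCast h₀ (by omega) (by omega), h₀ x hx', zero_mul, zero_mul]

/-- The progression of difference `D` and length `I` ending the grid cell of offset `D * t`
that contains `x` is determined by its predecessor. -/
def cellBase (D I t x : ℤ) : ℤ := x % D + D * (I * ((x / D - t) / I) + t - 1)

lemma sum_sub_mul_eq_sum_cellBase {D : ℤ} {I : ℕ} (hI : 0 < I) (b : ℤ → ℂ) (x : ℤ) :
    ∑ i ∈ Icc (1 : ℤ) I, b (x - D * i) = ∑ t ∈ Ico (0 : ℤ) I, b (cellBase D I t x) := by
  have hI' : (0 : ℤ) < I := by exact_mod_cast hI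
  refine Finset.sum_nbij' (fun i => (x / D + 1 - i) % I) (fun t => 1 + (x / D - t) % I)
    (fun i _ => ?_) (fun t _ => ?_) (fun i hi => ?_) (fun t ht => ?_) (fun i hi => ?_)
  · rw [mem_Ico]
    exact ⟨Int.emod_nonneg _ hI'.ne', Int.emod_lt_of_pos _ hI'⟩
  · rw [mem_Icc]
    have := Int.emod_nonneg (x / D - t) hI'.ne'
    have := Int.emod_lt_of_pos (x / D - t) hI'
    omega
  · rw [mem_Icc] at hi
    have e : x / D - (x / D + 1 - i) % I = (i - 1) + I * ((x / D + 1 - i) / I) := by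
      rw [Int.emod_def]; ring
    rw [e, Int.add_mul_emod_self_left, Int.emod_eq_of_lt (by omega) (by omega)]
    ring
  · rw [mem_Ico] at ht
    have e : x / D + 1 - (1 + (x / D - t) % I) = t + I * ((x / D - t) / I) := by
      rw [Int.emod_def]; ring
    rw [e, Int.add_mul_emod_self_left, Int.emod_eq_of_lt ht.1 ht.2]
  · rw [mem_Icc] at hi
    congr 1
    have e : x / D - (x / D + 1 - i) % I = (i - 1) + I * ((x / D + 1 - i) / I) := by
      rw [Int.emod_def]; ring
    rw [cellBase, e, Int.add_mul_ediv_left _ _ hI'.ne', Int.ediv_eq_zero_of_lt (by omega) (by omega),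
      Int.emod_def (x / D + 1 - i), Int.emod_def x]
    ring

/-- Large averages along progressions yield a correlation with a function measurable with respect
to a simple local factor. -/
lemma exists_structured_correlation {D I : ℕ} (hD : 0 < D) (hI : 0 < I) (hP : N + D * I < P)
    {F : ℤ → ℂ} (hF : ∀ x, x ∉ Icc (1 : ℤ) (N : ℤ) → F x = 0) :
    ∃ (r : ℝ) (ψ : ℤ → ℂ), (∀ x, ‖ψ x‖ ≤ 1) ∧
      (∀ x y : ℤ, ⌊((x : ℝ) - r) / (D * I : ℕ)⌋ = ⌊((y : ℝ) - r) / (D * I : ℕ)⌋ →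
        x % (D : ℤ) = y % (D : ℤ) → ψ x = ψ y) ∧
      P * (𝔼 x : ZMod P, ‖𝔼 i ∈ Icc (1 : ℤ) I, lift P F (x + ((D * i : ℤ) : ZMod P))‖) ≤
        ‖∑ x ∈ Icc (1 : ℤ) (N : ℤ), F x * ψ x‖ := by
  have hI0 : (0 : ℝ) < I := by exact_mod_cast hI
  have hD' : (0 : ℤ) < D := by exact_mod_cast hD
  have hP0 : (0 : ℝ) < P := by exact_mod_cast Nat.pos_of_ne_zero (NeZero.ne P)
  have hP' : (N : ℤ) + D * I < P := by exact_mod_cast hP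
  choose b hb1 hb using fun n : ℤ => exists_unimodular_mul (∑ i ∈ Icc (1 : ℤ) I, F (n + D * i))
  have hrange : ∀ i ∈ Icc (1 : ℤ) I, (D : ℤ) ≤ D * i ∧ D * i ≤ (D : ℤ) * I := by
    intro i hi
    rw [mem_Icc] at hi
    constructor <;> nlinarith
  set L : ℤ := D * I with hL
  set S : ℝ := ∑ n ∈ Ico (-L) (-L + P), ‖∑ i ∈ Icc (1 : ℤ) I, F (n + D * i)‖ with hS
  have h1 : P * (𝔼 x : ZMod P, ‖𝔼 i ∈ Icc (1 : ℤ) I, lift P F (x + ((D * i : ℤ) : ZMod P))‖) =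
      S / I := by
    rw [Finset.expect_eq_sum_div_card, Finset.card_univ, ZMod.card, mul_div_cancel₀ _ hP0.ne',
      sum_zmod_eq_sum_Ico P _ (-L), hS, Finset.sum_div]
    refine Finset.sum_congr rfl fun n hn => ?_
    rw [mem_Ico] at hn
    rw [Finset.expect_eq_sum_div_card, card_Icc_one, norm_div, Complex.norm_natCast]
    congr 2
    refine Finset.sum_congr rfl fun i hi => ?_
    have := hrange i hi
    rw [← Int.cast_add, lift_intCast hF (by omega) (by omega)]
  have h2 : (S : ℂ) = ∑ t ∈ Ico (0 : ℤ) I, ∑ x ∈ Icc (1 : ℤ) N, F x * b (cellBase D I t x) := by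
    rw [Finset.sum_comm]
    simp_rw [← Finset.mul_sum, ← sum_sub_mul_eq_sum_cellBase hI]
    rw [hS]
    push_cast
    simp_rw [← hb, Finset.mul_sum]
    rw [Finset.sum_comm, Finset.sum_comm (s := Icc (1 : ℤ) N)]
    refine Finset.sum_congr rfl fun i hi => ?_
    have hi' := hrange i hi
    symm
    refine Finset.sum_of_injOn (fun x => x - D * i) (fun x _ y _ h => by simpa using h)
      (fun x hx => ?_) (fun n _ hn => ?_) (fun x _ => ?_)
    · rw [Finset.mem_coe, mem_Icc] at hx
      rw [Finset.mem_coe, mem_Ico]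
      change _ ≤ x - D * i ∧ x - D * i < _
      omega
    · rw [hF, mul_zero]
      intro hx
      exact hn ⟨n + D * i, hx, by simp⟩
    · rw [sub_add_cancel, mul_comm]
  obtain ⟨t, -, ht⟩ : ∃ t ∈ Ico (0 : ℤ) I, S / I ≤
      ‖∑ x ∈ Icc (1 : ℤ) N, F x * b (cellBase D I t x)‖ := by
    refine exists_le_of_sum_le ⟨0, by rw [mem_Ico]; omega⟩ ?_
    rw [Finset.sum_const, nsmul_eq_mul, Int.card_Ico, sub_zero, Int.toNat_natCast,
      mul_div_cancel₀ _ hI0.ne']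
    refine le_trans ?_ (norm_sum_le _ _)
    rw [← h2, Complex.norm_real]
    exact Real.le_norm_self _
  refine ⟨((D * t : ℤ) : ℝ), fun x => b (cellBase D I t x), fun x => hb1 _, fun x y h h' => ?_,
    h1 ▸ ht⟩
  have hfl : ∀ x : ℤ, ⌊((x : ℝ) - ((D * t : ℤ) : ℝ)) / (D * I : ℕ)⌋ = (x / D - t) / I := by
    intro x
    rw [← Int.cast_sub, Int.floor_div_natCast, Int.floor_intCast, Nat.cast_mul,
      ← Int.sub_mul_ediv_left x t hD'.ne', Int.ediv_ediv]
    rw [if_neg (fun h => by omega), sub_zero]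
  rw [hfl, hfl] at h
  simp only [cellBase, h, h']

end Transfer

section Increment

lemma mul_sq_yRange_le {q N : ℕ} (hq : 0 < q) : q * yRange q N ^ 2 ≤ N := by
  have hq0 : (0 : ℝ) < q := by exact_mod_cast hq
  have h1 : (yRange q N : ℝ) ≤ √((N : ℝ) / q) := Nat.floor_le (Real.sqrt_nonneg _)
  have h2 : (yRange q N : ℝ) ^ 2 ≤ (N : ℝ) / q := by
    rw [← Real.sq_sqrt (show (0 : ℝ) ≤ (N : ℝ) / q by positivity)]
    gcongr
  rw [le_div_iff₀ hq0] at h2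
  have : ((q * yRange q N ^ 2 : ℕ) : ℝ) ≤ N := by push_cast; linarith
  exact_mod_cast this

lemma lt_mul_sq_yRange {q N : ℕ} (hq : 0 < q) : N < q * (yRange q N + 1) ^ 2 := by
  have hq0 : (0 : ℝ) < q := by exact_mod_cast hq
  have h1 : √((N : ℝ) / q) < yRange q N + 1 := Nat.lt_floor_add_one _
  have h2 : (N : ℝ) / q < (yRange q N + 1 : ℝ) ^ 2 := by
    rw [← Real.sq_sqrt (show (0 : ℝ) ≤ (N : ℝ) / q by positivity)]
    gcongr
  rw [div_lt_iff₀ hq0] at h2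
  have : (N : ℝ) < ((q * (yRange q N + 1) ^ 2 : ℕ) : ℝ) := by push_cast; linarith
  exact_mod_cast this

lemma yRange_pos {q N : ℕ} (hq : 0 < q) (hqN : q ≤ N) : 0 < yRange q N := by
  rw [yRange, Nat.floor_pos, Real.one_le_sqrt, one_le_div (by exact_mod_cast hq)]
  exact_mod_cast hqN

lemma sqrt_div_le_two_mul_yRange {q N : ℕ} (hq : 0 < q) (hqN : q ≤ N) :
    √((N : ℝ) / q) ≤ 2 * yRange q N := by
  have h1 : √((N : ℝ) / q) < yRange q N + 1 := Nat.lt_floor_add_one _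
  have h2 : (1 : ℝ) ≤ yRange q N := by exact_mod_cast yRange_pos hq hqN
  linarith

/-- A function with a large count correlates with a simple local factor. -/
theorem exists_correlation_of_cntOp : ∃ K : ℕ, ∀ (q N I : ℕ) (X : ℝ) (f₀ f₁ f₂ F : ℤ → ℂ),
    0 < q → q ≤ N → 2 ≤ X → 0 < I → X ^ K * (q * I) ≤ yRange q N →
    (∀ x, ‖f₀ x‖ ≤ 1) → (∀ x, ‖f₁ x‖ ≤ 1) → (∀ x, ‖f₂ x‖ ≤ 1) →
    (∀ x, x ∉ Icc (1 : ℤ) (N : ℤ) → f₀ x = 0) → (∀ x, x ∉ Icc (1 : ℤ) (N : ℤ) → f₁ x = 0) →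
    (∀ x, x ∉ Icc (1 : ℤ) (N : ℤ) → f₂ x = 0) →
    16 / X ≤ ‖cntOp q N f₀ f₁ f₂‖ → F = f₀ ∨ F = f₁ ∨ F = f₂ →
    ∃ (d : ℕ) (r : ℝ) (ψ : ℤ → ℂ), 0 < d ∧ (d : ℝ) ≤ X ^ K ∧ (∀ x, ‖ψ x‖ ≤ 1) ∧
      (∀ x y : ℤ, ⌊((x : ℝ) - r) / (q * d * I : ℕ)⌋ = ⌊((y : ℝ) - r) / (q * d * I : ℕ)⌋ →
        x % ((q * d : ℕ) : ℤ) = y % ((q * d : ℕ) : ℤ) → ψ x = ψ y) ∧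
      1 / X ^ K * N ≤ ‖∑ x ∈ Icc (1 : ℤ) (N : ℤ), F x * ψ x‖ := by
  obtain ⟨K, hK⟩ := hasLocalAverage_of_Lam
  refine ⟨K, fun q N I X f₀ f₁ f₂ F hq hqN hX hI hM h₀ h₁ h₂ s₀ s₁ s₂ hc hF => ?_⟩
  obtain ⟨M, hMdef⟩ : ∃ M, M = yRange q N := ⟨_, rfl⟩
  have hX0 : 0 < X := by linarith
  have hM0 : 0 < M := hMdef ▸ yRange_pos hq hqN
  have hqM := hMdef ▸ mul_sq_yRange_le (N := N) hq
  have hNM := hMdef ▸ lt_mul_sq_yRange (N := N) hq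
  have hN0 : 0 < N := hq.trans_le hqN
  obtain ⟨P, hPdef⟩ : ∃ P, P = 4 * (q * (M + 1) ^ 2) := ⟨_, rfl⟩
  have hP0 : 0 < P := by rw [hPdef]; positivity
  have : NeZero P := ⟨hP0.ne'⟩
  have hMN : M ≤ N := by
    refine le_trans ?_ hqM
    nlinarith [Nat.mul_le_mul hq (Nat.le_self_pow (n := 2) (by norm_num) M)]
  have hP16 : P ≤ 16 * N := by
    have : (M + 1) ^ 2 ≤ 4 * M ^ 2 := by nlinarith
    calc P = 4 * (q * (M + 1) ^ 2) := hPdef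
      _ ≤ 4 * (q * (4 * M ^ 2)) := by gcongr
      _ = 16 * (q * M ^ 2) := by ring
      _ ≤ _ := by gcongr
  have hR : OrderScale (q : ZMod P) M := by
    have hord : addOrderOf (q : ZMod P) = 4 * (M + 1) ^ 2 := by
      rw [ZMod.addOrderOf_coe _ hP0.ne']
      have h1 : P = q * (4 * (M + 1) ^ 2) := by rw [hPdef]; ring
      rw [h1, Nat.gcd_mul_right_left, Nat.mul_div_cancel_left _ hq]
    rw [OrderScale, hord]
    constructor <;> nlinarith
  have hP0' : (0 : ℝ) < P := by exact_mod_cast hP0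
  have hN0' : (0 : ℝ) < N := by exact_mod_cast hN0
  have hL : 1 / X ≤ ‖Lam (1 : ZMod P) (q : ZMod P) M (lift P f₀) (lift P f₁) (lift P f₂)‖ := by
    rw [hMdef, Lam_lift hN0 (hMdef ▸ hM0) (by rw [← hMdef]; omega) (by rw [← hMdef]; omega)
      s₀ s₁ s₂, norm_mul, norm_div, Complex.norm_natCast, Complex.norm_natCast]
    have h1 : (1 : ℝ) / 16 ≤ N / P := by
      rw [div_le_div_iff₀ (by norm_num) hP0', one_mul, mul_comm]
      exact_mod_cast hP16
    calc 1 / X = 1 / 16 * (16 / X) := by ring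
      _ ≤ N / P * ‖cntOp q N f₀ f₁ f₂‖ := by gcongr
  rw [← hMdef] at hM
  obtain ⟨a₀, a₁, a₂⟩ := hK (ZMod P) 1 (q : ZMod P) q M I X (lift P f₀) (lift P f₁) (lift P f₂)
    (by simp) hq hX hI hM hR (fun x => h₀ _) (fun x => h₁ _) (fun x => h₂ _) hL
  have hFs : ∀ x, x ∉ Icc (1 : ℤ) (N : ℤ) → F x = 0 := by
    rcases hF with rfl | rfl | rfl <;> assumption
  have hFa : HasLocalAverage (q : ZMod P) I (X ^ K) (lift P F) := by
    rcases hF with rfl | rfl | rfl <;> assumption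
  obtain ⟨d, hd0, hd, h⟩ := hFa
  have hDI : q * d * I ≤ M := by
    have : ((q * d * I : ℕ) : ℝ) ≤ M := by
      refine le_trans ?_ hM
      push_cast
      calc (q : ℝ) * d * I = d * (q * I) := by ring
        _ ≤ _ := by gcongr
    exact_mod_cast this
  obtain ⟨r, ψ, hψ1, hψ, hcor⟩ := exists_structured_correlation (P := P) (N := N) (D := q * d)
    (I := I) (by positivity) hI (by omega) hFs
  refine ⟨d, r, ψ, hd0, hd, hψ1, hψ, le_trans ?_ hcor⟩
  have e1 : ∀ i : ℤ, ((d * i : ℤ) • (q : ZMod P)) = ((((q * d : ℕ) : ℤ) * i : ℤ) : ZMod P) := by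
    intro i
    rw [zsmul_eq_mul]; push_cast; ring
  simp only [e1] at h
  rw [mul_comm]
  have hNP : (N : ℝ) ≤ P := by exact_mod_cast (by omega : N ≤ P)
  gcongr

end Increment

section Iteration

lemma cutNorm_le {q N : ℕ} {F : ℤ → ℂ} {δ : ℝ}
    (h : ∀ f₀ f₁ f₂ : ℤ → ℂ, F = f₀ ∨ F = f₁ ∨ F = f₂ →
      (∀ g ∈ ({f₀, f₁, f₂} : Set (ℤ → ℂ)), g = F ∨ ((∀ x, ‖g x‖ ≤ 1) ∧
        ∀ x, x ∉ Icc (1 : ℤ) (N : ℤ) → g x = 0)) →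
      ‖cntOp q N f₀ f₁ f₂‖ ≤ δ) : cutNorm q N F ≤ δ := by
  refine csSup_le ⟨_, 0, 0, by simp, by simp, by simp, by simp, Or.inl rfl⟩ ?_
  rintro r ⟨g₁, g₂, h1, h2, s1, s2, hr⟩
  have t1 : ∀ x, x ∉ Icc (1 : ℤ) (N : ℤ) → g₁ x = 0 := fun x => not_imp_comm.1 (s1 x)
  have t2 : ∀ x, x ∉ Icc (1 : ℤ) (N : ℤ) → g₂ x = 0 := fun x => not_imp_comm.1 (s2 x)
  rcases hr with rfl | rfl | rfl
  · refine h _ _ _ (Or.inl rfl) ?_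
    rintro g (rfl | rfl | rfl)
    exacts [Or.inl rfl, Or.inr ⟨h1, t1⟩, Or.inr ⟨h2, t2⟩]
  · refine h _ _ _ (Or.inr (Or.inl rfl)) ?_
    rintro g (rfl | rfl | rfl)
    exacts [Or.inr ⟨h1, t1⟩, Or.inl rfl, Or.inr ⟨h2, t2⟩]
  · refine h _ _ _ (Or.inr (Or.inr rfl)) ?_
    rintro g (rfl | rfl | rfl)
    exacts [Or.inr ⟨h1, t1⟩, Or.inr ⟨h2, t2⟩, Or.inl rfl]

lemma norm_sub_factorProj_le {N : ℕ} (𝓑 : Finpartition (Icc (1 : ℤ) (N : ℤ))) {f : ℤ → ℝ}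
    (hf : ∀ x ∈ Icc (1 : ℤ) (N : ℤ), f x ∈ Set.Icc (0 : ℝ) 1)
    (hs : ∀ x, x ∉ Icc (1 : ℤ) (N : ℤ) → f x = 0) (x : ℤ) :
    ‖(f x : ℂ) - factorProj 𝓑 (fun y => (f y : ℂ)) x‖ ≤ 1 := by
  obtain ⟨a, ha, h⟩ := exists_factorProj_eq_ofReal 𝓑 hf x
  have hx : f x ∈ Set.Icc (0 : ℝ) 1 := by
    by_cases hx : x ∈ Icc (1 : ℤ) (N : ℤ)
    · exact hf x hx
    · rw [hs x hx]; simp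
  rw [h, ← Complex.ofReal_sub, Complex.norm_real, Real.norm_eq_abs, abs_le]
  constructor <;> linarith [ha.1, ha.2, hx.1, hx.2]

/-- The energy increment: one step of the iteration. -/
theorem exists_energy_increment : ∃ K : ℕ, ∀ (q N I d q' : ℕ) (X R : ℝ) (f : ℤ → ℝ)
    (𝓑 : Finpartition (Icc (1 : ℤ) (N : ℤ))),
    0 < q → q ≤ N → 2 ≤ X → 0 < I → X ^ K * (q * I) ≤ yRange q N → R ≤ q * I →
    (∀ x ∈ Icc (1 : ℤ) (N : ℤ), f x ∈ Set.Icc (0 : ℝ) 1) →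
    (∀ x, x ∉ Icc (1 : ℤ) (N : ℤ) → f x = 0) → 0 < q' → IsLocalFactor 𝓑 d R (q * q') →
    ¬ cutNorm q N (fun x => (f x : ℂ) - factorProj 𝓑 (fun y => (f y : ℂ)) x) ≤ 16 / X →
    ∃ (q'' : ℕ) (𝓑' : Finpartition (Icc (1 : ℤ) (N : ℤ))), 0 < q'' ∧ (q'' : ℝ) ≤ X ^ K * q' ∧
      IsLocalFactor 𝓑' (d + 1) R (q * q'') ∧
      energy 𝓑 (fun x => (f x : ℂ)) + (1 / X ^ K) ^ 2 * N ≤ energy 𝓑' (fun x => (f x : ℂ)) := by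
  obtain ⟨K, hK⟩ := exists_correlation_of_cntOp
  refine ⟨K, fun q N I d q' X R f 𝓑 hq hqN hX hI hM hR hf hs hq' h𝓑 hcut => ?_⟩
  have hX0 : 0 < X := by linarith
  have hN0 : 0 < N := hq.trans_le hqN
  set F : ℤ → ℂ := fun x => (f x : ℂ) - factorProj 𝓑 (fun y => (f y : ℂ)) x with hF
  have hF1 : ∀ x, ‖F x‖ ≤ 1 := norm_sub_factorProj_le 𝓑 hf hs
  have hFs : ∀ x, x ∉ Icc (1 : ℤ) (N : ℤ) → F x = 0 := fun x hx => by
    simp only [hF, hs x hx, factorProj_eq_zero 𝓑 hx, Complex.ofReal_zero, sub_zero]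
  obtain ⟨f₀, f₁, f₂, hmem, hall, hlarge⟩ : ∃ f₀ f₁ f₂ : ℤ → ℂ, (F = f₀ ∨ F = f₁ ∨ F = f₂) ∧
      (∀ g ∈ ({f₀, f₁, f₂} : Set (ℤ → ℂ)), g = F ∨ ((∀ x, ‖g x‖ ≤ 1) ∧
        ∀ x, x ∉ Icc (1 : ℤ) (N : ℤ) → g x = 0)) ∧ 16 / X < ‖cntOp q N f₀ f₁ f₂‖ := by
    by_contra hcon
    push Not at hcon
    exact hcut (cutNorm_le hcon)
  have hall' : ∀ g ∈ ({f₀, f₁, f₂} : Set (ℤ → ℂ)), (∀ x, ‖g x‖ ≤ 1) ∧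
      ∀ x, x ∉ Icc (1 : ℤ) (N : ℤ) → g x = 0 := fun g hg => by
    rcases hall g hg with rfl | h
    exacts [⟨hF1, hFs⟩, h]
  obtain ⟨b₀, s₀⟩ := hall' f₀ (by simp)
  obtain ⟨b₁, s₁⟩ := hall' f₁ (by simp)
  obtain ⟨b₂, s₂⟩ := hall' f₂ (by simp)
  obtain ⟨e, r, ψ, he0, he, hψ1, hψ, hcor⟩ := hK q N I X f₀ f₁ f₂ F hq hqN hX hI hM b₀ b₁ b₂
    s₀ s₁ s₂ hlarge.le hmem
  have hpos : 0 < q * e * I := by positivity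
  obtain ⟨𝓢, h𝓢, h𝓢'⟩ := exists_isSimpleLocalFactor N (R := (q * e * I : ℕ))
    (by exact_mod_cast hpos) (m := q * e) (by positivity) r
  have hR' : R ≤ (q * e * I : ℕ) := by
    refine hR.trans ?_
    have : q * I ≤ q * e * I := by
      gcongr
      exact Nat.le_mul_of_pos_right q he0
    exact_mod_cast this
  obtain ⟨𝓑', h1, h2⟩ := exists_join h𝓑 h𝓢 hR'
  have hmem' : ∀ x y, SamePart 𝓑' x y → x ∈ Icc (1 : ℤ) (N : ℤ) ∧ y ∈ Icc (1 : ℤ) (N : ℤ) := by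
    rintro x y ⟨B, hB, hx, hy⟩
    exact ⟨𝓑'.le hB hx, 𝓑'.le hB hy⟩
  refine ⟨Nat.lcm e q', 𝓑', Nat.lcm_pos he0 hq', ?_, ?_, ?_⟩
  · calc ((Nat.lcm e q' : ℕ) : ℝ) ≤ ((e * q' : ℕ) : ℝ) := by
          exact_mod_cast Nat.le_of_dvd (by positivity) (Nat.lcm_dvd_mul e q')
      _ = e * q' := by push_cast; ring
      _ ≤ _ := by gcongr
  · rw [Nat.lcm_mul_left] at h1
    exact h1
  · refine energy_add_le _ hN0 (fun x y hxy => ?_) hψ1 (fun x y hxy => ?_) (by positivity) hcor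
    · obtain ⟨hx, hy⟩ := hmem' x y hxy
      exact ((h2 x hx y hy).1 hxy).2
    · obtain ⟨hx, hy⟩ := hmem' x y hxy
      have := (h𝓢' x hx y hy).1 ((h2 x hx y hy).1 hxy).1
      exact hψ x y this.1 this.2

/-- The outcome of the energy increment iteration. -/
theorem exists_localFactor : ∃ K : ℕ, ∀ (q N I : ℕ) (X R : ℝ) (f : ℤ → ℝ),
    0 < q → q ≤ N → 2 ≤ X → 0 < I → X ^ K * (q * I) ≤ yRange q N → 0 < R → R ≤ q * I →
    (∀ x ∈ Icc (1 : ℤ) (N : ℤ), f x ∈ Set.Icc (0 : ℝ) 1) →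
    (∀ x, x ∉ Icc (1 : ℤ) (N : ℤ) → f x = 0) →
    ∃ (d q' : ℕ) (𝓑 : Finpartition (Icc (1 : ℤ) (N : ℤ))), (d : ℝ) ≤ X ^ (2 * K) + 2 ∧ 0 < q' ∧
      (q' : ℝ) ≤ (X ^ K) ^ d ∧ IsLocalFactor 𝓑 d R (q * q') ∧
      cutNorm q N (fun x => (f x : ℂ) - factorProj 𝓑 (fun y => (f y : ℂ)) x) ≤ 16 / X := by
  obtain ⟨K, hK⟩ := exists_energy_increment
  refine ⟨K, fun q N I X R f hq hqN hX hI hM hR0 hR hf hs => ?_⟩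
  have hX0 : 0 < X := by linarith
  have hX1 : 1 ≤ X := by linarith
  have hN0 : (0 : ℝ) < N := by exact_mod_cast hq.trans_le hqN
  by_contra hcon
  push Not at hcon
  have key : ∀ n : ℕ, (n : ℝ) ≤ X ^ (2 * K) + 1 →
      ∃ (q' : ℕ) (𝓑 : Finpartition (Icc (1 : ℤ) (N : ℤ))), 0 < q' ∧ (q' : ℝ) ≤ (X ^ K) ^ n ∧
        IsLocalFactor 𝓑 (n + 1) R (q * q') ∧
        n * ((1 / X ^ K) ^ 2 * N) ≤ energy 𝓑 (fun x => (f x : ℂ)) := by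
    intro n
    induction n with
    | zero =>
      intro _
      obtain ⟨𝓢, h𝓢, -⟩ := exists_isSimpleLocalFactor N hR0 hq 0
      exact ⟨1, 𝓢, one_pos, by simp, by simpa using isLocalFactor_one h𝓢, by
        simpa using energy_nonneg 𝓢 _⟩
    | succ n ih =>
      intro hn
      push_cast at hn
      obtain ⟨q', 𝓑, h1, h2, h3, h4⟩ := ih (by linarith)
      have h5 := hcon (n + 1) q' 𝓑 (by push_cast; linarith) h1
        (h2.trans (pow_le_pow_right₀ (one_le_pow₀ hX1) (by omega))) h3
      obtain ⟨q'', 𝓑', a1, a2, a3, a4⟩ := hK q N I (n + 1) q' X R f 𝓑 hq hqN hX hI hM hR hf hs h1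
        h3 (not_le.2 h5)
      refine ⟨q'', 𝓑', a1, a2.trans ?_, a3, ?_⟩
      · rw [pow_succ, mul_comm]
        gcongr
      · push_cast
        linarith
  have hfl := Nat.floor_le (show 0 ≤ X ^ (2 * K) by positivity)
  have hlt := Nat.lt_floor_add_one (X ^ (2 * K))
  obtain ⟨q', 𝓑, -, -, -, h⟩ := key (⌊X ^ (2 * K)⌋₊ + 1) (by push_cast; linarith)
  have h' := h.trans (energy_le 𝓑 hf)
  push_cast at h'
  have hpos : 0 < (1 / X ^ K) ^ 2 * (N : ℝ) := by positivity
  have : X ^ (2 * K) * ((1 / X ^ K) ^ 2 * (N : ℝ)) = N := by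
    rw [mul_comm 2 K, pow_mul]
    field_simp
  nlinarith

end Iteration

end PolyRoth

/-- **Weak regularity lemma.** -/
theorem weak_regularity :
    ∃ C c : ℝ, 0 < C ∧ 0 < c ∧
      ∀ (q N : ℕ), 0 < q → q ≤ N → ∀ δ : ℝ, 0 < δ → δ ≤ 1 →
        ((N : ℝ) ≤ C * ((q : ℝ) / δ) ^ C ∨
          ∀ f : ℤ → ℝ,
            (∀ x ∈ Finset.Icc (1 : ℤ) (N : ℤ), f x ∈ Set.Icc (0 : ℝ) 1) →
            (∀ x, x ∉ Finset.Icc (1 : ℤ) (N : ℤ) → f x = 0) →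
            ∃ (d q' : ℕ) (𝓑 : Finpartition (Finset.Icc (1 : ℤ) (N : ℤ))),
              (d : ℝ) ≤ C * δ ^ (-C) ∧ 0 < q' ∧
              (q' : ℝ) ≤ (C / δ) ^ (C * (d : ℝ)) ∧
              IsLocalFactor 𝓑 d (c * (δ / (q : ℝ)) ^ C * Real.sqrt N) (q * q') ∧
              cutNorm q N
                (fun x => (f x : ℂ) - factorProj 𝓑 (fun y => (f y : ℂ)) x) ≤ δ) := by
  obtain ⟨K, hK⟩ := PolyRoth.exists_localFactor
  obtain ⟨C, hC⟩ : ∃ C : ℝ, C = 4 * 16 ^ (2 * K) + 2 * K + 16 := ⟨_, rfl⟩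
  have h16 : (1 : ℝ) ≤ 16 ^ (2 * K) := one_le_pow₀ (by norm_num)
  have hK0 : (0 : ℝ) ≤ K := Nat.cast_nonneg K
  have hC16 : 16 ≤ C := by rw [hC]; linarith
  have hC0 : 0 < C := by linarith
  refine ⟨C, 1 / (4 * 16 ^ K), hC0, by positivity, fun q N hq hqN δ hδ hδ1 => ?_⟩
  rw [or_iff_not_imp_left]
  intro hN f hf hs
  push Not at hN
  have hq1 : (1 : ℝ) ≤ q := by exact_mod_cast hq
  have hq0 : (0 : ℝ) < q := by linarith
  have hu1 : 1 ≤ 1 / δ := by rw [le_div_iff₀ hδ]; linarith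
  obtain ⟨u, hu⟩ : ∃ u : ℝ, u = 1 / δ := ⟨_, rfl⟩
  rw [← hu] at hu1
  have hu0 : 0 < u := by linarith
  have hδu : δ = 1 / u := by rw [hu, one_div_one_div]
  have hX2 : (2 : ℝ) ≤ 16 * u := by linarith
  set M := yRange q N with hM
  have hrpow : ∀ (a : ℝ) (n : ℕ), 1 ≤ a → (n : ℝ) ≤ C → a ^ n ≤ a ^ C := by
    intro a n ha hn
    rw [← Real.rpow_natCast]
    exact Real.rpow_le_rpow_of_exponent_le ha hn
  -- the length of the progressions
  have hM1 : (16 * u) ^ K * q ≤ M := by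
    have h1 : (2 * ((16 * u) ^ K * q)) ^ 2 ≤ (N : ℝ) / q := by
      rw [le_div_iff₀ hq0]
      have hqu : 1 ≤ q * u := one_le_mul_of_one_le_of_one_le hq1 hu1
      have h2 := hrpow (q * u) (2 * K + 3) hqu (by rw [hC]; push_cast; linarith)
      have h3 : (q : ℝ) / δ = q * u := by rw [hu]; ring
      rw [h3] at hN
      calc (2 * ((16 * u) ^ K * q)) ^ 2 * q = 4 * 16 ^ (2 * K) * (u ^ (2 * K) * q ^ 3) := by
            rw [mul_pow 16 u]; ring
        _ ≤ C * (q * u) ^ (2 * K + 3) := by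
            rw [mul_pow]
            have a1 : u ^ (2 * K) ≤ u ^ (2 * K + 3) := pow_le_pow_right₀ hu1 (by omega)
            have a2 : (q : ℝ) ^ 3 ≤ q ^ (2 * K + 3) := pow_le_pow_right₀ hq1 (by omega)
            have a3 : 4 * (16 : ℝ) ^ (2 * K) ≤ C := by rw [hC]; linarith
            rw [mul_comm (u ^ (2 * K))]
            gcongr
        _ ≤ C * (q * u) ^ C := by gcongr
        _ ≤ N := hN.le
    have h2 : 2 * ((16 * u) ^ K * q) ≤ √((N : ℝ) / q) := Real.le_sqrt_of_sq_le h1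
    have h3 := PolyRoth.sqrt_div_le_two_mul_yRange hq hqN
    linarith
  have hden : 0 < (16 * u) ^ K * q := by positivity
  obtain ⟨I, hI⟩ : ∃ I : ℕ, I = ⌊(M : ℝ) / ((16 * u) ^ K * q)⌋₊ := ⟨_, rfl⟩
  have hI0 : 0 < I := by
    rw [hI, Nat.floor_pos, one_le_div hden]
    exact hM1
  have hI1 : (16 * u) ^ K * (q * I) ≤ M := by
    have := Nat.floor_le (show 0 ≤ (M : ℝ) / ((16 * u) ^ K * q) by positivity)
    rw [← hI, le_div_iff₀ hden] at this
    linarith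
  have hI2 : (M : ℝ) ≤ 2 * (16 * u) ^ K * (q * I) := by
    have := Nat.lt_floor_add_one ((M : ℝ) / ((16 * u) ^ K * q))
    rw [← hI, div_lt_iff₀ hden] at this
    have hI1' : (1 : ℝ) ≤ I := by exact_mod_cast hI0
    nlinarith
  have hR : 1 / (4 * 16 ^ K) * (δ / q) ^ C * √N ≤ q * I := by
    have h1 : (δ / q) ^ C ≤ 1 / u ^ K * (1 / √q) := by
      have a1 : δ / q = (q * u)⁻¹ := by rw [hu]; field_simp
      have hqu : 1 ≤ q * u := one_le_mul_of_one_le_of_one_le hq1 hu1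
      have a2 := hrpow (q * u) (K + 1) hqu (by rw [hC]; push_cast; linarith)
      rw [a1, Real.inv_rpow (by positivity), div_mul_div_comm, one_mul, ← one_div]
      refine one_div_le_one_div_of_le (by positivity) (le_trans ?_ a2)
      rw [mul_pow, mul_comm]
      have a3 : √(q : ℝ) ≤ q := by
        rw [Real.sqrt_le_left hq0.le]
        nlinarith
      have a4 : (q : ℝ) ≤ q ^ (K + 1) := le_self_pow₀ hq1 (by omega)
      have a5 : u ^ K ≤ u ^ (K + 1) := pow_le_pow_right₀ hu1 (by omega)
      have a6 := a3.trans a4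
      gcongr
    have h2 : √((N : ℝ) / q) ≤ 4 * (16 * u) ^ K * (q * I) := by
      have := PolyRoth.sqrt_div_le_two_mul_yRange hq hqN
      linarith
    calc 1 / (4 * 16 ^ K) * (δ / q) ^ C * √N ≤
        1 / (4 * 16 ^ K) * (1 / u ^ K * (1 / √q)) * √N := by gcongr
      _ = √((N : ℝ) / q) / (4 * (16 * u) ^ K) := by
        rw [Real.sqrt_div (Nat.cast_nonneg N), mul_pow]
        field_simp
      _ ≤ _ := by
        rw [div_le_iff₀ (by positivity)]
        linarith
  have hR0 : 0 < 1 / (4 * 16 ^ K) * (δ / q) ^ C * √N := by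
    have : (0 : ℝ) < N := by exact_mod_cast hq.trans_le hqN
    positivity
  obtain ⟨d, q', 𝓑, h1, h2, h3, h4, h5⟩ :=
    hK q N I (16 * u) _ f hq hqN hX2 hI0 hI1 hR0 hR hf hs
  refine ⟨d, q', 𝓑, h1.trans ?_, h2, h3.trans ?_, h4, h5.trans (le_of_eq ?_)⟩
  · have a1 : δ ^ (-C) = u ^ C := by
      rw [hδu, one_div, Real.inv_rpow hu0.le, Real.rpow_neg hu0.le, inv_inv]
    have a2 := hrpow u (2 * K) hu1 (by rw [hC]; push_cast; linarith)
    have a3 : 1 ≤ u ^ (2 * K) := one_le_pow₀ hu1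
    rw [a1, mul_pow]
    have a4 : (16 : ℝ) ^ (2 * K) + 2 ≤ C := by rw [hC]; linarith
    calc 16 ^ (2 * K) * u ^ (2 * K) + 2 ≤ (16 ^ (2 * K) + 2) * u ^ (2 * K) := by linarith
      _ ≤ C * u ^ C := by gcongr
  · have a1 : 16 * u ≤ C / δ := by
      rw [hu, mul_one_div]
      gcongr
    have a2 : 1 ≤ C / δ := by linarith
    rw [← pow_mul, ← Real.rpow_natCast]
    refine (Real.rpow_le_rpow (by positivity) a1 (by positivity)).trans
      (Real.rpow_le_rpow_of_exponent_le a2 ?_)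
    push_cast
    gcongr
    rw [hC]; linarith
  · rw [hδu]
    field_simp
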